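/- For each of the four unordered pairs of root systems {E₈³, D₈³}, {D₁₆⊕E₈, A₁₅⊕D₉}, {D₁₂², A₁₂²}, {D₂₄, A₂₄}, there is exactly one isometry class of odd Niemeier lattice whose two even neighbors have root sublattices isometric to the members of that pair. -/

import Mathlib

open scoped BigOperators

namespace Niemeier

variable {V : Type*} [AddCommGroup V] [Module ℚ V]
variable {W : Type*} [AddCommGroup W] [Module ℚ W]

/-- The dual lattice of a `ℤ`-submodule `L` of a rational vector space `V` with respect to the
bilinear form `B`: all vectors pairing integrally with every element of `L`. -/
def dualLattice (B : V →ₗ[ℚ] V →ₗ[ℚ] ℚ) (L : Submodule ℤ V) : Submodule ℤ V where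
  carrier := {x | ∀ y ∈ L, ∃ n : ℤ, B x y = n}
  zero_mem' := by
    intro y hy
    exact ⟨0, by simp⟩
  add_mem' := by
    intro a b ha hb y hy
    obtain ⟨m, hm⟩ := ha y hy
    obtain ⟨k, hk⟩ := hb y hy
    exact ⟨m + k, by push_cast [map_add, LinearMap.add_apply, hm, hk]; rfl⟩
  smul_mem' := by
    intro c x hx y hy
    obtain ⟨m, hm⟩ := hx y hy
    refine ⟨c * m, ?_⟩
    have h1 : B (c • x) y = c • (B x y) := by
      rw [map_zsmul]; rfl
    rw [h1, hm, zsmul_eq_mul]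
    push_cast
    ring

/-- `B` is a symmetric positive-definite bilinear form. -/
def IsPosDefSymm (B : V →ₗ[ℚ] V →ₗ[ℚ] ℚ) : Prop :=
  (∀ x y, B x y = B y x) ∧ ∀ x : V, x ≠ 0 → 0 < B x x

/-- `L` is a (full-rank, integral) lattice in `V` with respect to `B`. -/
structure IsIntegralLattice (B : V →ₗ[ℚ] V →ₗ[ℚ] ℚ) (L : Submodule ℤ V) : Prop where
  fg : L.FG
  spans : Submodule.span ℚ (L : Set V) = ⊤
  integral : L ≤ dualLattice B L

/-- `L` is unimodular: it coincides with its dual lattice. -/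
def IsUnimodular (B : V →ₗ[ℚ] V →ₗ[ℚ] ℚ) (L : Submodule ℤ V) : Prop :=
  L = dualLattice B L

/-- `L` is an even lattice: all norms are even integers. -/
def IsEvenLat (B : V →ₗ[ℚ] V →ₗ[ℚ] ℚ) (L : Submodule ℤ V) : Prop :=
  ∀ v ∈ L, ∃ n : ℤ, B v v = 2 * n

/-- `L` is an odd lattice: some vector has odd (integer) norm. -/
def IsOddLat (B : V →ₗ[ℚ] V →ₗ[ℚ] ℚ) (L : Submodule ℤ V) : Prop :=
  ∃ v ∈ L, ∃ n : ℤ, B v v = 2 * n + 1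

/-- An odd Niemeier lattice: an odd positive-definite unimodular integral lattice of rank 24
(positive-definiteness of `B` is a separate hypothesis). -/
def IsOddNiemeier (B : V →ₗ[ℚ] V →ₗ[ℚ] ℚ) (N : Submodule ℤ V) : Prop :=
  IsIntegralLattice B N ∧ IsUnimodular B N ∧ IsOddLat B N ∧ Module.finrank ℚ V = 24

/-- `D` is a subgroup of index two in `L`. -/
def IndexTwo (D L : Submodule ℤ V) : Prop :=
  D ≤ L ∧ ∃ a ∈ L, a ∉ D ∧ ∀ x ∈ L, x ∈ D ∨ x - a ∈ D

/-- Two lattices are neighbors if their intersection has index two in each of them. -/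
def Neighbors (L M : Submodule ℤ V) : Prop :=
  IndexTwo (L ⊓ M) L ∧ IndexTwo (L ⊓ M) M

/-- `E` is an even neighbor of the odd Niemeier lattice `N`: an even unimodular integral
lattice (in the same ambient space) which is a neighbor of `N`. -/
def IsEvenNeighbor (B : V →ₗ[ℚ] V →ₗ[ℚ] ℚ) (N E : Submodule ℤ V) : Prop :=
  IsIntegralLattice B E ∧ IsUnimodular B E ∧ IsEvenLat B E ∧ Neighbors N E

/-- The minimum norm of `L` equals `m`. -/
def HasMinNorm (B : V →ₗ[ℚ] V →ₗ[ℚ] ℚ) (L : Submodule ℤ V) (m : ℚ) : Prop :=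
  (∃ v ∈ L, v ≠ 0 ∧ B v v = m) ∧ ∀ v ∈ L, v ≠ 0 → m ≤ B v v

/-- `N` contains a sublattice isometric to the rank-6 lattice `L⁺`, i.e. there are vectors
`h, a 0, …, a 4` in `N` realizing the Gram matrix of `L⁺`. -/
def ContainsLPlus (B : V →ₗ[ℚ] V →ₗ[ℚ] ℚ) (N : Submodule ℤ V) : Prop :=
  ∃ h ∈ N, ∃ a : Fin 5 → V, (∀ i, a i ∈ N) ∧
    B h h = 2 ∧ (∀ i, B h (a i) = 1) ∧ (∀ i, B (a i) (a i) = 3) ∧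
    ∀ i j, i ≠ j → B (a i) (a j) = 0

/-- Two lattices (in possibly different ambient spaces, with forms `B` and `C`) are isometric:
there is a `ℤ`-linear bijection between them preserving the bilinear forms. -/
def LatticeIsometric (B : V → V → ℚ) (C : W → W → ℚ)
    (L : Submodule ℤ V) (M : Submodule ℤ W) : Prop :=
  ∃ f : L ≃ₗ[ℤ] M, ∀ x y : L, C (f x) (f y) = B x y

/-- The standard dot product on `ℚⁿ`. -/
def stdDot (n : ℕ) : (Fin n → ℚ) → (Fin n → ℚ) → ℚ := fun x y => ∑ i, x i * y i

/-- The orthogonal sum of two bilinear forms. -/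
def prodForm (B : V → V → ℚ) (C : W → W → ℚ) : V × W → V × W → ℚ :=
  fun p q => B p.1 q.1 + C p.2 q.2

/-- A vector in `ℚⁿ` has integer coordinates. -/
def IsIntVec {n : ℕ} (x : Fin n → ℚ) : Prop := ∀ i, ∃ m : ℤ, x i = m

/-- The root lattice `Dₙ = {x ∈ ℤⁿ : ∑ xᵢ even}`. -/
def latD (n : ℕ) : Submodule ℤ (Fin n → ℚ) where
  carrier := {x | IsIntVec x ∧ ∃ k : ℤ, ∑ i, x i = 2 * k}
  zero_mem' := by
    refine ⟨fun i => ⟨0, by simp⟩, 0, by simp⟩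
  add_mem' := by
    rintro a b ⟨ha, k₁, hk₁⟩ ⟨hb, k₂, hk₂⟩
    refine ⟨fun i => ?_, k₁ + k₂, ?_⟩
    · obtain ⟨m, hm⟩ := ha i
      obtain ⟨m', hm'⟩ := hb i
      exact ⟨m + m', by simp [Pi.add_apply, hm, hm']⟩
    · simp only [Pi.add_apply, Finset.sum_add_distrib, hk₁, hk₂]
      push_cast
      ring
  smul_mem' := by
    rintro c x ⟨hx, k, hk⟩
    refine ⟨fun i => ?_, c * k, ?_⟩
    · obtain ⟨m, hm⟩ := hx i
      exact ⟨c * m, by simp [Pi.smul_apply, hm, zsmul_eq_mul]⟩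
    · have : ∑ i, (c • x) i = c • ∑ i, x i := by
        simp [Pi.smul_apply, Finset.smul_sum]
      rw [this, hk, zsmul_eq_mul]
      push_cast
      ring

/-- The root lattice `Aₙ = {x ∈ ℤⁿ⁺¹ : ∑ xᵢ = 0}`. -/
def latA (n : ℕ) : Submodule ℤ (Fin (n + 1) → ℚ) where
  carrier := {x | IsIntVec x ∧ ∑ i, x i = 0}
  zero_mem' := ⟨fun i => ⟨0, by simp⟩, by simp⟩
  add_mem' := by
    rintro a b ⟨ha, hka⟩ ⟨hb, hkb⟩
    refine ⟨fun i => ?_, ?_⟩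
    · obtain ⟨m, hm⟩ := ha i
      obtain ⟨m', hm'⟩ := hb i
      exact ⟨m + m', by simp [Pi.add_apply, hm, hm']⟩
    · simp [Pi.add_apply, Finset.sum_add_distrib, hka, hkb]
  smul_mem' := by
    rintro c x ⟨hx, hk⟩
    refine ⟨fun i => ?_, ?_⟩
    · obtain ⟨m, hm⟩ := hx i
      exact ⟨c * m, by simp [Pi.smul_apply, hm, zsmul_eq_mul]⟩
    · have : ∑ i, (c • x) i = c • ∑ i, x i := by
        simp [Pi.smul_apply, Finset.smul_sum]
      rw [this, hk, smul_zero]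

/-- The root lattice `E₈ = D₈ + ℤ·(½,…,½)`. -/
def latE8 : Submodule ℤ (Fin 8 → ℚ) :=
  latD 8 ⊔ Submodule.span ℤ {fun _ => (1 : ℚ) / 2}

/-- The root sublattice of `E`: the `ℤ`-span of its vectors of norm 2. -/
def rootSublattice (B : V →ₗ[ℚ] V →ₗ[ℚ] ℚ) (E : Submodule ℤ V) : Submodule ℤ V :=
  Submodule.span ℤ {v : V | v ∈ E ∧ B v v = 2}

/-- The set of even-norm vectors of `N` (the even sublattice, as a set). -/
def evenSet (B : V →ₗ[ℚ] V →ₗ[ℚ] ℚ) (N : Submodule ℤ V) : Set V :=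
  {x | x ∈ N ∧ ∃ n : ℤ, B x x = 2 * n}

/-- The unordered pair of root sublattices of `E₁` and `E₂` is isometric to the pair
`(M₁, M₂)`. -/
def RootPairIso {W₁ W₂ : Type*} [AddCommGroup W₁] [Module ℚ W₁]
    [AddCommGroup W₂] [Module ℚ W₂]
    (B : V →ₗ[ℚ] V →ₗ[ℚ] ℚ) (E₁ E₂ : Submodule ℤ V)
    (C₁ : W₁ → W₁ → ℚ) (M₁ : Submodule ℤ W₁)
    (C₂ : W₂ → W₂ → ℚ) (M₂ : Submodule ℤ W₂) : Prop :=
  (LatticeIsometric (fun x y => B x y) C₁ (rootSublattice B E₁) M₁ ∧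
    LatticeIsometric (fun x y => B x y) C₂ (rootSublattice B E₂) M₂) ∨
  (LatticeIsometric (fun x y => B x y) C₂ (rootSublattice B E₁) M₂ ∧
    LatticeIsometric (fun x y => B x y) C₁ (rootSublattice B E₂) M₁)

/-- The unordered pair of root sublattices of `E₁`, `E₂` is one of the four exceptional pairs
`{E₈³, D₈³}`, `{D₁₆⊕E₈, A₁₅⊕D₉}`, `{D₁₂², A₁₂²}`, `{D₂₄, A₂₄}`. -/
def IsExceptionalPair (B : V →ₗ[ℚ] V →ₗ[ℚ] ℚ) (E₁ E₂ : Submodule ℤ V) : Prop :=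
  RootPairIso B E₁ E₂
    (prodForm (stdDot 8) (prodForm (stdDot 8) (stdDot 8))) (latE8.prod (latE8.prod latE8))
    (prodForm (stdDot 8) (prodForm (stdDot 8) (stdDot 8))) ((latD 8).prod ((latD 8).prod (latD 8))) ∨
  RootPairIso B E₁ E₂
    (prodForm (stdDot 16) (stdDot 8)) ((latD 16).prod latE8)
    (prodForm (stdDot 16) (stdDot 9)) ((latA 15).prod (latD 9)) ∨
  RootPairIso B E₁ E₂
    (prodForm (stdDot 12) (stdDot 12)) ((latD 12).prod (latD 12))
    (prodForm (stdDot 13) (stdDot 13)) ((latA 12).prod (latA 12)) ∨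
  RootPairIso B E₁ E₂
    (stdDot 24) (latD 24)
    (stdDot 25) (latA 24)

/-- `N` is an odd Niemeier lattice (with respect to the positive-definite symmetric form `B`)
whose two even neighbors have root sublattices forming, as an unordered pair, a pair isometric
to `(M₁, M₂)`. -/
def NeighborsRootPair {V : Type*} [AddCommGroup V] [Module ℚ V]
    {W₁ W₂ : Type*} [AddCommGroup W₁] [Module ℚ W₁] [AddCommGroup W₂] [Module ℚ W₂]
    (B : V →ₗ[ℚ] V →ₗ[ℚ] ℚ) (N : Submodule ℤ V)
    (C₁ : W₁ → W₁ → ℚ) (M₁ : Submodule ℤ W₁)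
    (C₂ : W₂ → W₂ → ℚ) (M₂ : Submodule ℤ W₂) : Prop :=
  IsPosDefSymm B ∧ IsOddNiemeier B N ∧
  ∃ E₁ E₂ : Submodule ℤ V, E₁ ≠ E₂ ∧ IsEvenNeighbor B N E₁ ∧ IsEvenNeighbor B N E₂ ∧
    RootPairIso B E₁ E₂ C₁ M₁ C₂ M₂


set_option linter.unusedSectionVars false


/-- A rational number is an integer. -/
def IsZ (q : ℚ) : Prop := ∃ n : ℤ, q = n

theorem IsZ.add {a b : ℚ} (ha : IsZ a) (hb : IsZ b) : IsZ (a + b) := by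
  obtain ⟨m, rfl⟩ := ha
  obtain ⟨n, rfl⟩ := hb
  exact ⟨m + n, by push_cast; ring⟩

theorem IsZ.neg {a : ℚ} (ha : IsZ a) : IsZ (-a) := by
  obtain ⟨m, rfl⟩ := ha
  exact ⟨-m, by push_cast; ring⟩

theorem IsZ.sub {a b : ℚ} (ha : IsZ a) (hb : IsZ b) : IsZ (a - b) := by
  rw [sub_eq_add_neg]
  exact ha.add hb.neg

theorem IsZ.mul {a b : ℚ} (ha : IsZ a) (hb : IsZ b) : IsZ (a * b) := by
  obtain ⟨m, rfl⟩ := ha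
  obtain ⟨n, rfl⟩ := hb
  exact ⟨m * n, by push_cast; ring⟩

theorem isZ_int (n : ℤ) : IsZ (n : ℚ) := ⟨n, rfl⟩

theorem isZ_zero : IsZ 0 := ⟨0, by simp⟩

theorem isZ_one : IsZ 1 := ⟨1, by simp⟩

theorem IsZ.sum {ι : Type*} (s : Finset ι) (f : ι → ℚ) (h : ∀ i ∈ s, IsZ (f i)) :
    IsZ (∑ i ∈ s, f i) := by
  classical
  induction s using Finset.induction_on with
  | empty => simpa using isZ_zero
  | insert a s ha ih =>
    rw [Finset.sum_insert ha]
    exact (h a (Finset.mem_insert_self _ _)).add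
      (ih fun i hi => h i (Finset.mem_insert_of_mem hi))

theorem mem_dual {B : V →ₗ[ℚ] V →ₗ[ℚ] ℚ} {L : Submodule ℤ V} {x : V} :
    x ∈ dualLattice B L ↔ ∀ y ∈ L, IsZ (B x y) := Iff.rfl

/-- The neighbour of `E` at `t`. -/
def nb (B : V →ₗ[ℚ] V →ₗ[ℚ] ℚ) (E : Submodule ℤ V) (t : V) : Submodule ℤ V where
  carrier := {x | ∃ w ∈ E, IsZ (B w t) ∧ ∃ k : ℤ, x = w + k • t}
  zero_mem' := ⟨0, E.zero_mem, by simpa using isZ_zero, 0, by simp⟩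
  add_mem' := by
    rintro a b ⟨w, hw, h, k, rfl⟩ ⟨w', hw', h', k', rfl⟩
    refine ⟨w + w', E.add_mem hw hw', ?_, k + k', ?_⟩
    · rw [map_add, LinearMap.add_apply]
      exact h.add h'
    · rw [add_smul]
      abel
  smul_mem' := by
    rintro c x ⟨w, hw, h, k, rfl⟩
    refine ⟨c • w, E.smul_mem c hw, ?_, c * k, ?_⟩
    · rw [map_zsmul, LinearMap.smul_apply, zsmul_eq_mul]
      exact (isZ_int c).mul h
    · rw [smul_add, mul_smul]

theorem mem_nb {B : V →ₗ[ℚ] V →ₗ[ℚ] ℚ} {E : Submodule ℤ V} {t x : V} :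
    x ∈ nb B E t ↔ ∃ w ∈ E, IsZ (B w t) ∧ ∃ k : ℤ, x = w + k • t := Iff.rfl

theorem B_zsmul_left (B : V →ₗ[ℚ] V →ₗ[ℚ] ℚ) (k : ℤ) (x y : V) : B (k • x) y = k * B x y := by
  rw [map_zsmul, LinearMap.smul_apply, zsmul_eq_mul]

theorem B_zsmul_right (B : V →ₗ[ℚ] V →ₗ[ℚ] ℚ) (k : ℤ) (x y : V) : B x (k • y) = k * B x y := by
  rw [map_zsmul, zsmul_eq_mul]

theorem uni_int {B : V →ₗ[ℚ] V →ₗ[ℚ] ℚ} {E : Submodule ℤ V} (h : IsUnimodular B E) {x y : V}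
    (hx : x ∈ E) (hy : y ∈ E) : IsZ (B x y) := by
  rw [h] at hx
  exact hx y hy

theorem nb_le_of_congr {B : V →ₗ[ℚ] V →ₗ[ℚ] ℚ} (hs : ∀ x y, B x y = B y x) {E : Submodule ℤ V}
    (hu : IsUnimodular B E) (he : IsEvenLat B E) {t s : V} (hts : t - s ∈ E)
    (ht : ∃ k : ℤ, B t t = 2 * k + 1) (hs' : ∃ k : ℤ, B s s = 2 * k + 1) :
    nb B E t ≤ nb B E s := by
  rintro x ⟨w, hw, h, k, rfl⟩
  have hd : IsZ (B (t - s) s) := by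
    obtain ⟨a, ha⟩ := ht
    obtain ⟨b, hb⟩ := hs'
    obtain ⟨c, hc⟩ := he _ hts
    refine ⟨a - b - c, ?_⟩
    have := hs s t
    simp only [map_sub, LinearMap.sub_apply] at hc ⊢
    push_cast
    linarith
  refine ⟨w + k • (t - s), E.add_mem hw (E.smul_mem _ hts), ?_, k, ?_⟩
  · rw [map_add, LinearMap.add_apply, B_zsmul_left]
    refine IsZ.add ?_ ((isZ_int k).mul hd)
    have h2 := h.sub (uni_int hu hw hts)
    rw [map_sub] at h2
    simpa using h2
  · rw [smul_sub]
    abel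

theorem nb_congr {B : V →ₗ[ℚ] V →ₗ[ℚ] ℚ} (hs : ∀ x y, B x y = B y x) {E : Submodule ℤ V}
    (hu : IsUnimodular B E) (he : IsEvenLat B E) {t s : V} (hts : t - s ∈ E)
    (ht : ∃ k : ℤ, B t t = 2 * k + 1) (hs' : ∃ k : ℤ, B s s = 2 * k + 1) :
    nb B E t = nb B E s :=
  le_antisymm (nb_le_of_congr hs hu he hts ht hs')
    (nb_le_of_congr hs hu he (by rw [← neg_sub]; exact E.neg_mem hts) hs' ht)

/-- Even vectors of `N` belong to any even neighbour. -/
theorem even_mem {B : V →ₗ[ℚ] V →ₗ[ℚ] ℚ} (hs : ∀ x y, B x y = B y x) {N E : Submodule ℤ V}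
    (hN : IsOddNiemeier B N) (hE : IsEvenNeighbor B N E) {x : V} (hx : x ∈ N)
    (hx2 : ∃ n : ℤ, B x x = 2 * n) : x ∈ E := by
  obtain ⟨-, hNu, ⟨u, hu, m, hm⟩, -⟩ := hN
  obtain ⟨-, hEu, hEe, ⟨⟨-, a, ha, haN, hcos⟩, -⟩⟩ := hE
  by_contra hxE
  have huE : u ∉ E := by
    intro h
    obtain ⟨k, hk⟩ := hEe u h
    rw [hm] at hk
    have : (2 * m + 1 : ℤ) = 2 * k := by exact_mod_cast hk
    omega
  have h1 : x - a ∈ N ⊓ E := (hcos x hx).resolve_left fun h => hxE h.2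
  have h2 : u - a ∈ N ⊓ E := (hcos u hu).resolve_left fun h => huE h.2
  have h3 : x - u ∈ N ⊓ E := by
    have := (N ⊓ E).sub_mem h1 h2
    simpa using this
  obtain ⟨k, hk⟩ := hEe _ h3.2
  obtain ⟨n, hn⟩ := hx2
  obtain ⟨j, hj⟩ := uni_int hNu hx hu
  have := hs x u
  simp only [map_sub, LinearMap.sub_apply] at hk
  have h4 : (2 * n + (2 * m + 1) - 2 * j : ℚ) = 2 * k := by linarith
  have : (2 * n + (2 * m + 1) - 2 * j : ℤ) = 2 * k := by exact_mod_cast h4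
  omega

theorem extract {B : V →ₗ[ℚ] V →ₗ[ℚ] ℚ} (hs : ∀ x y, B x y = B y x) {N E E' : Submodule ℤ V}
    (hN : IsOddNiemeier B N) (hE : IsEvenNeighbor B N E) (hE' : IsEvenNeighbor B N E') :
    ∃ t : V, (2 : ℤ) • t ∈ E ∧ (∃ k : ℤ, B t t = 2 * k + 1) ∧ N = nb B E t ∧
      ∀ x ∈ E, B x x = 2 → IsZ (B x t) → x ∈ E' := by
  have hN' := hN
  obtain ⟨-, hNu, ⟨t, ht, m, hm⟩, -⟩ := hN
  have hE2 := hE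
  obtain ⟨-, hEu, hEe, ⟨⟨-, a, ha, haN, hcos⟩, -⟩⟩ := hE
  have htE : t ∉ E := by
    intro h
    obtain ⟨k, hk⟩ := hEe t h
    rw [hm] at hk
    have : (2 * m + 1 : ℤ) = 2 * k := by exact_mod_cast hk
    omega
  have hta : t - a ∈ N ⊓ E := (hcos t ht).resolve_left fun h => htE h.2
  have h2t : (2 : ℤ) • t ∈ E := by
    refine even_mem hs hN' hE2 (N.smul_mem _ ht) ⟨2 * (2 * m + 1), ?_⟩
    rw [B_zsmul_left, B_zsmul_right, hm]
    push_cast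
    ring
  have key : ∀ x ∈ E, IsZ (B x t) → x ∈ N := by
    intro x hx hxt
    rw [hNu]
    intro y hy
    rcases hcos y hy with h | h
    · exact uni_int hEu hx h.2
    · have h3 : y - t ∈ N ⊓ E := by
        have := (N ⊓ E).sub_mem h hta
        simpa using this
      have := (uni_int hEu hx h3.2).add hxt
      rw [map_sub, sub_add_cancel] at this
      exact this
  refine ⟨t, h2t, ⟨m, hm⟩, ?_, ?_⟩
  · apply le_antisymm
    · intro x hx
      rcases hcos x hx with h | h
      · exact ⟨x, h.2, uni_int hNu hx ht, 0, by simp⟩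
      · have h3 : x - t ∈ N ⊓ E := by
          have := (N ⊓ E).sub_mem h hta
          simpa using this
        exact ⟨x - t, h3.2, uni_int hNu h3.1 ht, 1, by simp⟩
    · rintro x ⟨w, hw, h, k, rfl⟩
      exact N.add_mem (key w hw h) (N.smul_mem _ ht)
  · intro x hx hx2 hxt
    exact even_mem hs hN' hE' (key x hx hxt) ⟨1, by rw [hx2]; norm_num⟩

/-- Additive maps from subgroups to rational vector spaces extend. -/
theorem exists_ext (F : Submodule ℤ V) (f : F →ₗ[ℤ] W) :
    ∃ g : V →ₗ[ℚ] W, ∀ x : F, g x = f x := by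
  let _ : DivisibleBy W ℤ :=
    { div := fun x n => ((n : ℚ)⁻¹) • x
      div_zero := fun x => by simp
      div_cancel := fun {n} x hn => by
        have hn' : (n : ℚ) ≠ 0 := by exact_mod_cast hn
        rw [← Int.cast_smul_eq_zsmul ℚ, smul_smul, mul_inv_cancel₀ hn', one_smul] }
  obtain ⟨h, hh⟩ := (Module.Baer.of_divisible W).extension_property_addMonoidHom
    (f := F.subtype.toAddMonoidHom) Subtype.val_injective f.toAddMonoidHom
  refine ⟨h.toRatLinearMap, fun x => ?_⟩
  exact DFunLike.congr_fun hh x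

/-- Image of a lattice under a rational isomorphism. -/
def mapL (e : V ≃ₗ[ℚ] W) (L : Submodule ℤ V) : Submodule ℤ W :=
  L.map (e.toLinearMap.restrictScalars ℤ)

theorem mem_mapL {e : V ≃ₗ[ℚ] W} {L : Submodule ℤ V} {y : W} :
    y ∈ mapL e L ↔ e.symm y ∈ L := by
  constructor
  · rintro ⟨x, hx, rfl⟩
    simpa using hx
  · intro h
    exact ⟨e.symm y, h, by simp⟩

theorem map_mem_mapL {e : V ≃ₗ[ℚ] W} {L : Submodule ℤ V} {x : V} :
    e x ∈ mapL e L ↔ x ∈ L := by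
  rw [mem_mapL, LinearEquiv.symm_apply_apply]

/-- `e` carries the form `B` to the form `C`. -/
def Isom (B : V →ₗ[ℚ] V →ₗ[ℚ] ℚ) (C : W →ₗ[ℚ] W →ₗ[ℚ] ℚ) (e : V ≃ₗ[ℚ] W) : Prop :=
  ∀ x y, C (e x) (e y) = B x y

theorem Isom.symm {B : V →ₗ[ℚ] V →ₗ[ℚ] ℚ} {C : W →ₗ[ℚ] W →ₗ[ℚ] ℚ} {e : V ≃ₗ[ℚ] W}
    (h : Isom B C e) : Isom C B e.symm := by
  intro x y
  rw [← h]
  simp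

section
variable {B : V →ₗ[ℚ] V →ₗ[ℚ] ℚ} {C : W →ₗ[ℚ] W →ₗ[ℚ] ℚ} {e : V ≃ₗ[ℚ] W}

theorem Isom.symm_left (h : Isom B C e) (x : W) (y : V) : B (e.symm x) y = C x (e y) := by
  rw [← h]
  simp

theorem mapL_dual (h : Isom B C e) (L : Submodule ℤ V) :
    mapL e (dualLattice B L) = dualLattice C (mapL e L) := by
  ext y
  rw [mem_mapL, mem_dual, mem_dual]
  constructor
  · intro hy z hz
    rw [mem_mapL] at hz
    have := hy _ hz
    rwa [h.symm_left, LinearEquiv.apply_symm_apply] at this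
  · intro hy z hz
    rw [h.symm_left]
    exact hy _ (map_mem_mapL.2 hz)

theorem mapL_uni (h : Isom B C e) {L : Submodule ℤ V} (hL : IsUnimodular B L) :
    IsUnimodular C (mapL e L) := by
  unfold IsUnimodular at *
  rw [← mapL_dual h, ← hL]

theorem mapL_even (h : Isom B C e) {L : Submodule ℤ V} (hL : IsEvenLat B L) :
    IsEvenLat C (mapL e L) := by
  intro v hv
  rw [mem_mapL] at hv
  have := hL _ hv
  rwa [h.symm_left, LinearEquiv.apply_symm_apply] at this

theorem mapL_odd (h : Isom B C e) {L : Submodule ℤ V} (hL : IsOddLat B L) :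
    IsOddLat C (mapL e L) := by
  obtain ⟨v, hv, n, hn⟩ := hL
  exact ⟨e v, map_mem_mapL.2 hv, n, by rw [h, hn]⟩

theorem mapL_inf (L M : Submodule ℤ V) : mapL e (L ⊓ M) = mapL e L ⊓ mapL e M := by
  ext y
  simp [mem_mapL]

theorem mapL_index {D L : Submodule ℤ V} (hL : IndexTwo D L) :
    IndexTwo (mapL e D) (mapL e L) := by
  obtain ⟨h, a, ha, haD, hc⟩ := hL
  refine ⟨?_, e a, map_mem_mapL.2 ha, fun h' => haD (map_mem_mapL.1 h'), ?_⟩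
  · intro x hx
    exact mem_mapL.2 (h (mem_mapL.1 hx))
  · intro x hx
    rcases hc _ (mem_mapL.1 hx) with h1 | h1
    · exact Or.inl (mem_mapL.2 h1)
    · refine Or.inr (mem_mapL.2 ?_)
      simpa using h1

theorem mapL_latt (h : Isom B C e) {L : Submodule ℤ V} (hL : IsIntegralLattice B L) :
    IsIntegralLattice C (mapL e L) := by
  refine ⟨hL.fg.map _, ?_, ?_⟩
  · have : ((mapL e L : Submodule ℤ W) : Set W) = e.toLinearMap '' (L : Set V) := by
      unfold mapL
      rw [Submodule.map_coe]
      rfl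
    rw [this, Submodule.span_image, hL.spans, Submodule.map_top, LinearEquiv.range]
  · rw [← mapL_dual h]
    exact Submodule.map_mono hL.integral

theorem mapL_nb (h : Isom B C e) (E : Submodule ℤ V) (t : V) :
    mapL e (nb B E t) = nb C (mapL e E) (e t) := by
  ext y
  rw [mem_mapL, mem_nb, mem_nb]
  constructor
  · rintro ⟨w, hw, hwt, k, hk⟩
    refine ⟨e w, map_mem_mapL.2 hw, by rwa [h], k, ?_⟩
    rw [← map_zsmul, ← map_add, ← hk, LinearEquiv.apply_symm_apply]
  · rintro ⟨w, hw, hwt, k, rfl⟩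
    refine ⟨e.symm w, mem_mapL.1 hw, by rwa [h.symm_left], k, ?_⟩
    rw [map_add, map_zsmul, LinearEquiv.symm_apply_apply]

theorem mapL_root (h : Isom B C e) (E : Submodule ℤ V) :
    mapL e (rootSublattice B E) = rootSublattice C (mapL e E) := by
  unfold rootSublattice mapL
  rw [Submodule.map_span]
  congr 1
  ext y
  constructor
  · rintro ⟨x, ⟨hx, hx2⟩, rfl⟩
    exact ⟨⟨x, hx, rfl⟩, by rw [← hx2]; exact h x x⟩
  · rintro ⟨⟨x, hx, rfl⟩, hx2⟩
    exact ⟨x, ⟨hx, by rw [← hx2]; exact (h x x).symm⟩, rfl⟩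

theorem mapL_iso (h : Isom B C e) (L : Submodule ℤ V) :
    LatticeIsometric (fun x y => B x y) (fun x y => C x y) L (mapL e L) := by
  refine ⟨Submodule.equivMapOfInjective (e.toLinearMap.restrictScalars ℤ) e.injective L, ?_⟩
  intro x y
  exact h x y

end

theorem LatticeIsometric.symm' {B : V → V → ℚ} {C : W → W → ℚ} {L : Submodule ℤ V}
    {M : Submodule ℤ W} (h : LatticeIsometric B C L M) : LatticeIsometric C B M L := by
  obtain ⟨f, hf⟩ := h
  refine ⟨f.symm, fun x y => ?_⟩
  rw [← hf]
  simp

theorem LatticeIsometric.trans' {U : Type*} [AddCommGroup U] [Module ℚ U]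
    {B : V → V → ℚ} {C : W → W → ℚ} {D : U → U → ℚ} {L : Submodule ℤ V}
    {M : Submodule ℤ W} {K : Submodule ℤ U} (h : LatticeIsometric B C L M)
    (h' : LatticeIsometric C D M K) : LatticeIsometric B D L K := by
  obtain ⟨f, hf⟩ := h
  obtain ⟨g, hg⟩ := h'
  refine ⟨f.trans g, fun x y => ?_⟩
  rw [← hf, ← hg]
  rfl

/-- Transport of the whole situation along a rational isometry. -/
theorem NeighborsRootPair.transport {W₁ W₂ : Type*} [AddCommGroup W₁] [Module ℚ W₁]
    [AddCommGroup W₂] [Module ℚ W₂]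
    {B : V →ₗ[ℚ] V →ₗ[ℚ] ℚ} {C : W →ₗ[ℚ] W →ₗ[ℚ] ℚ} {e : V ≃ₗ[ℚ] W} (h : Isom B C e)
    {N : Submodule ℤ V} {C₁ : W₁ → W₁ → ℚ} {M₁ : Submodule ℤ W₁}
    {C₂ : W₂ → W₂ → ℚ} {M₂ : Submodule ℤ W₂}
    (hN : NeighborsRootPair B N C₁ M₁ C₂ M₂) :
    NeighborsRootPair C (mapL e N) C₁ M₁ C₂ M₂ := by
  obtain ⟨⟨hs, hp⟩, ⟨h1, h2, h3, h4⟩, E₁, E₂, hne, hE₁, hE₂, hr⟩ := hN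
  have tr : ∀ {E : Submodule ℤ V}, IsEvenNeighbor B N E →
      IsEvenNeighbor C (mapL e N) (mapL e E) := by
    rintro E ⟨g1, g2, g3, g4, g5⟩
    refine ⟨mapL_latt h g1, mapL_uni h g2, mapL_even h g3, ?_, ?_⟩
    · rw [← mapL_inf]
      exact mapL_index g4
    · rw [← mapL_inf]
      exact mapL_index g5
  have ri : ∀ (E : Submodule ℤ V), LatticeIsometric (fun x y => C x y) (fun x y => B x y)
      (rootSublattice C (mapL e E)) (rootSublattice B E) := by
    intro E
    rw [← mapL_root h]
    exact (mapL_iso h _).symm'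
  refine ⟨⟨?_, ?_⟩, ⟨mapL_latt h h1, mapL_uni h h2, mapL_odd h h3, ?_⟩,
    mapL e E₁, mapL e E₂, ?_, tr hE₁, tr hE₂, ?_⟩
  · intro x y
    rw [← h.symm, ← h.symm, hs]
  · intro x hx
    rw [← h.symm]
    exact hp _ (by simpa using hx)
  · rw [← h4]
    exact e.symm.finrank_eq
  · intro h'
    apply hne
    ext x
    rw [← map_mem_mapL (e := e), h', map_mem_mapL]
  · rcases hr with ⟨r1, r2⟩ | ⟨r1, r2⟩
    · exact Or.inl ⟨(ri _).trans' r1, (ri _).trans' r2⟩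
    · exact Or.inr ⟨(ri _).trans' r1, (ri _).trans' r2⟩

/-- The data extracted from an odd lattice with its neighbours, in coordinates adapted to the
first neighbour. -/
structure Cfg {W₂ : Type*} [AddCommGroup W₂] [Module ℚ W₂]
    (C : W →ₗ[ℚ] W →ₗ[ℚ] ℚ) (M : Submodule ℤ W) (C₂ : W₂ →ₗ[ℚ] W₂ →ₗ[ℚ] ℚ)
    (M₂ : Submodule ℤ W₂) (E : Submodule ℤ W) (t : W) : Prop where
  uni : IsUnimodular C E
  even : IsEvenLat C E
  le : M ≤ E
  root : ∀ x ∈ E, C x x = 2 → x ∈ M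
  two : (2 : ℤ) • t ∈ E
  odd : ∃ k : ℤ, C t t = 2 * k + 1
  emb : ∃ Φ : W →ₗ[ℚ] W₂, (∀ x ∈ E, C x x = 2 → IsZ (C x t) → Φ x ∈ M₂) ∧
    ∀ x ∈ E, ∀ y ∈ E, C x x = 2 → C y y = 2 → IsZ (C x t) → IsZ (C y t) →
      C₂ (Φ x) (Φ y) = C x y

theorem Cfg.map {W₂ : Type*} [AddCommGroup W₂] [Module ℚ W₂]
    {C : W →ₗ[ℚ] W →ₗ[ℚ] ℚ} {M : Submodule ℤ W} {C₂ : W₂ →ₗ[ℚ] W₂ →ₗ[ℚ] ℚ}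
    {M₂ : Submodule ℤ W₂} {E : Submodule ℤ W} {t : W} (h : Cfg C M C₂ M₂ E t)
    {e : W ≃ₗ[ℚ] W} (he : Isom C C e) (hM : ∀ x, x ∈ M ↔ e x ∈ M) :
    Cfg C M C₂ M₂ (mapL e E) (e t) := by
  obtain ⟨Φ, h1, h2⟩ := h.emb
  refine ⟨mapL_uni he h.uni, mapL_even he h.even, ?_, ?_, ?_, ?_, Φ.comp e.symm.toLinearMap,
    ?_, ?_⟩
  · intro x hx
    rw [mem_mapL]
    apply h.le
    rw [hM]
    simpa using hx
  · intro x hx hx2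
    have := h.root _ (mem_mapL.1 hx) (by rw [he.symm]; exact hx2)
    rw [hM] at this
    simpa using this
  · rw [← map_zsmul, map_mem_mapL]
    exact h.two
  · rw [he]
    exact h.odd
  · intro x hx hx2 hxt
    exact h1 (e.symm x) (mem_mapL.1 hx) (by rw [he.symm]; exact hx2) (by rwa [he.symm_left])
  · intro x hx y hy hx2 hy2 hxt hyt
    rw [← he.symm x y]
    exact h2 (e.symm x) (mem_mapL.1 hx) (e.symm y) (mem_mapL.1 hy) (by rw [he.symm]; exact hx2)
      (by rw [he.symm]; exact hy2) (by rwa [he.symm_left]) (by rwa [he.symm_left])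

theorem form_ext {B : V →ₗ[ℚ] V →ₗ[ℚ] ℚ} {C : W →ₗ[ℚ] W →ₗ[ℚ] ℚ} (g : V →ₗ[ℚ] W) (S : Set V)
    (h : ∀ x ∈ S, ∀ y ∈ S, C (g x) (g y) = B x y) {x y : V}
    (hx : x ∈ Submodule.span ℚ S) (hy : y ∈ Submodule.span ℚ S) : C (g x) (g y) = B x y := by
  induction hx using Submodule.span_induction with
  | zero => simp
  | add a b _ _ iha ihb => simp [iha, ihb]
  | smul c a _ iha => simp [iha]
  | mem a ha =>
    induction hy using Submodule.span_induction with
    | zero => simp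
    | add c d _ _ ihc ihd => simp [ihc, ihd]
    | smul c d _ ihd => simp [ihd]
    | mem b hb => exact h a ha b hb

theorem toCfg_aux {W₂ : Type*} [AddCommGroup W₂] [Module ℚ W₂]
    [FiniteDimensional ℚ V] [FiniteDimensional ℚ W]
    {B : V →ₗ[ℚ] V →ₗ[ℚ] ℚ} {N : Submodule ℤ V}
    {C : W →ₗ[ℚ] W →ₗ[ℚ] ℚ} {M : Submodule ℤ W} {C₂ : W₂ →ₗ[ℚ] W₂ →ₗ[ℚ] ℚ}
    {M₂ : Submodule ℤ W₂} (hC : IsPosDefSymm C) (hspan : Submodule.span ℚ (M : Set W) = ⊤)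
    (hdim : Module.finrank ℚ W = Module.finrank ℚ V) (hB : IsPosDefSymm B)
    (hN : IsOddNiemeier B N) {E E' : Submodule ℤ V} (hE : IsEvenNeighbor B N E)
    (hE' : IsEvenNeighbor B N E')
    (h1 : LatticeIsometric (fun x y => B x y) (fun x y => C x y) (rootSublattice B E) M)
    (h2 : LatticeIsometric (fun x y => B x y) (fun x y => C₂ x y) (rootSublattice B E') M₂) :
    ∃ E₁ t, Cfg C M C₂ M₂ E₁ t ∧
      LatticeIsometric (fun x y => B x y) (fun x y => C x y) N (nb C E₁ t) := by
  obtain ⟨f, hf⟩ := h1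
  obtain ⟨f', hf'⟩ := h2
  obtain ⟨t, h2t, hodd, hNt, hroots⟩ := extract hB.1 hN hE hE'
  obtain ⟨g, hg⟩ := exists_ext M ((rootSublattice B E).subtype.comp f.symm.toLinearMap)
  obtain ⟨Φ, hΦ⟩ := exists_ext (rootSublattice B E') (M₂.subtype.comp f'.toLinearMap)
  have hgM : ∀ x (hx : x ∈ M), g x = (f.symm ⟨x, hx⟩ : V) := fun x hx => hg ⟨x, hx⟩
  have giso : ∀ x y, B (g x) (g y) = C x y := by
    intro x y
    refine form_ext (B := C) (C := B) g (M : Set W) ?_ (by rw [hspan]; trivial)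
      (by rw [hspan]; trivial)
    intro x hx y hy
    rw [hgM x hx, hgM y hy]
    have := hf (f.symm ⟨x, hx⟩) (f.symm ⟨y, hy⟩)
    simp only [LinearEquiv.apply_symm_apply] at this
    exact this.symm
  have ginj : Function.Injective g := by
    rw [injective_iff_map_eq_zero]
    intro x hx
    by_contra hne
    have := hC.2 x hne
    rw [← giso, hx] at this
    simp at this
  let e : W ≃ₗ[ℚ] V := LinearEquiv.ofInjectiveOfFinrankEq g ginj hdim
  have heg : ∀ x, e x = g x := fun x => rfl
  have he : Isom C B e := giso
  have hs := he.symm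
  refine ⟨mapL e.symm E, e.symm t, ⟨mapL_uni hs hE.2.1, mapL_even hs hE.2.2.1, ?_, ?_, ?_, ?_,
    Φ.comp e.toLinearMap, ?_, ?_⟩, ?_⟩
  · intro x hx
    rw [mem_mapL, LinearEquiv.symm_symm, heg, hgM x hx]
    have h3 : rootSublattice B E ≤ E := by
      unfold rootSublattice
      rw [Submodule.span_le]
      exact fun y hy => hy.1
    exact h3 (f.symm ⟨x, hx⟩).2
  · intro x hx hx2
    rw [mem_mapL, LinearEquiv.symm_symm] at hx
    have hr : e x ∈ rootSublattice B E := Submodule.subset_span ⟨hx, by rw [he, hx2]⟩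
    have h3 : e (f ⟨e x, hr⟩) = e x := by
      rw [heg, hgM _ (f ⟨e x, hr⟩).2]
      simp
    rw [← e.injective h3]
    exact (f ⟨e x, hr⟩).2
  · rw [← map_zsmul, map_mem_mapL]
    exact h2t
  · rw [hs]
    exact hodd
  · intro x hx hx2 hxt
    rw [mem_mapL, LinearEquiv.symm_symm] at hx
    rw [← hs.symm_left, LinearEquiv.symm_symm] at hxt
    have h3 := hroots _ hx (by rw [he, hx2]) hxt
    have hr : e x ∈ rootSublattice B E' := Submodule.subset_span ⟨h3, by rw [he, hx2]⟩
    have := hΦ ⟨e x, hr⟩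
    simp only [LinearMap.comp_apply] at this ⊢
    change Φ (e x) ∈ M₂
    rw [this]
    exact (f' ⟨e x, hr⟩).2
  · intro x hx y hy hx2 hy2 hxt hyt
    rw [mem_mapL, LinearEquiv.symm_symm] at hx hy
    rw [← hs.symm_left, LinearEquiv.symm_symm] at hxt hyt
    have h3 := hroots _ hx (by rw [he, hx2]) hxt
    have hr : e x ∈ rootSublattice B E' := Submodule.subset_span ⟨h3, by rw [he, hx2]⟩
    have h3' := hroots _ hy (by rw [he, hy2]) hyt
    have hr' : e y ∈ rootSublattice B E' := Submodule.subset_span ⟨h3', by rw [he, hy2]⟩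
    have a1 := hΦ ⟨e x, hr⟩
    have a2 := hΦ ⟨e y, hr'⟩
    change C₂ (Φ (e x)) (Φ (e y)) = _
    simp only at a1 a2
    rw [a1, a2, ← he]
    exact hf' _ _
  · rw [← mapL_nb hs, ← hNt]
    exact mapL_iso hs N

theorem toCfg {W₂ : Type*} [AddCommGroup W₂] [Module ℚ W₂]
    [FiniteDimensional ℚ V] [FiniteDimensional ℚ W]
    {B : V →ₗ[ℚ] V →ₗ[ℚ] ℚ} {N : Submodule ℤ V}
    {C : W →ₗ[ℚ] W →ₗ[ℚ] ℚ} {M : Submodule ℤ W} {C₂ : W₂ →ₗ[ℚ] W₂ →ₗ[ℚ] ℚ}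
    {M₂ : Submodule ℤ W₂} (hC : IsPosDefSymm C) (hspan : Submodule.span ℚ (M : Set W) = ⊤)
    (hdim : Module.finrank ℚ W = 24)
    (h : NeighborsRootPair B N (fun x y => C x y) M (fun x y => C₂ x y) M₂) :
    ∃ E₁ t, Cfg C M C₂ M₂ E₁ t ∧
      LatticeIsometric (fun x y => B x y) (fun x y => C x y) N (nb C E₁ t) := by
  obtain ⟨hB, hN, E₁, E₂, -, hE₁, hE₂, hr⟩ := h
  have hd : Module.finrank ℚ W = Module.finrank ℚ V := by rw [hdim, hN.2.2.2]
  rcases hr with ⟨r1, r2⟩ | ⟨r1, r2⟩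
  · exact toCfg_aux hC hspan hd hB hN hE₁ hE₂ r1 r2
  · exact toCfg_aux hC hspan hd hB hN hE₂ hE₁ r2 r1

/-- Uniqueness from a normal form statement. -/
theorem unique_of_normal {W₂ : Type*} [AddCommGroup W₂] [Module ℚ W₂]
    [FiniteDimensional ℚ V] [FiniteDimensional ℚ W]
    {C : W →ₗ[ℚ] W →ₗ[ℚ] ℚ} {M : Submodule ℤ W} {C₂ : W₂ →ₗ[ℚ] W₂ →ₗ[ℚ] ℚ}
    {M₂ : Submodule ℤ W₂} (hC : IsPosDefSymm C) (hspan : Submodule.span ℚ (M : Set W) = ⊤)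
    (hdim : Module.finrank ℚ W = 24) (E₀ : Submodule ℤ W) (t₀ : W)
    (ht₀ : ∃ k : ℤ, C t₀ t₀ = 2 * k + 1)
    (normal : ∀ E t, Cfg C M C₂ M₂ E t → ∃ e : W ≃ₗ[ℚ] W, Isom C C e ∧ mapL e E = E₀ ∧
      e t - t₀ ∈ E₀)
    {B₁ B₂ : V →ₗ[ℚ] V →ₗ[ℚ] ℚ} {N₁ N₂ : Submodule ℤ V}
    (h₁ : NeighborsRootPair B₁ N₁ (fun x y => C x y) M (fun x y => C₂ x y) M₂)
    (h₂ : NeighborsRootPair B₂ N₂ (fun x y => C x y) M (fun x y => C₂ x y) M₂) :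
    LatticeIsometric (fun x y => B₁ x y) (fun x y => B₂ x y) N₁ N₂ := by
  have key : ∀ {B : V →ₗ[ℚ] V →ₗ[ℚ] ℚ} {N : Submodule ℤ V},
      NeighborsRootPair B N (fun x y => C x y) M (fun x y => C₂ x y) M₂ →
      LatticeIsometric (fun x y => B x y) (fun x y => C x y) N (nb C E₀ t₀) := by
    intro B N h
    obtain ⟨E, t, hc, hi⟩ := toCfg hC hspan hdim h
    obtain ⟨e, he, hE, ht⟩ := normal E t hc
    refine hi.trans' ?_
    have h3 : mapL e (nb C E t) = nb C E₀ t₀ := by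
      rw [mapL_nb he, hE]
      refine nb_congr hC.1 ?_ ?_ ht ?_ ht₀
      · rw [← hE]
        exact mapL_uni he hc.uni
      · rw [← hE]
        exact mapL_even he hc.even
      · rw [he]
        exact hc.odd
    rw [← h3]
    exact mapL_iso he _
  exact (key h₁).trans' (key h₂).symm'



theorem IsZ.half {q : ℚ} (h2 : IsZ (2 * q)) (h : ¬ IsZ q) : ∃ m : ℤ, q = m + 1 / 2 := by
  obtain ⟨n, hn⟩ := h2
  rcases Int.even_or_odd' n with ⟨k, rfl | rfl⟩
  · exact absurd ⟨k, by push_cast at hn; linarith⟩ h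
  · exact ⟨k, by push_cast at hn; linarith⟩

theorem fg_of_integral [FiniteDimensional ℚ V] {B : V →ₗ[ℚ] V →ₗ[ℚ] ℚ} (hB : IsPosDefSymm B)
    {L : Submodule ℤ V} (hspan : Submodule.span ℚ (L : Set V) = ⊤)
    (hL : L ≤ dualLattice B L) : L.FG := by
  obtain ⟨b, hbL, hbspan, hbi⟩ := exists_linearIndependent ℚ (L : Set V)
  have hfin : Finite b := hbi.finite
  let f : V →ₗ[ℤ] (b → ℚ) := (LinearMap.pi fun i : b => B i).restrictScalars ℤ
  have finj : Function.Injective f := by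
    rw [injective_iff_map_eq_zero]
    intro x hx
    have h1 : ∀ i ∈ b, B i x = 0 := fun i hi => congrFun hx ⟨i, hi⟩
    have h2 : ∀ y ∈ Submodule.span ℚ b, B y x = 0 := by
      intro y hy
      induction hy using Submodule.span_induction with
      | zero => simp
      | add a b _ _ iha ihb => simp [iha, ihb]
      | smul c a _ iha => simp [iha]
      | mem a ha => exact h1 a ha
    by_contra hne
    have h3 := hB.2 x hne
    rw [h2 x (by rw [hbspan, hspan]; trivial)] at h3
    exact lt_irrefl _ h3
  refine Submodule.fg_of_fg_map_injective f finj ?_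
  let Z : (b → ℤ) →ₗ[ℤ] (b → ℚ) := LinearMap.pi fun i =>
    (Algebra.linearMap ℤ ℚ).comp (LinearMap.proj i)
  have hZ : (LinearMap.range Z).FG := by
    rw [LinearMap.range_eq_map]
    exact (Module.Finite.fg_top (R := ℤ) (M := b → ℤ)).map Z
  refine hZ.of_le ?_
  rintro _ ⟨x, hx, rfl⟩
  have h1 : ∀ i : b, ∃ n : ℤ, B i x = n := fun i => hL (hbL i.2) x hx
  choose n hn using h1
  exact ⟨n, funext fun i => (hn i).symm⟩

section nbsec
variable {B : V →ₗ[ℚ] V →ₗ[ℚ] ℚ} {E : Submodule ℤ V} {t t' : V}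

theorem self_mem_nb : t ∈ nb B E t := ⟨0, E.zero_mem, by simpa using isZ_zero, 1, by simp⟩

theorem mem_nb_of {x : V} (hx : x ∈ E) (h : IsZ (B x t)) : x ∈ nb B E t :=
  ⟨x, hx, h, 0, by simp⟩

theorem B_two (x : V) : B ((2 : ℤ) • x) t = 2 * B x t := by
  rw [B_zsmul_left]
  norm_num

theorem two_pair (hs : ∀ x y, B x y = B y x) (hu : IsUnimodular B E) (h2 : (2 : ℤ) • t ∈ E) {w : V}
    (hw : w ∈ E) : IsZ (2 * B w t) := by
  have := uni_int hu h2 hw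
  rwa [B_two, hs] at this

theorem nb_cases (h2 : (2 : ℤ) • t ∈ E) (hZ : IsZ (B t t)) {x : V} (hx : x ∈ nb B E t) :
    (x ∈ E ∧ IsZ (B x t)) ∨ (x - t ∈ E ∧ IsZ (B (x - t) t)) := by
  obtain ⟨w, hw, h, k, rfl⟩ := hx
  have aux : ∀ j : ℤ, w + (2 * j) • t ∈ E ∧ IsZ (B (w + (2 * j) • t) t) := by
    intro j
    constructor
    · rw [mul_comm, mul_smul]
      exact E.add_mem hw (E.smul_mem _ h2)
    · rw [map_add, LinearMap.add_apply, B_zsmul_left]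
      exact h.add ((isZ_int _).mul hZ)
  rcases Int.even_or_odd' k with ⟨j, rfl | rfl⟩
  · exact Or.inl (aux j)
  · right
    have : w + (2 * j + 1) • t - t = w + (2 * j) • t := by
      rw [add_smul, one_smul]
      abel
    rw [this]
    exact aux j

theorem nb_int (hs : ∀ x y, B x y = B y x) (hu : IsUnimodular B E) (hZ : IsZ (B t t)) :
    nb B E t ≤ dualLattice B (nb B E t) := by
  rintro x ⟨w, hw, h, k, rfl⟩ y ⟨w', hw', h', k', rfl⟩
  have h3 := uni_int hu hw hw'
  change IsZ _
  simp only [map_add, LinearMap.add_apply, B_zsmul_left, B_zsmul_right]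
  rw [hs t w']
  exact (h3.add ((isZ_int k).mul h')).add
    (((isZ_int k').mul h).add ((isZ_int k').mul ((isZ_int k).mul hZ)))

theorem nb_uni (hs : ∀ x y, B x y = B y x) (hu : IsUnimodular B E) (h2 : (2 : ℤ) • t ∈ E)
    (hZ : IsZ (B t t)) : IsUnimodular B (nb B E t) := by
  refine le_antisymm (nb_int hs hu hZ) ?_
  intro x hx
  have hxt : IsZ (B x t) := hx t self_mem_nb
  by_cases hall : ∀ w ∈ E, IsZ (B x w)
  · refine mem_nb_of ?_ hxt
    rw [hu]
    exact hall
  · push Not at hall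
    obtain ⟨w₀, hw₀, hn⟩ := hall
    have hn' : ¬ IsZ (B w₀ t) := fun h => hn (hx w₀ (mem_nb_of hw₀ h))
    have hx2 : ∀ w ∈ E, IsZ (2 * B x w) := by
      intro w hw
      have := hx ((2 : ℤ) • w) (mem_nb_of (E.smul_mem _ hw) (by
        rw [B_two]; exact two_pair hs hu h2 hw))
      rw [B_zsmul_right] at this
      exact_mod_cast this
    have h3 : x - t ∈ E := by
      rw [hu]
      intro w hw
      change IsZ _
      rw [map_sub, LinearMap.sub_apply]
      by_cases hwt : IsZ (B w t)
      · rw [hs t w]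
        exact IsZ.sub (hx w (mem_nb_of hw hwt)) hwt
      · obtain ⟨a, ha⟩ := (two_pair hs hu h2 hw).half hwt
        obtain ⟨b, hb⟩ := (two_pair hs hu h2 hw₀).half hn'
        obtain ⟨c, hc⟩ := (hx2 w₀ hw₀).half hn
        have h4 : IsZ (B x (w - w₀)) := by
          refine hx _ (mem_nb_of (E.sub_mem hw hw₀) ⟨a - b, ?_⟩)
          rw [map_sub, LinearMap.sub_apply, ha, hb]
          push_cast
          ring
        obtain ⟨d, hd⟩ := h4
        rw [map_sub] at hd
        refine ⟨d + c - a, ?_⟩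
        rw [hs t w]
        push_cast
        linarith
    refine ⟨x - t, h3, ?_, 1, by simp⟩
    rw [map_sub, LinearMap.sub_apply]
    exact hxt.sub hZ

theorem nb_even (hs : ∀ x y, B x y = B y x) (he : IsEvenLat B E)
    (ht : ∃ k : ℤ, B t t = 2 * k) : IsEvenLat B (nb B E t) := by
  rintro x ⟨w, hw, ⟨n, hn⟩, k, rfl⟩
  obtain ⟨a, ha⟩ := he w hw
  obtain ⟨b, hb⟩ := ht
  refine ⟨a + k * n + k * k * b, ?_⟩
  simp only [map_add, LinearMap.add_apply, B_zsmul_left, B_zsmul_right]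
  rw [hs t w, hn, ha, hb]
  push_cast
  ring

theorem nb_latt [FiniteDimensional ℚ V] (hB : IsPosDefSymm B) (hu : IsUnimodular B E)
    (hspan : Submodule.span ℚ (E : Set V) = ⊤) (h2 : (2 : ℤ) • t ∈ E)
    (hZ : IsZ (B t t)) : IsIntegralLattice B (nb B E t) := by
  have hi := nb_int hB.1 hu hZ
  have hsp : Submodule.span ℚ ((nb B E t : Submodule ℤ V) : Set V) = ⊤ := by
    rw [eq_top_iff, ← hspan, Submodule.span_le]
    intro x hx
    have h3 : (2 : ℤ) • x ∈ nb B E t := mem_nb_of (E.smul_mem _ hx) (by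
      rw [B_two]; exact two_pair hB.1 hu h2 hx)
    have h4 : x = (1 / 2 : ℚ) • ((2 : ℤ) • x) := by
      rw [← Int.cast_smul_eq_zsmul ℚ, smul_smul]
      norm_num
    rw [h4]
    exact Submodule.smul_mem _ _ (Submodule.subset_span h3)
  exact ⟨fg_of_integral hB hsp hi, hsp, hi⟩

theorem exist_of [FiniteDimensional ℚ V] {W₁ W₂ : Type*} [AddCommGroup W₁] [Module ℚ W₁]
    [AddCommGroup W₂] [Module ℚ W₂] (hdim : Module.finrank ℚ V = 24)
    (hB : IsPosDefSymm B) (hu : IsUnimodular B E) (he : IsEvenLat B E)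
    (hspan : Submodule.span ℚ (E : Set V) = ⊤) (h2 : (2 : ℤ) • t ∈ E)
    (htt : t' - t ∈ E) (hodd : ∃ k : ℤ, B t t = 2 * k + 1) (heven : ∃ k : ℤ, B t' t' = 2 * k)
    {C₁ : W₁ → W₁ → ℚ} {M₁ : Submodule ℤ W₁}
    {C₂ : W₂ → W₂ → ℚ} {M₂ : Submodule ℤ W₂}
    (r1 : LatticeIsometric (fun x y => B x y) C₁ (rootSublattice B E) M₁)
    (r2 : LatticeIsometric (fun x y => B x y) C₂ (rootSublattice B (nb B E t')) M₂) :
    NeighborsRootPair B (nb B E t) C₁ M₁ C₂ M₂ := by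
  have hs := hB.1
  have hZ : IsZ (B t t) := by
    obtain ⟨k, hk⟩ := hodd
    exact ⟨2 * k + 1, by rw [hk]; push_cast; ring⟩
  have hZ' : IsZ (B t' t') := by
    obtain ⟨k, hk⟩ := heven
    exact ⟨2 * k, by rw [hk]; push_cast; ring⟩
  have h2' : (2 : ℤ) • t' ∈ E := by
    have := E.add_mem (E.smul_mem 2 htt) h2
    rw [← smul_add] at this
    simpa using this
  have notev : ∀ L : Submodule ℤ V, IsEvenLat B L → t ∉ L := by
    intro L hL hm
    obtain ⟨a, ha⟩ := hodd
    obtain ⟨b, hb⟩ := hL t hm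
    rw [ha] at hb
    have : (2 * a + 1 : ℤ) = 2 * b := by exact_mod_cast hb
    omega
  have htE := notev E he
  have hd : ¬ IsZ (B (t' - t) t) := by
    rintro ⟨n, hn⟩
    obtain ⟨a, ha⟩ := hodd
    obtain ⟨b, hb⟩ := heven
    obtain ⟨c, hc⟩ := he _ htt
    have := hs t t'
    simp only [map_sub, LinearMap.sub_apply] at hc hn
    have h3 : (2 * b : ℚ) = 2 * a + 1 + 2 * n + 2 * c := by linarith
    have : (2 * b : ℤ) = 2 * a + 1 + 2 * n + 2 * c := by exact_mod_cast h3
    omega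
  have ht'E : t' ∉ E := by
    intro h
    apply htE
    have := E.sub_mem h htt
    simpa using this
  have hu1 := nb_uni hs hu h2 hZ
  have hu2 := nb_uni hs hu h2' hZ'
  have he2 := nb_even hs he heven (t := t')
  have same : ∀ x ∈ E, IsZ (B x t) ↔ IsZ (B x t') := by
    intro x hx
    have h3 := uni_int hu hx htt
    rw [map_sub] at h3
    constructor
    · intro h
      have := h3.add h
      simpa using this
    · intro h
      have := h.sub h3
      simpa using this
  have d1 : ∃ w ∈ E, ¬ IsZ (B w t) := ⟨t' - t, htt, hd⟩
  have comE : ∀ {s : V}, (2 : ℤ) • s ∈ E → IsZ (B s s) → s ∉ E →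
      (∃ w ∈ E, ¬ IsZ (B w s)) → Neighbors (nb B E s) E := by
    intro s h2s hZs hsE hw
    have hus := nb_uni hs hu h2s hZs
    obtain ⟨w, hw, hws⟩ := hw
    refine ⟨⟨inf_le_left, s, self_mem_nb, fun h => hsE h.2, ?_⟩,
      ⟨inf_le_right, w, hw, fun h => hws (uni_int hus h.1 self_mem_nb), ?_⟩⟩
    · intro x hx
      rcases nb_cases h2s hZs hx with h | h
      · exact Or.inl ⟨hx, h.1⟩
      · exact Or.inr ⟨mem_nb_of h.1 h.2, h.1⟩
    · intro x hx
      by_cases hxs : IsZ (B x s)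
      · exact Or.inl ⟨mem_nb_of hx hxs, hx⟩
      · obtain ⟨a, ha⟩ := (two_pair hs hu h2s hx).half hxs
        obtain ⟨b, hb⟩ := (two_pair hs hu h2s hw).half hws
        refine Or.inr ⟨mem_nb_of (E.sub_mem hx hw) ⟨a - b, ?_⟩, E.sub_mem hx hw⟩
        rw [map_sub, LinearMap.sub_apply, ha, hb]
        push_cast
        ring
  refine ⟨hB, ⟨nb_latt hB hu hspan h2 hZ, hu1, ⟨t, self_mem_nb, hodd⟩, hdim⟩, E, nb B E t', ?_,
    ⟨⟨fg_of_integral hB hspan hu.le, hspan, hu.le⟩, hu, he, comE h2 hZ htE d1⟩,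
    ⟨nb_latt hB hu hspan h2' hZ', hu2, he2, ?_⟩, Or.inl ⟨r1, r2⟩⟩
  · intro h
    apply ht'E
    rw [h]
    exact self_mem_nb
  · refine ⟨⟨inf_le_left, t, self_mem_nb, fun h => notev _ he2 h.2, ?_⟩,
      ⟨inf_le_right, t', self_mem_nb, fun h => ?_, ?_⟩⟩
    · intro x hx
      rcases nb_cases h2 hZ hx with h | h
      · exact Or.inl ⟨hx, mem_nb_of h.1 ((same _ h.1).1 h.2)⟩
      · exact Or.inr ⟨mem_nb_of h.1 h.2, mem_nb_of h.1 ((same _ h.1).1 h.2)⟩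
    · apply hd
      rw [map_sub, LinearMap.sub_apply]
      exact (uni_int hu1 h.1 self_mem_nb).sub hZ
    · intro x hx
      rcases nb_cases h2' hZ' hx with h | h
      · exact Or.inl ⟨mem_nb_of h.1 ((same _ h.1).2 h.2), hx⟩
      · exact Or.inr ⟨mem_nb_of h.1 ((same _ h.1).2 h.2), mem_nb_of h.1 h.2⟩

end nbsec

/-- Existence in the ambient space `Fin 24 → ℚ` from existence in another space. -/
theorem exist_fin [FiniteDimensional ℚ V] {W₁ W₂ : Type*} [AddCommGroup W₁] [Module ℚ W₁]
    [AddCommGroup W₂] [Module ℚ W₂] {B : V →ₗ[ℚ] V →ₗ[ℚ] ℚ} {N : Submodule ℤ V}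
    {C₁ : W₁ → W₁ → ℚ} {M₁ : Submodule ℤ W₁} {C₂ : W₂ → W₂ → ℚ} {M₂ : Submodule ℤ W₂}
    (h : NeighborsRootPair B N C₁ M₁ C₂ M₂) :
    ∃ (B : (Fin 24 → ℚ) →ₗ[ℚ] (Fin 24 → ℚ) →ₗ[ℚ] ℚ) (N : Submodule ℤ (Fin 24 → ℚ)),
      NeighborsRootPair B N C₁ M₁ C₂ M₂ := by
  have hd : Module.finrank ℚ V = Module.finrank ℚ (Fin 24 → ℚ) := by
    rw [h.2.1.2.2.2]
    simp
  let e : V ≃ₗ[ℚ] (Fin 24 → ℚ) := LinearEquiv.ofFinrankEq _ _ hd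
  let C : (Fin 24 → ℚ) →ₗ[ℚ] (Fin 24 → ℚ) →ₗ[ℚ] ℚ :=
    B.compl₁₂ e.symm.toLinearMap e.symm.toLinearMap
  have he : Isom B C e := by
    intro x y
    simp [C, LinearMap.compl₁₂_apply]
  exact ⟨C, mapL e N, h.transport he⟩



/-- The standard dot product as a bilinear map. -/
noncomputable def dotB (n : ℕ) : (Fin n → ℚ) →ₗ[ℚ] (Fin n → ℚ) →ₗ[ℚ] ℚ :=
  LinearMap.mk₂ ℚ (stdDot n)
    (fun x y z => by simp [stdDot, add_mul, Finset.sum_add_distrib])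
    (fun c x y => by simp [stdDot, Finset.mul_sum, mul_assoc])
    (fun x y z => by simp [stdDot, mul_add, Finset.sum_add_distrib])
    (fun c x y => by simp [stdDot, Finset.mul_sum, mul_left_comm])

/-- The orthogonal sum of two bilinear maps. -/
noncomputable def prodB (B : V →ₗ[ℚ] V →ₗ[ℚ] ℚ) (C : W →ₗ[ℚ] W →ₗ[ℚ] ℚ) :
    (V × W) →ₗ[ℚ] (V × W) →ₗ[ℚ] ℚ :=
  LinearMap.mk₂ ℚ (prodForm (fun x y => B x y) (fun x y => C x y))
    (fun x y z => by simp [prodForm]; ring)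
    (fun c x y => by simp [prodForm, mul_add])
    (fun x y z => by simp [prodForm]; ring)
    (fun c x y => by simp [prodForm, mul_add])

theorem dotB_apply {n : ℕ} (x y : Fin n → ℚ) : dotB n x y = ∑ i, x i * y i := rfl

theorem prodB_apply {B : V →ₗ[ℚ] V →ₗ[ℚ] ℚ} {C : W →ₗ[ℚ] W →ₗ[ℚ] ℚ} (x y : V × W) :
    prodB B C x y = B x.1 y.1 + C x.2 y.2 := rfl

theorem dotB_pos (n : ℕ) : IsPosDefSymm (dotB n) := by
  refine ⟨fun x y => ?_, fun x hx => ?_⟩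
  · simp only [dotB_apply, mul_comm]
  · rw [dotB_apply]
    obtain ⟨i, hi⟩ : ∃ i, x i ≠ 0 := by
      by_contra h
      push Not at h
      exact hx (funext h)
    exact Finset.sum_pos' (fun i _ => mul_self_nonneg _)
      ⟨i, Finset.mem_univ _, mul_self_pos.2 hi⟩

theorem prodB_pos {B : V →ₗ[ℚ] V →ₗ[ℚ] ℚ} {C : W →ₗ[ℚ] W →ₗ[ℚ] ℚ} (hB : IsPosDefSymm B)
    (hC : IsPosDefSymm C) : IsPosDefSymm (prodB B C) := by
  refine ⟨fun x y => ?_, fun x hx => ?_⟩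
  · rw [prodB_apply, prodB_apply, hB.1, hC.1]
  · rw [prodB_apply]
    have nn : ∀ {V : Type _} [AddCommGroup V] [Module ℚ V] {B : V →ₗ[ℚ] V →ₗ[ℚ] ℚ},
        IsPosDefSymm B → ∀ v, 0 ≤ B v v := by
      intro V _ _ B hB v
      by_cases hv : v = 0
      · simp [hv]
      · exact (hB.2 v hv).le
    have nn' : ∀ v, 0 ≤ C v v := by
      intro v
      by_cases hv : v = 0
      · simp [hv]
      · exact (hC.2 v hv).le
    by_cases h1 : x.1 = 0
    · have h2 : x.2 ≠ 0 := fun h => hx (Prod.ext h1 h)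
      have := hC.2 _ h2
      have := nn hB x.1
      linarith
    · have := hB.2 _ h1
      have := nn' x.2
      linarith

/-- The basis vectors. -/
abbrev ev {n : ℕ} (i : Fin n) : Fin n → ℚ := Pi.single i 1

theorem dot_ev {n : ℕ} (x : Fin n → ℚ) (i : Fin n) : dotB n x (ev i) = x i := by
  rw [dotB_apply]
  simp [ev, Pi.single_apply]

theorem sum_ev {n : ℕ} (i : Fin n) : ∑ j, (ev i : Fin n → ℚ) j = 1 := by
  simp [ev, Pi.single_apply]

theorem ev_int {n : ℕ} (i j : Fin n) : IsZ ((ev i : Fin n → ℚ) j) := by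
  by_cases h : j = i
  · subst h
    exact ⟨1, by simp⟩
  · exact ⟨0, by simp [h]⟩

theorem mem_latD {n : ℕ} {x : Fin n → ℚ} :
    x ∈ latD n ↔ (∀ i, IsZ (x i)) ∧ ∃ k : ℤ, ∑ i, x i = 2 * k := Iff.rfl

theorem mem_latA {n : ℕ} {x : Fin (n + 1) → ℚ} :
    x ∈ latA n ↔ (∀ i, IsZ (x i)) ∧ ∑ i, x i = 0 := Iff.rfl

theorem ev_add_mem {n : ℕ} (i j : Fin n) : ev i + ev j ∈ latD n := by
  rw [mem_latD]
  refine ⟨fun k => (ev_int i k).add (ev_int j k), 1, ?_⟩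
  simp only [Pi.add_apply, Finset.sum_add_distrib, sum_ev]
  norm_num

theorem ev_sub_mem {n : ℕ} (i j : Fin n) : ev i - ev j ∈ latD n := by
  rw [mem_latD]
  refine ⟨fun k => (ev_int i k).sub (ev_int j k), 0, ?_⟩
  simp only [Pi.sub_apply, Finset.sum_sub_distrib, sum_ev]
  norm_num

theorem vec_eq_sum {n : ℕ} (x : Fin n → ℚ) : x = ∑ i, x i • ev i := by
  funext j
  simp [Finset.sum_apply, Pi.single_apply]

theorem span_of_latD {n : ℕ} {M : Submodule ℤ (Fin n → ℚ)} (h : latD n ≤ M) :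
    Submodule.span ℚ (M : Set (Fin n → ℚ)) = ⊤ := by
  rw [eq_top_iff]
  rintro x -
  rw [vec_eq_sum x]
  refine Submodule.sum_mem _ fun i _ => Submodule.smul_mem _ _ ?_
  have h1 : ev i = (1 / 2 : ℚ) • (ev i + ev i : Fin n → ℚ) := by
    rw [← two_smul ℚ, smul_smul]
    norm_num
  rw [h1]
  exact Submodule.smul_mem _ _ (Submodule.subset_span (h (ev_add_mem i i)))

theorem span_prod {M : Submodule ℤ V} {N : Submodule ℤ W}
    (hM : Submodule.span ℚ (M : Set V) = ⊤) (hN : Submodule.span ℚ (N : Set W) = ⊤) :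
    Submodule.span ℚ ((M.prod N : Submodule ℤ (V × W)) : Set (V × W)) = ⊤ := by
  rw [eq_top_iff]
  rintro ⟨x, y⟩ -
  have h1 : ∀ x ∈ Submodule.span ℚ (M : Set V), ((x, 0) : V × W) ∈
      Submodule.span ℚ ((M.prod N : Submodule ℤ (V × W)) : Set (V × W)) := by
    intro x hx
    induction hx using Submodule.span_induction with
    | zero => exact Submodule.zero_mem _
    | add a b _ _ iha ihb => simpa using Submodule.add_mem _ iha ihb
    | smul c a _ iha => simpa using Submodule.smul_mem _ c iha
    | mem a ha => exact Submodule.subset_span ⟨ha, N.zero_mem⟩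
  have h2 : ∀ y ∈ Submodule.span ℚ (N : Set W), ((0, y) : V × W) ∈
      Submodule.span ℚ ((M.prod N : Submodule ℤ (V × W)) : Set (V × W)) := by
    intro x hx
    induction hx using Submodule.span_induction with
    | zero => exact Submodule.zero_mem _
    | add a b _ _ iha ihb => simpa using Submodule.add_mem _ iha ihb
    | smul c a _ iha => simpa using Submodule.smul_mem _ c iha
    | mem a ha => exact Submodule.subset_span ⟨M.zero_mem, ha⟩
  simpa using Submodule.add_mem _ (h1 x (by rw [hM]; trivial)) (h2 y (by rw [hN]; trivial))

theorem span_mono_top {M N : Submodule ℤ V} (h : M ≤ N)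
    (hM : Submodule.span ℚ (M : Set V) = ⊤) : Submodule.span ℚ (N : Set V) = ⊤ := by
  rw [eq_top_iff, ← hM]
  exact Submodule.span_mono h

/-- The data extracted from the second root lattice. -/
theorem Cfg.obs {W₂ κ : Type*} [AddCommGroup W₂] [Module ℚ W₂] [Fintype κ]
    {C : W →ₗ[ℚ] W →ₗ[ℚ] ℚ} {M : Submodule ℤ W} {C₂ : W₂ →ₗ[ℚ] W₂ →ₗ[ℚ] ℚ}
    {M₂ : Submodule ℤ W₂} {E : Submodule ℤ W} {t : W} (h : Cfg C M C₂ M₂ E t)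
    (J : W₂ →ₗ[ℚ] (κ → ℚ)) (hJ : ∀ x y, C₂ x y = ∑ i, J x i * J y i) :
    ∃ p : W →ₗ[ℚ] (κ → ℚ), (∀ x ∈ E, C x x = 2 → IsZ (C x t) → ∃ y ∈ M₂, p x = J y) ∧
      ∀ x ∈ Submodule.span ℚ {x | x ∈ E ∧ C x x = 2 ∧ IsZ (C x t)},
      ∀ y ∈ Submodule.span ℚ {x | x ∈ E ∧ C x x = 2 ∧ IsZ (C x t)},
        ∑ i, p x i * p y i = C x y := by
  obtain ⟨Φ, h1, h2⟩ := h.emb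
  refine ⟨J.comp Φ, fun x hx h3 h4 => ⟨Φ x, h1 x hx h3 h4, rfl⟩, fun x hx y hy => ?_⟩
  rw [← form_ext (C := C₂) Φ _ _ hx hy]
  · rw [hJ]
    rfl
  · rintro a ⟨ha, ha2, ha3⟩ b ⟨hb, hb2, hb3⟩
    exact h2 a ha b hb ha2 hb2 ha3 hb3

theorem bessel {κ T : Type*} [Fintype κ] [Fintype T] [DecidableEq T] (p : T → κ → ℚ) (c : ℚ) (c0 : 0 ≤ c)
    (h : ∀ k l, ∑ i, p k i * p l i = if k = l then c else 0) (i : κ) :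
    ∑ k, p k i * p k i ≤ c := by
  classical
  set s := ∑ k, p k i * p k i with hs
  let v : κ → ℚ := fun j => ∑ k, p k i * p k j
  have hv : ∑ j, v j * v j = c * s := by
    have : ∀ j, v j * v j = ∑ k, ∑ l, (p k i * p l i) * (p k j * p l j) := by
      intro j
      simp only [v, Finset.sum_mul_sum]
      refine Finset.sum_congr rfl fun k _ => Finset.sum_congr rfl fun l _ => by ring
    simp only [this]
    rw [Finset.sum_comm]
    rw [hs, Finset.mul_sum]
    refine Finset.sum_congr rfl fun k _ => ?_
    rw [Finset.sum_comm]
    simp only [← Finset.mul_sum, h]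
    simp
    ring
  have h1 : v i * v i ≤ ∑ j, v j * v j :=
    Finset.single_le_sum (f := fun j => v j * v j) (fun j _ => mul_self_nonneg _)
      (Finset.mem_univ i)
  have h2 : v i = s := rfl
  rw [hv, h2] at h1
  have h0 : 0 ≤ s := Finset.sum_nonneg fun k _ => mul_self_nonneg _
  by_contra hc
  push Not at hc
  nlinarith

theorem isZ_sq_ge {q : ℚ} (h : IsZ q) (h0 : q ≠ 0) : 1 ≤ q * q := by
  obtain ⟨n, rfl⟩ := h
  have h1 : n ≠ 0 := by
    rintro rfl
    simp at h0
  have : 1 ≤ n * n := by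
    have := Int.natAbs_pos.2 h1
    nlinarith [mul_self_pos.2 h1]
  exact_mod_cast this

theorem half_sq_ge (m : ℤ) : (1 : ℚ) / 4 ≤ (m + 1 / 2) * (m + 1 / 2) := by
  have : (0 : ℤ) ≤ m * (m + 1) := by
    rcases le_or_gt 0 m with h | h
    · positivity
    · nlinarith
  have : (0 : ℚ) ≤ m * (m + 1) := by exact_mod_cast this
  nlinarith

/-- Rigidity of root systems of type `D` inside `ℤ^κ`. -/
theorem obsD {κ T : Type*} [Fintype κ] [Fintype T] [DecidableEq T] (hT : 5 ≤ Fintype.card T)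
    (p : T → κ → ℚ) (h : ∀ k l, ∑ i, p k i * p l i = if k = l then 1 else 0)
    (hp : ∀ k l, k ≠ l → ∀ i, IsZ (p k i + p l i) ∧ IsZ (p k i - p l i)) (k : T) :
    ∃ i, p k i ≠ 0 ∧ ∀ j, j ≠ i → p k j = 0 := by
  classical
  have hInteg : ∀ i, IsZ (p k i) := by
    intro i
    by_contra hn
    have hall : ∀ l, ¬ IsZ (p l i) := by
      intro l hl
      by_cases hkl : k = l
      · subst hkl
        exact hn hl
      · have := (hp k l hkl i).1.sub hl
        exact hn (by simpa using this)
    have hge : ∀ l, (1 : ℚ) / 4 ≤ p l i * p l i := by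
      intro l
      obtain ⟨l', hl'⟩ : ∃ l', l ≠ l' := by
        have : 1 < Fintype.card T := by omega
        obtain ⟨l', h'⟩ := Fintype.exists_ne_of_one_lt_card this l
        exact ⟨l', h'.symm⟩
      have h2 := (hp l l' hl' i).1.add (hp l l' hl' i).2
      obtain ⟨m, hm⟩ := IsZ.half (q := p l i) (by convert h2 using 1; ring) (hall l)
      rw [hm]
      exact half_sq_ge m
    have h1 := bessel p 1 zero_le_one h i
    have h2 : ∑ l : T, (1 : ℚ) / 4 ≤ ∑ l, p l i * p l i := Finset.sum_le_sum fun l _ => hge l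
    rw [Finset.sum_const, nsmul_eq_mul, Finset.card_univ] at h2
    have h3 : (5 : ℚ) ≤ Fintype.card T := by exact_mod_cast hT
    linarith
  have h1 := h k k
  rw [if_pos rfl] at h1
  obtain ⟨i, hi⟩ : ∃ i, p k i ≠ 0 := by
    by_contra hn
    push Not at hn
    simp [hn] at h1
  refine ⟨i, hi, fun j hj => ?_⟩
  by_contra hj0
  have h2 := Finset.sum_le_sum_of_subset_of_nonneg (f := fun i => p k i * p k i)
    (Finset.subset_univ {i, j}) (fun j _ _ => mul_self_nonneg _)
  rw [Finset.sum_pair hj.symm, h1] at h2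
  have := isZ_sq_ge (hInteg i) hi
  have := isZ_sq_ge (hInteg j) hj0
  linarith

/-- The Hamming code obstruction. -/
theorem obsH {κ : Type*} [Fintype κ] (r : Fin 7 → κ → ℚ) (hr : ∀ k i, IsZ (r k i))
    (h : ∀ k l, ∑ i, r k i * r l i = if k = l then 2 else 0)
    (h1 : ∀ i, IsZ ((1 / 2) * (r 0 i + r 1 i + r 2 i + r 3 i)))
    (h2 : ∀ i, IsZ ((1 / 2) * (r 4 i + r 5 i + r 0 i + r 3 i)))
    (h3 : ∀ i, IsZ ((1 / 2) * (r 4 i + r 6 i + r 0 i + r 2 i))) : False := by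
  have key : ∀ i, r 0 i = 0 := by
    intro i
    have hb := bessel r 2 (by norm_num) h i
    choose z hz using fun k => hr k i
    obtain ⟨a, ha⟩ := h1 i
    obtain ⟨b, hb'⟩ := h2 i
    obtain ⟨c, hc⟩ := h3 i
    simp only [Fin.sum_univ_succ, Fin.sum_univ_zero, hz] at hb
    rw [hz, hz, hz, hz] at ha hb' hc
    have e1 : z 0 + z 1 + z 2 + z 3 = 2 * a := by
      have : (z 0 + z 1 + z 2 + z 3 : ℚ) = 2 * a := by linarith
      exact_mod_cast this
    have e2 : z 4 + z 5 + z 0 + z 3 = 2 * b := by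
      have : (z 4 + z 5 + z 0 + z 3 : ℚ) = 2 * b := by linarith
      exact_mod_cast this
    have e3 : z 4 + z 6 + z 0 + z 2 = 2 * c := by
      have : (z 4 + z 6 + z 0 + z 2 : ℚ) = 2 * c := by linarith
      exact_mod_cast this
    have e4 : z 0 * z 0 + z 1 * z 1 + z 2 * z 2 + z 3 * z 3 + z 4 * z 4 + z 5 * z 5
        + z 6 * z 6 ≤ 2 := by
      have : (z 0 * z 0 + z 1 * z 1 + z 2 * z 2 + z 3 * z 3 + z 4 * z 4 + z 5 * z 5
        + z 6 * z 6 : ℚ) ≤ 2 := by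
        refine le_trans (le_of_eq ?_) hb
        simp only [Fin.succ_zero_eq_one, Fin.succ_one_eq_two]
        have : (Fin.succ 2 : Fin 4) = 3 := rfl
        simp only [← add_assoc, add_zero]
        rfl
      exact_mod_cast this
    have par : ∀ n : ℤ, ∃ w, n * n = n + 2 * w := by
      intro n
      rcases Int.even_or_odd' n with ⟨k, rfl | rfl⟩
      · exact ⟨2 * k * k - k, by ring⟩
      · exact ⟨2 * k * k + k, by ring⟩
    have nonneg : ∀ n : ℤ, 0 ≤ n * n := fun n => mul_self_nonneg n
    have z0 : z 0 = 0 := by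
      have g : ∀ k, 0 ≤ z k * z k := fun k => nonneg _
      choose w hw using par
      have w0 := hw (z 0); have w1 := hw (z 1); have w2 := hw (z 2); have w3 := hw (z 3)
      have w4 := hw (z 4); have w5 := hw (z 5); have w6 := hw (z 6)
      have g0 := g 0; have g1 := g 1; have g2 := g 2; have g3 := g 3
      have g4 := g 4; have g5 := g 5; have g6 := g 6
      have : z 0 * z 0 < 2 ∨ z 0 * z 0 = 2 := by omega
      have hsm : ∀ n : ℤ, n * n ≤ 2 → n = -1 ∨ n = 0 ∨ n = 1 := by
        intro n hn
        have a1 : n < 2 := by nlinarith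
        have a2 : -2 < n := by nlinarith
        omega
      have sq : ∀ k, z k * z k = 0 ∨ z k * z k = 1 := by
        intro k
        have hk : z k * z k ≤ 2 := by
          fin_cases k <;> simp only [Fin.zero_eta, Fin.mk_one, Fin.reduceFinMk] <;> omega
        rcases hsm _ hk with h | h | h <;> simp [h]
      have s0 := sq 0
      rcases s0 with s0 | s0
      · simpa using s0
      · exfalso
        have s1 := sq 1; have s2 := sq 2; have s3 := sq 3
        have s4 := sq 4; have s5 := sq 5; have s6 := sq 6
        generalize z 0 * z 0 = q0 at *
        generalize z 1 * z 1 = q1 at *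
        generalize z 2 * z 2 = q2 at *
        generalize z 3 * z 3 = q3 at *
        generalize z 4 * z 4 = q4 at *
        generalize z 5 * z 5 = q5 at *
        generalize z 6 * z 6 = q6 at *
        clear hsm sq nonneg g
        rcases s1 with s1 | s1 <;> rcases s2 with s2 | s2 <;> rcases s3 with s3 | s3 <;> omega
    rw [hz, z0]
    simp
  have := h 0 0
  simp [key] at this



theorem dual_latD {n : ℕ} {x : Fin n → ℚ} (hx : ∀ y ∈ latD n, IsZ (dotB n x y)) :
    (∀ i, IsZ (x i)) ∨ (∀ i, ∃ m : ℤ, x i = m + 1 / 2) := by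
  have h1 : ∀ i j, IsZ (x i + x j) := by
    intro i j
    have := hx _ (ev_add_mem i j)
    rwa [map_add, dot_ev, dot_ev] at this
  by_cases h : ∀ i, IsZ (x i)
  · exact Or.inl h
  · right
    push Not at h
    obtain ⟨j, hj⟩ := h
    intro i
    refine IsZ.half (by convert h1 i i using 1; ring) fun hi => hj ?_
    have := (h1 i j).sub hi
    simpa using this

/-- Sign changes. -/
noncomputable def flip {n : ℕ} (s : Fin n → ℚ) (hs : ∀ i, s i = 1 ∨ s i = -1) :
    (Fin n → ℚ) ≃ₗ[ℚ] (Fin n → ℚ) :=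
  LinearEquiv.ofInvolutive
    { toFun := fun x i => s i * x i
      map_add' := fun x y => by funext i; simp [mul_add]
      map_smul' := fun c x => by funext i; simp [mul_left_comm] }
    (fun x => by
      funext i
      simp only [LinearMap.coe_mk, AddHom.coe_mk]
      rcases hs i with h | h <;> simp [h])

theorem flip_apply {n : ℕ} (s : Fin n → ℚ) (hs) (x : Fin n → ℚ) (i : Fin n) :
    flip s hs x i = s i * x i := rfl

theorem flip_symm {n : ℕ} (s : Fin n → ℚ) (hs) : (flip s hs).symm = flip s hs := rfl

theorem flip_isom {n : ℕ} (s : Fin n → ℚ) (hs) : Isom (dotB n) (dotB n) (flip s hs) := by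
  intro x y
  simp only [dotB_apply, flip_apply]
  refine Finset.sum_congr rfl fun i _ => ?_
  rcases hs i with h | h <;> simp [h]

theorem flip_mem {n : ℕ} (s : Fin n → ℚ) (hs) {x : Fin n → ℚ} (hx : x ∈ latD n) :
    flip s hs x ∈ latD n := by
  rw [mem_latD] at hx ⊢
  obtain ⟨h1, k, hk⟩ := hx
  choose z hz using h1
  refine ⟨fun i => ?_, ?_⟩
  · rw [flip_apply]
    rcases hs i with h | h
    · simpa [h] using ⟨z i, hz i⟩
    · rw [h, neg_one_mul]
      exact IsZ.neg ⟨z i, hz i⟩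
  · have h2 : ∀ i, ∃ w : ℤ, flip s hs x i = x i + 2 * w := by
      intro i
      rw [flip_apply]
      rcases hs i with h | h
      · exact ⟨0, by simp [h]⟩
      · exact ⟨-z i, by rw [h, hz]; push_cast; ring⟩
    choose w hw using h2
    refine ⟨k + ∑ i, w i, ?_⟩
    simp only [hw, Finset.sum_add_distrib, hk, ← Finset.mul_sum]
    push_cast
    ring

theorem flip_mem_iff {n : ℕ} (s : Fin n → ℚ) (hs) (x : Fin n → ℚ) :
    x ∈ latD n ↔ flip s hs x ∈ latD n := by
  refine ⟨flip_mem s hs, fun h => ?_⟩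
  have := flip_mem s hs h
  rwa [show flip s hs (flip s hs x) = x from (flip s hs).symm_apply_apply x] at this

theorem flip_quarter {n : ℕ} {t : Fin n → ℚ} (h : ∀ i, ∃ m : ℤ, 2 * t i = m + 1 / 2) :
    ∃ s : Fin n → ℚ, (∀ i, s i = 1 ∨ s i = -1) ∧ ∀ i, ∃ z : ℤ, s i * t i = 1 / 4 + z := by
  have : ∀ i, ∃ s : ℚ, (s = 1 ∨ s = -1) ∧ ∃ z : ℤ, s * t i = 1 / 4 + z := by
    intro i
    obtain ⟨m, hm⟩ := h i
    rcases Int.even_or_odd' m with ⟨k, rfl | rfl⟩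
    · exact ⟨1, Or.inl rfl, k, by push_cast at hm; linarith⟩
    · exact ⟨-1, Or.inr rfl, -k - 1, by push_cast at hm ⊢; linarith⟩
  choose s hs using this
  exact ⟨s, fun i => (hs i).1, fun i => (hs i).2⟩

/-- Application of the `D` obstruction. -/
theorem obsT {κ T : Type*} [Fintype κ] [Fintype T] [DecidableEq T] (hT : 5 ≤ Fintype.card T)
    {C : W →ₗ[ℚ] W →ₗ[ℚ] ℚ} {E : Submodule ℤ W} {t : W}
    (p : W →ₗ[ℚ] (κ → ℚ)) (A : Finset κ)
    (hp1 : ∀ x ∈ E, C x x = 2 → IsZ (C x t) → (∀ i, IsZ (p x i)) ∧ ∑ i ∈ A, p x i = 0)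
    (hp2 : ∀ x ∈ Submodule.span ℚ {x | x ∈ E ∧ C x x = 2 ∧ IsZ (C x t)},
      ∀ y ∈ Submodule.span ℚ {x | x ∈ E ∧ C x x = 2 ∧ IsZ (C x t)},
        ∑ i, p x i * p y i = C x y)
    (u : T → W) (hu : ∀ k l, C (u k) (u l) = if k = l then 1 else 0)
    (huE : ∀ k l, k ≠ l → u k + u l ∈ E ∧ u k - u l ∈ E)
    (hut : ∀ k l, k ≠ l → IsZ (C (u k + u l) t) ∧ IsZ (C (u k - u l) t)) (k : T) :
    u k ∈ Submodule.span ℚ {x | x ∈ E ∧ C x x = 2 ∧ IsZ (C x t)} ∧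
      ∃ i, i ∉ A ∧ p (u k) i ≠ 0 ∧ ∀ j, j ≠ i → p (u k) j = 0 := by
  classical
  have n1 : ∀ k l, k ≠ l → C (u k + u l) (u k + u l) = 2 := by
    intro k l hkl
    simp only [map_add, LinearMap.add_apply, hu, if_neg hkl, if_neg hkl.symm]
    norm_num
  have n2 : ∀ k l, k ≠ l → C (u k - u l) (u k - u l) = 2 := by
    intro k l hkl
    simp only [map_sub, LinearMap.sub_apply, hu, if_neg hkl, if_neg hkl.symm]
    norm_num
  have other : ∀ k : T, ∃ l, k ≠ l := by
    intro k
    obtain ⟨l', h'⟩ := Fintype.exists_ne_of_one_lt_card (by omega : 1 < Fintype.card T) k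
    exact ⟨l', h'.symm⟩
  have eq1 : ∀ k l, u k = (1 / 2 : ℚ) • ((u k + u l) + (u k - u l)) := by
    intro k l
    rw [add_add_sub_cancel, ← two_smul ℚ, smul_smul]
    norm_num
  have hsp : ∀ k, u k ∈ Submodule.span ℚ {x | x ∈ E ∧ C x x = 2 ∧ IsZ (C x t)} := by
    intro k
    obtain ⟨l, hl⟩ := other k
    rw [eq1 k l]
    exact Submodule.smul_mem _ _ (Submodule.add_mem _
      (Submodule.subset_span ⟨(huE k l hl).1, n1 k l hl, (hut k l hl).1⟩)
      (Submodule.subset_span ⟨(huE k l hl).2, n2 k l hl, (hut k l hl).2⟩))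
  refine ⟨hsp k, ?_⟩
  obtain ⟨i, hi, hi'⟩ := obsD hT (fun k => p (u k))
    (fun k l => by rw [hp2 _ (hsp k) _ (hsp l), hu])
    (fun k l hkl i => ⟨by
      have := (hp1 _ (huE k l hkl).1 (n1 k l hkl) (hut k l hkl).1).1 i
      simpa using this, by
      have := (hp1 _ (huE k l hkl).2 (n2 k l hkl) (hut k l hkl).2).1 i
      simpa using this⟩) k
  refine ⟨i, fun hA => hi ?_, hi, hi'⟩
  obtain ⟨l, hl⟩ := other k
  have s1 := (hp1 _ (huE k l hl).1 (n1 k l hl) (hut k l hl).1).2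
  have s2 := (hp1 _ (huE k l hl).2 (n2 k l hl) (hut k l hl).2).2
  simp only [map_add, map_sub, Pi.add_apply, Pi.sub_apply, Finset.sum_add_distrib,
    Finset.sum_sub_distrib] at s1 s2
  have s3 : ∑ j ∈ A, p (u k) j = 0 := by linarith
  rwa [Finset.sum_eq_single_of_mem i hA (fun j _ hj => hi' j hj)] at s3

/-- A set of many indices with equal parity. -/
theorem exists_parity {n : ℕ} (hn : 9 ≤ n) {t : Fin n → ℚ} (h : ∀ i, IsZ (2 * t i)) :
    ∃ T : Finset (Fin n), 5 ≤ T.card ∧ ∀ k ∈ T, ∀ l ∈ T, IsZ (t k + t l) ∧ IsZ (t k - t l) := by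
  classical
  have hsum := Finset.card_filter_add_card_filter_not (s := (Finset.univ : Finset (Fin n)))
    (fun i => IsZ (t i))
  rw [Finset.card_univ, Fintype.card_fin] at hsum
  rcases le_or_gt 5 (Finset.univ.filter fun i => IsZ (t i)).card with h5 | h5
  · refine ⟨_, h5, fun k hk l hl => ?_⟩
    rw [Finset.mem_filter] at hk hl
    exact ⟨hk.2.add hl.2, hk.2.sub hl.2⟩
  · refine ⟨Finset.univ.filter fun i => ¬ IsZ (t i), by omega, fun k hk l hl => ?_⟩
    rw [Finset.mem_filter] at hk hl
    obtain ⟨a, ha⟩ := (h k).half hk.2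
    obtain ⟨b, hb⟩ := (h l).half hl.2
    rw [ha, hb]
    exact ⟨⟨a + b + 1, by push_cast; ring⟩, ⟨a - b, by push_cast; ring⟩⟩

theorem sub_ev_span {n : ℕ} {S : Submodule ℤ (Fin n → ℚ)} (i₀ : Fin n)
    (hS : ∀ i j, i ≠ j → ev i - ev j ∈ S) {x : Fin n → ℚ} {z : Fin n → ℤ}
    (hz : ∀ i, x i = z i) : x - (∑ i, x i) • ev i₀ ∈ S := by
  have : x - (∑ i, x i) • ev i₀ = ∑ i, z i • (ev i - ev i₀ : Fin n → ℚ) := by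
    conv_lhs => rw [vec_eq_sum x]
    simp only [smul_sub, Finset.sum_sub_distrib]
    congr 1
    · refine Finset.sum_congr rfl fun i _ => ?_
      rw [hz, Int.cast_smul_eq_zsmul]
    · rw [← Finset.sum_smul, ← Int.cast_smul_eq_zsmul ℚ]
      congr 1
      push_cast
      refine Finset.sum_congr rfl fun i _ => ?_
      rw [← hz]
      simp [Pi.single_apply]
  rw [this]
  refine Submodule.sum_mem _ fun i _ => Submodule.smul_mem _ _ ?_
  by_cases h : i = i₀
  · subst h
    simp
  · exact hS i i₀ h

theorem norm_ev {n : ℕ} (i j : Fin n) :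
    dotB n (ev i) (ev j) = if i = j then 1 else 0 := by
  rw [dot_ev]
  simp [Pi.single_apply, eq_comm]

theorem norm_ev_sub {n : ℕ} {i j : Fin n} (h : i ≠ j) :
    dotB n (ev i - ev j) (ev i - ev j) = 2 := by
  simp only [map_sub, LinearMap.sub_apply, norm_ev, if_neg h, if_neg h.symm]
  norm_num

theorem norm_ev_add {n : ℕ} {i j : Fin n} (h : i ≠ j) :
    dotB n (ev i + ev j) (ev i + ev j) = 2 := by
  simp only [map_add, LinearMap.add_apply, norm_ev, if_neg h, if_neg h.symm]
  norm_num

theorem latD_gen (n : ℕ) (hn : 2 ≤ n) :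
    latD n ≤ Submodule.span ℤ {x | x ∈ latD n ∧ dotB n x x = 2} := by
  intro x hx
  have hx' := hx
  rw [mem_latD] at hx
  obtain ⟨h1, k, hk⟩ := hx
  choose z hz using h1
  let i₀ : Fin n := ⟨0, by omega⟩
  let i₁ : Fin n := ⟨1, by omega⟩
  have h01 : i₀ ≠ i₁ := by simp [i₀, i₁]
  have h2 := sub_ev_span (S := Submodule.span ℤ {x | x ∈ latD n ∧ dotB n x x = 2}) i₀
    (fun i j h => Submodule.subset_span ⟨ev_sub_mem i j, norm_ev_sub h⟩) hz
  have h3 : (∑ i, x i) • (ev i₀ : Fin n → ℚ) =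
      k • ((ev i₀ + ev i₁) + (ev i₀ - ev i₁) : Fin n → ℚ) := by
    rw [hk, add_add_sub_cancel, ← two_smul ℚ, ← Int.cast_smul_eq_zsmul ℚ, smul_smul, mul_comm]
  have h4 : k • ((ev i₀ + ev i₁) + (ev i₀ - ev i₁) : Fin n → ℚ) ∈
      Submodule.span ℤ {x | x ∈ latD n ∧ dotB n x x = 2} :=
    Submodule.smul_mem _ _ (Submodule.add_mem _
      (Submodule.subset_span ⟨ev_add_mem _ _, norm_ev_add h01⟩)
      (Submodule.subset_span ⟨ev_sub_mem _ _, norm_ev_sub h01⟩))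
  rw [h3] at h2
  have := Submodule.add_mem _ h2 h4
  rwa [sub_add_cancel] at this

theorem latA_sub {n : ℕ} (i j : Fin (n + 1)) : ev i - ev j ∈ latA n := by
  rw [mem_latA]
  refine ⟨fun k => (ev_int i k).sub (ev_int j k), ?_⟩
  simp only [Pi.sub_apply, Finset.sum_sub_distrib, sum_ev]
  norm_num

theorem latA_gen (n : ℕ) {S : Submodule ℤ (Fin (n + 1) → ℚ)}
    (hS : ∀ i j, i ≠ j → ev i - ev j ∈ S) : latA n ≤ S := by
  intro x hx
  rw [mem_latA] at hx
  obtain ⟨h1, hk⟩ := hx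
  choose z hz using h1
  have h2 := sub_ev_span 0 hS hz
  rw [hk] at h2
  simpa using h2

theorem gen_prod {B : V →ₗ[ℚ] V →ₗ[ℚ] ℚ} {C : W →ₗ[ℚ] W →ₗ[ℚ] ℚ} {M : Submodule ℤ V}
    {N : Submodule ℤ W} (hM : M ≤ Submodule.span ℤ {x | x ∈ M ∧ B x x = 2})
    (hN : N ≤ Submodule.span ℤ {x | x ∈ N ∧ C x x = 2}) :
    M.prod N ≤ Submodule.span ℤ {x | x ∈ M.prod N ∧ prodB B C x x = 2} := by
  have h1 : Submodule.span ℤ {x | x ∈ M ∧ B x x = 2} ≤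
      (Submodule.span ℤ {x | x ∈ M.prod N ∧ prodB B C x x = 2}).comap (LinearMap.inl ℤ V W) := by
    rw [Submodule.span_le]
    rintro x ⟨hx, hx2⟩
    refine Submodule.subset_span ⟨⟨hx, N.zero_mem⟩, ?_⟩
    simp [prodB_apply, hx2]
  have h2 : Submodule.span ℤ {x | x ∈ N ∧ C x x = 2} ≤
      (Submodule.span ℤ {x | x ∈ M.prod N ∧ prodB B C x x = 2}).comap (LinearMap.inr ℤ V W) := by
    rw [Submodule.span_le]
    rintro x ⟨hx, hx2⟩
    refine Submodule.subset_span ⟨⟨M.zero_mem, hx⟩, ?_⟩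
    simp [prodB_apply, hx2]
  rintro ⟨x, y⟩ ⟨hx, hy⟩
  have e1 : ((x, 0) : V × W) ∈ Submodule.span ℤ {x | x ∈ M.prod N ∧ prodB B C x x = 2} :=
    h1 (hM hx)
  have e2 : ((0, y) : V × W) ∈ Submodule.span ℤ {x | x ∈ M.prod N ∧ prodB B C x x = 2} :=
    h2 (hN hy)
  have e3 : ((x, y) : V × W) = (x, 0) + (0, y) := by simp
  rw [e3]
  exact Submodule.add_mem _ e1 e2

theorem root_eq {C : W →ₗ[ℚ] W →ₗ[ℚ] ℚ} {M E : Submodule ℤ W} (hME : M ≤ E)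
    (hgen : M ≤ Submodule.span ℤ {x | x ∈ M ∧ C x x = 2})
    (hroot : ∀ x ∈ E, C x x = 2 → x ∈ M) : rootSublattice C E = M := by
  apply le_antisymm
  · rw [rootSublattice, Submodule.span_le]
    rintro x ⟨hx, h2⟩
    exact hroot x hx h2
  · refine hgen.trans (Submodule.span_mono ?_)
    rintro x ⟨hx, h2⟩
    exact ⟨hME hx, h2⟩

theorem iso_of_eq {C : W → W → ℚ} {M E : Submodule ℤ W} (h : E = M) :
    LatticeIsometric C C E M := by
  subst h
  exact ⟨LinearEquiv.refl _ _, fun x y => rfl⟩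

theorem iso_of_psi {W₂ : Type*} [AddCommGroup W₂] [Module ℚ W₂] {C : W →ₗ[ℚ] W →ₗ[ℚ] ℚ}
    {E : Submodule ℤ W} {C₂ : W₂ →ₗ[ℚ] W₂ →ₗ[ℚ] ℚ} (hC₂ : IsPosDefSymm C₂) {M₂ : Submodule ℤ W₂}
    (ψ : W₂ →ₗ[ℚ] W) (hψ : ∀ x ∈ M₂, ∀ y ∈ M₂, C (ψ x) (ψ y) = C₂ x y)
    (h1 : ∀ x ∈ M₂, ψ x ∈ rootSublattice C E)
    (h2 : ∀ y ∈ E, C y y = 2 → ∃ x ∈ M₂, ψ x = y) :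
    LatticeIsometric (fun x y => C x y) (fun x y => C₂ x y) (rootSublattice C E) M₂ := by
  let g : M₂ →ₗ[ℤ] rootSublattice C E :=
    LinearMap.restrict (ψ.restrictScalars ℤ) h1
  have ginj : Function.Injective g := by
    rw [injective_iff_map_eq_zero]
    intro x hx
    have h3 : ψ x = 0 := congrArg Subtype.val hx
    by_contra hne
    have := hC₂.2 (x : W₂) (fun h => hne (Subtype.ext h))
    rw [← hψ x x.2 x x.2, h3] at this
    simp at this
  have gsurj : Function.Surjective g := by
    rintro ⟨y, hy⟩
    have h4 : rootSublattice C E ≤ M₂.map (ψ.restrictScalars ℤ) := by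
      rw [rootSublattice, Submodule.span_le]
      rintro y ⟨hy, hy2⟩
      obtain ⟨x, hx, rfl⟩ := h2 y hy hy2
      exact ⟨x, hx, rfl⟩
    obtain ⟨x, hx, rfl⟩ := h4 hy
    exact ⟨⟨x, hx⟩, rfl⟩
  let e := LinearEquiv.ofBijective g ⟨ginj, gsurj⟩
  refine ⟨e.symm, fun x y => ?_⟩
  obtain ⟨a, rfl⟩ := e.surjective x
  obtain ⟨b, rfl⟩ := e.surjective y
  simp only [LinearEquiv.symm_apply_apply]
  exact (hψ a a.2 b b.2).symm



/-- The lattice `Dₙ⁺`. -/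
def latDp (n : ℕ) : Submodule ℤ (Fin n → ℚ) :=
  latD n ⊔ Submodule.span ℤ {fun _ => (1 : ℚ) / 2}

theorem latE8_eq : latE8 = latDp 8 := rfl

/-- The constant vector. -/
abbrev cst (n : ℕ) (c : ℚ) : Fin n → ℚ := fun _ => c

theorem latD_le_latDp (n : ℕ) : latD n ≤ latDp n := le_sup_left

theorem half_mem_latDp (n : ℕ) : cst n (1 / 2) ∈ latDp n :=
  (le_sup_right : _ ≤ latDp n) (Submodule.mem_span_singleton_self _)

theorem dot_cst {n : ℕ} (x : Fin n → ℚ) (c : ℚ) : dotB n x (cst n c) = (∑ i, x i) * c := by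
  rw [dotB_apply, Finset.sum_mul]

theorem sum_cst {n : ℕ} (c : ℚ) : ∑ i, cst n c i = n * c := by
  simp

theorem mem_latDp {n m : ℕ} (hn : n = 2 * m) {x : Fin n → ℚ} :
    x ∈ latDp n ↔ x ∈ latD n ∨ x - cst n (1 / 2) ∈ latD n := by
  constructor
  · intro hx
    obtain ⟨d, hd, y, hy, rfl⟩ := Submodule.mem_sup.1 hx
    obtain ⟨k, rfl⟩ := Submodule.mem_span_singleton.1 hy
    have h1 : cst n 1 ∈ latD n := by
      rw [mem_latD]
      refine ⟨fun i => isZ_one, m, ?_⟩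
      rw [sum_cst, hn]
      push_cast
      ring
    rcases Int.even_or_odd' k with ⟨j, rfl | rfl⟩
    · left
      have : ((2 * j) • fun _ => (1 : ℚ) / 2 : Fin n → ℚ) = j • cst n 1 := by
        funext i
        simp
        ring
      rw [this]
      exact Submodule.add_mem _ hd (Submodule.smul_mem _ _ h1)
    · right
      have : d + ((2 * j + 1) • fun _ => (1 : ℚ) / 2 : Fin n → ℚ) - cst n (1 / 2)
          = d + j • cst n 1 := by
        funext i
        simp
        ring
      rw [this]
      exact Submodule.add_mem _ hd (Submodule.smul_mem _ _ h1)
  · rintro (h | h)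
    · exact latD_le_latDp n h
    · have := Submodule.add_mem _ (latD_le_latDp n h) (half_mem_latDp n)
      simpa using this

theorem dot_int {n : ℕ} {x y : Fin n → ℚ} (hx : ∀ i, IsZ (x i)) (hy : ∀ i, IsZ (y i)) :
    IsZ (dotB n x y) := by
  rw [dotB_apply]
  exact IsZ.sum _ _ fun i _ => (hx i).mul (hy i)

theorem latDp_uni {n m : ℕ} (hn : n = 4 * m) : IsUnimodular (dotB n) (latDp n) := by
  have hs := (dotB_pos n).1
  apply le_antisymm
  · have hDD : ∀ x ∈ latD n, ∀ y ∈ latD n, IsZ (dotB n x y) := fun x hx y hy =>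
      dot_int hx.1 hy.1
    have hDh : ∀ x ∈ latD n, IsZ (dotB n x (cst n (1 / 2))) := by
      rintro x ⟨-, k, hk⟩
      exact ⟨k, by rw [dot_cst, hk]; ring⟩
    have hhh : IsZ (dotB n (cst n (1 / 2)) (cst n (1 / 2))) := by
      refine ⟨m, ?_⟩
      rw [dot_cst, sum_cst, hn]
      push_cast
      ring
    have hDp : ∀ x ∈ latD n, ∀ y ∈ latDp n, IsZ (dotB n x y) := by
      intro x hx y hy
      rcases (mem_latDp (m := 2 * m) (by omega)).1 hy with h | h
      · exact hDD x hx y h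
      · have := (hDD x hx _ h).add (hDh x hx)
        rw [← map_add] at this
        simpa using this
    have hhp : ∀ y ∈ latDp n, IsZ (dotB n (cst n (1 / 2)) y) := by
      intro y hy
      rcases (mem_latDp (m := 2 * m) (by omega)).1 hy with h | h
      · rw [hs]
        exact hDh y h
      · have := (hDh _ h).add hhh
        rw [← LinearMap.add_apply, ← map_add] at this
        rw [hs]
        simpa using this
    intro x hx y hy
    rcases (mem_latDp (m := 2 * m) (by omega)).1 hx with h | h
    · exact hDp x h y hy
    · have := (hDp _ h y hy).add (hhp y hy)
      rw [← LinearMap.add_apply, ← map_add] at this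
      have h' : IsZ (dotB n x y) := by simpa using this
      exact h'
  · intro x hx
    obtain ⟨k, hk⟩ : IsZ (dotB n x (cst n (1 / 2))) := hx _ (half_mem_latDp n)
    rw [dot_cst] at hk
    rw [mem_latDp (m := 2 * m) (by omega)]
    rcases dual_latD (x := x) (fun y hy => hx y (latD_le_latDp n hy)) with h | h
    · left
      exact ⟨h, k, by linarith⟩
    · right
      refine ⟨fun i => ?_, k - m, ?_⟩
      · obtain ⟨a, ha⟩ := h i
        exact ⟨a, by simp [ha]⟩
      · simp only [Pi.sub_apply, Finset.sum_sub_distrib, sum_cst, hn]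
        push_cast
        rw [hn] at *
        linarith

theorem sq_sum {n : ℕ} {x : Fin n → ℚ} (hx : ∀ i, IsZ (x i)) :
    ∃ k : ℤ, ∑ i, x i * x i = ∑ i, x i + 2 * k := by
  choose z hz using hx
  have : ∀ i, ∃ w : ℤ, x i * x i = x i + 2 * w := by
    intro i
    rw [hz]
    rcases Int.even_or_odd' (z i) with ⟨k, h | h⟩
    · exact ⟨2 * k * k - k, by rw [h]; push_cast; ring⟩
    · exact ⟨2 * k * k + k, by rw [h]; push_cast; ring⟩
  choose w hw using this
  refine ⟨∑ i, w i, ?_⟩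
  simp only [hw, Finset.sum_add_distrib, ← Finset.mul_sum]
  push_cast
  ring

theorem latD_even (n : ℕ) : IsEvenLat (dotB n) (latD n) := by
  rintro x ⟨hx, k, hk⟩
  obtain ⟨w, hw⟩ := sq_sum hx
  refine ⟨k + w, ?_⟩
  rw [dotB_apply, hw, hk]
  push_cast
  ring

theorem latDp_even {n m : ℕ} (hn : n = 8 * m) : IsEvenLat (dotB n) (latDp n) := by
  intro x hx
  rcases (mem_latDp (m := 4 * m) (by omega)).1 hx with h | h
  · exact latD_even n x h
  · obtain ⟨k, hk⟩ := latD_even n _ h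
    obtain ⟨-, l, hl⟩ := h
    have h1 : dotB n x x = dotB n (x - cst n (1 / 2)) (x - cst n (1 / 2))
        + ∑ i, (x - cst n (1 / 2)) i + n * (1 / 4) := by
      have : (n : ℚ) * (1 / 4) = ∑ i, cst n (1 / 4) i := (sum_cst _).symm
      rw [this, dotB_apply, dotB_apply, ← Finset.sum_add_distrib, ← Finset.sum_add_distrib]
      refine Finset.sum_congr rfl fun i _ => ?_
      simp only [Pi.sub_apply]
      ring
    refine ⟨k + l + m, ?_⟩
    rw [h1, hk, hl, hn]
    push_cast
    ring

theorem half_norm_ge {n : ℕ} {x : Fin n → ℚ} (h : ∀ i, ∃ m : ℤ, x i = m + 1 / 2) :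
    (n : ℚ) * (1 / 4) ≤ dotB n x x := by
  have : (n : ℚ) * (1 / 4) = ∑ i, cst n (1 / 4) i := (sum_cst _).symm
  rw [this, dotB_apply]
  refine Finset.sum_le_sum fun i _ => ?_
  obtain ⟨m, hm⟩ := h i
  rw [hm]
  exact half_sq_ge m

theorem half_of_sub {n : ℕ} {x : Fin n → ℚ} (h : ∀ i, IsZ ((x - cst n (1 / 2)) i)) :
    ∀ i, ∃ m : ℤ, x i = m + 1 / 2 := by
  intro i
  obtain ⟨m, hm⟩ := h i
  exact ⟨m, by rw [← hm]; simp⟩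

theorem latDp_root {n m : ℕ} (hn : n = 8 * m) (hm : 2 ≤ m) {x : Fin n → ℚ} (hx : x ∈ latDp n)
    (h2 : dotB n x x ≤ 2) : x ∈ latD n := by
  rcases (mem_latDp (m := 4 * m) (by omega)).1 hx with h | h
  · exact h
  · exfalso
    have h1 := half_norm_ge (half_of_sub h.1)
    have hn' : (n : ℚ) = 8 * m := by exact_mod_cast hn
    have : (2 : ℚ) ≤ m := by exact_mod_cast hm
    linarith

theorem uni_eq_of_le {C : W →ₗ[ℚ] W →ₗ[ℚ] ℚ} {E F : Submodule ℤ W} (hE : IsUnimodular C E)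
    (hF : IsUnimodular C F) (h : F ≤ E) : E = F := by
  refine le_antisymm ?_ h
  intro x hx
  rw [hF]
  intro y hy
  exact uni_int hE hx (h hy)

/-- The quarter decomposition. -/
theorem quarter_norm {n : ℕ} (z : Fin n → ℚ) :
    dotB n (cst n (1 / 4) + z) (cst n (1 / 4) + z) =
      n * (1 / 16) + (∑ i, z i) / 2 + ∑ i, z i * z i := by
  have : (n : ℚ) * (1 / 16) = ∑ i, cst n (1 / 16) i := (sum_cst _).symm
  rw [this, dotB_apply, Finset.sum_div, ← Finset.sum_add_distrib, ← Finset.sum_add_distrib]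
  refine Finset.sum_congr rfl fun i _ => ?_
  simp only [Pi.add_apply]
  ring

theorem quarter_of {n : ℕ} {t : Fin n → ℚ} (h : ∀ i, ∃ z : ℤ, t i = 1 / 4 + z) :
    ∃ z : Fin n → ℚ, (∀ i, IsZ (z i)) ∧ t = cst n (1 / 4) + z := by
  choose z hz using h
  exact ⟨fun i => z i, fun i => ⟨z i, rfl⟩, funext fun i => hz i⟩

theorem two_mem_latD {n : ℕ} {z : Fin n → ℚ} (hz : ∀ i, IsZ (z i)) : (2 : ℤ) • z ∈ latD n := by
  rw [mem_latD]
  obtain ⟨k, hk⟩ := IsZ.sum Finset.univ z fun i _ => hz i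
  refine ⟨fun i => ?_, k, ?_⟩
  · rw [Pi.smul_apply, zsmul_eq_mul]
    exact (isZ_int 2).mul (hz i)
  · simp only [Pi.smul_apply, zsmul_eq_mul, ← Finset.mul_sum, hk]
    norm_num

theorem abs_sum_le {n : ℕ} {z : Fin n → ℚ} (hz : ∀ i, IsZ (z i)) :
    ∑ i, z i ≤ ∑ i, z i * z i ∧ -∑ i, z i ≤ ∑ i, z i * z i := by
  have : ∀ q : ℚ, IsZ q → q ≤ q * q ∧ -q ≤ q * q := by
    intro q hq
    by_cases h0 : q = 0
    · simp [h0]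
    · have := isZ_sq_ge hq h0
      constructor <;> nlinarith [sq_nonneg (q - 1), sq_nonneg (q + 1)]
  constructor
  · exact Finset.sum_le_sum fun i _ => (this _ (hz i)).1
  · rw [← Finset.sum_neg_distrib]
    exact Finset.sum_le_sum fun i _ => (this _ (hz i)).2

theorem case4_normal (E : Submodule ℤ (Fin 24 → ℚ)) (t : Fin 24 → ℚ)
    (h : Cfg (dotB 24) (latD 24) (dotB 25) (latA 24) E t) :
    ∃ e : (Fin 24 → ℚ) ≃ₗ[ℚ] (Fin 24 → ℚ), Isom (dotB 24) (dotB 24) e ∧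
      mapL e E = latDp 24 ∧ e t - (cst 24 (1 / 4) + ev 0) ∈ latDp 24 := by
  have hd := dual_latD (x := (2 : ℤ) • t) (fun y hy => uni_int h.uni h.two (h.le hy))
  have hh : ∀ i, ∃ m : ℤ, 2 * t i = m + 1 / 2 := by
    rcases hd with hd | hd
    · exfalso
      obtain ⟨T, hT, hTp⟩ := exists_parity (t := t) (by norm_num) (fun i => by simpa using hd i)
      obtain ⟨p, hp1, hp2⟩ := h.obs LinearMap.id (fun x y => by rfl)
      have hne : T.Nonempty := Finset.card_pos.1 (by omega)
      obtain ⟨k, hk⟩ := hne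
      obtain ⟨-, i, hi, -⟩ := obsT (T := T) (by simpa using hT) p Finset.univ
        (fun x hx h2 h3 => by
          obtain ⟨y, hy, hxy⟩ := hp1 x hx h2 h3
          rw [hxy]
          exact hy) hp2 (fun k => ev (k : Fin 24))
        (fun k l => by
          rw [norm_ev]
          exact if_congr Subtype.ext_iff.symm rfl rfl)
        (fun k l _ => ⟨h.le (ev_add_mem _ _), h.le (ev_sub_mem _ _)⟩)
        (fun k l _ => by
          rw [(dotB_pos 24).1, (dotB_pos 24).1 _ t, map_add, map_sub, dot_ev, dot_ev]
          exact hTp k k.2 l l.2) ⟨k, hk⟩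
      exact hi (Finset.mem_univ _)
    · intro i
      simpa using hd i
  obtain ⟨s, hs, hst⟩ := flip_quarter hh
  have h' := h.map (flip_isom s hs) (flip_mem_iff s hs)
  refine ⟨flip s hs, flip_isom s hs, ?_⟩
  obtain ⟨z, hz, htz⟩ := quarter_of (t := flip s hs t) hst
  have half : cst 24 (1 / 2) ∈ mapL (flip s hs) E := by
    have h2 := h'.two
    rw [htz] at h2
    have h3 := Submodule.sub_mem _ h2 (h'.le (two_mem_latD hz))
    convert h3 using 1
    funext i
    simp
    norm_num
  have hE : mapL (flip s hs) E = latDp 24 := by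
    refine uni_eq_of_le h'.uni (latDp_uni (m := 6) rfl) ?_
    refine sup_le h'.le ?_
    rw [Submodule.span_singleton_le_iff_mem]
    exact half
  refine ⟨hE, ?_⟩
  apply latD_le_latDp
  obtain ⟨k, hk⟩ := h'.odd
  rw [htz, quarter_norm] at hk
  obtain ⟨w, hw⟩ := sq_sum hz
  obtain ⟨S, hS⟩ := IsZ.sum Finset.univ z fun i _ => hz i
  rw [hw, hS] at hk
  have hk' : 3 + 3 * S + 4 * w = 4 * k + 2 := by
    have : (3 + 3 * S + 4 * w : ℚ) = 4 * k + 2 := by push_cast at hk; linarith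
    exact_mod_cast this
  have e1 : flip s hs t - (cst 24 (1 / 4) + ev 0) = z - ev 0 := by
    rw [htz]
    abel
  rw [e1]
  refine ⟨fun i => (hz i).sub (ev_int 0 i), (S - 1) / 2, ?_⟩
  simp only [Pi.sub_apply, Finset.sum_sub_distrib, sum_ev, hS]
  have : S - 1 = 2 * ((S - 1) / 2) := by omega
  exact_mod_cast this



/-- Embedding of `A₂₄`. -/
noncomputable def psi4 : (Fin 25 → ℚ) →ₗ[ℚ] (Fin 24 → ℚ) where
  toFun x i := (∑ j : Fin 24, x j.castSucc) / 4 - x i.castSucc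
  map_add' x y := by
    funext i
    simp only [Pi.add_apply, Finset.sum_add_distrib]
    ring
  map_smul' c x := by
    funext i
    simp only [Pi.smul_apply, smul_eq_mul, ← Finset.mul_sum, RingHom.id_apply]
    ring

theorem psi4_apply (x : Fin 25 → ℚ) (i : Fin 24) :
    psi4 x i = (∑ j : Fin 24, x j.castSucc) / 4 - x i.castSucc := rfl

theorem psi4_snoc (y : Fin 24 → ℚ) (a : ℚ) (i : Fin 24) :
    psi4 (Fin.snoc (α := fun _ => ℚ) y a) i = (∑ j, y j) / 4 - y i := by
  rw [psi4_apply]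
  simp only [Fin.snoc_castSucc]

theorem psi4_ev (i : Fin 24) : psi4 (ev i.castSucc) = cst 24 (1 / 4) - ev i := by
  funext k
  rw [psi4_apply]
  simp [Pi.single_apply]

theorem psi4_last : psi4 (ev (Fin.last 24)) = 0 := by
  funext k
  rw [psi4_apply]
  have : ∀ j : Fin 24, (ev (Fin.last 24) : Fin 25 → ℚ) j.castSucc = 0 := by
    intro j
    exact Pi.single_eq_of_ne (Fin.castSucc_lt_last j).ne _
  simp only [this]
  simp

theorem psi4_isom (x y : Fin 25 → ℚ) (hx : x ∈ latA 24) (hy : y ∈ latA 24) :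
    dotB 24 (psi4 x) (psi4 y) = dotB 25 x y := by
  have hx2 := hx.2
  have hy2 := hy.2
  rw [Fin.sum_univ_castSucc (n := 24)] at hx2 hy2
  rw [dotB_apply, dotB_apply, Fin.sum_univ_castSucc (n := 24)]
  simp only [psi4_apply]
  set X := ∑ j : Fin 24, x j.castSucc with hX
  set Y := ∑ j : Fin 24, y j.castSucc with hY
  have e1 : ∀ i : Fin 24, (X / 4 - x i.castSucc) * (Y / 4 - y i.castSucc) =
      X * Y / 16 - X / 4 * y i.castSucc - x i.castSucc * (Y / 4) + x i.castSucc * y i.castSucc :=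
    fun i => by ring
  have e2 : x (Fin.last 24) = -X := by
    change X + x (Fin.last 24) = 0 at hx2
    linarith
  have e3 : y (Fin.last 24) = -Y := by
    change Y + y (Fin.last 24) = 0 at hy2
    linarith
  simp only [e1, Finset.sum_add_distrib, Finset.sum_sub_distrib, ← Finset.mul_sum,
    ← Finset.sum_mul, ← hX, ← hY, e2, e3]
  simp only [Finset.sum_const, Finset.card_univ, Fintype.card_fin]
  ring

theorem dot_quarter_sub {n : ℕ} (x : Fin n → ℚ) (i : Fin n) :
    dotB n x (cst n (1 / 4) - ev i) = (∑ j, x j) / 4 - x i := by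
  rw [map_sub, dot_cst, dot_ev]
  ring

theorem norm_f4 (i : Fin 24) :
    dotB 24 (cst 24 (1 / 4) - ev i) (cst 24 (1 / 4) - ev i) = 2 := by
  rw [dot_quarter_sub]
  simp only [Pi.sub_apply, Finset.sum_sub_distrib, sum_ev, sum_cst]
  simp
  norm_num

theorem int_sum_zero {n : ℕ} {y : Fin n → ℚ} (hy : ∀ i, IsZ (y i)) (h2 : dotB n y y = 2)
    (h4 : IsZ ((∑ i, y i) / 4)) : ∑ i, y i = 0 := by
  obtain ⟨a, b⟩ := abs_sum_le hy
  rw [dotB_apply] at h2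
  rw [h2] at a b
  obtain ⟨k, hk⟩ := h4
  have hk' : ∑ i, y i = 4 * k := by linarith
  rw [hk'] at a b ⊢
  have a' : 4 * k ≤ 2 := by exact_mod_cast a
  have b' : -(4 * k) ≤ 2 := by exact_mod_cast b
  have : k = 0 := by omega
  simp [this]

theorem case4_hit {z : Fin 24 → ℚ} (hz : ∀ i, IsZ (z i))
    (h2 : dotB 24 (cst 24 (1 / 4) + z) (cst 24 (1 / 4) + z) = 2) :
    ∃ x ∈ latA 24, psi4 x = cst 24 (1 / 4) + z := by
  rw [quarter_norm] at h2
  obtain ⟨a, b⟩ := abs_sum_le hz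
  obtain ⟨S, hS⟩ := IsZ.sum Finset.univ z fun i _ => hz i
  obtain ⟨Q, hQ⟩ := IsZ.sum Finset.univ (fun i => z i * z i) fun i _ => (hz i).mul (hz i)
  have hS1 : S = -1 := by
    rw [hS, hQ] at h2 a b
    have a' : S ≤ Q := by exact_mod_cast a
    have b' : -S ≤ Q := by exact_mod_cast b
    have c' : S + 2 * Q = 1 := by
      have : (S + 2 * Q : ℚ) = 1 := by push_cast at h2; linarith
      exact_mod_cast this
    omega
  have hS2 : ∑ i, z i = -1 := by rw [hS, hS1]; simp
  refine ⟨Fin.snoc (α := fun _ => ℚ) (-z) (-1), ⟨fun i => ?_, ?_⟩, ?_⟩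
  · refine Fin.lastCases ?_ (fun j => ?_) i
    · rw [Fin.snoc_last]
      exact isZ_one.neg
    · rw [Fin.snoc_castSucc]
      exact (hz j).neg
  · rw [Fin.sum_univ_castSucc]
    simp only [Fin.snoc_castSucc, Fin.snoc_last, Pi.neg_apply, Finset.sum_neg_distrib, hS2]
    norm_num
  · funext i
    rw [psi4_snoc]
    simp only [Pi.neg_apply, Finset.sum_neg_distrib, hS2, Pi.add_apply]
    ring

theorem ev_sq {n : ℕ} (i j : Fin n) : (ev i : Fin n → ℚ) j * (ev i : Fin n → ℚ) j
    = (ev i : Fin n → ℚ) j := by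
  by_cases h : j = i
  · subst h
    simp
  · simp [h]

theorem case4_odd :
    ∃ k : ℤ, dotB 24 (cst 24 (1 / 4) + ev 0) (cst 24 (1 / 4) + ev 0) = 2 * k + 1 := by
  refine ⟨1, ?_⟩
  rw [quarter_norm]
  simp only [ev_sq, sum_ev]
  norm_num

theorem case4_exist : NeighborsRootPair (dotB 24) (nb (dotB 24) (latDp 24) (cst 24 (1 / 4) + ev 0))
    (stdDot 24) (latD 24) (stdDot 25) (latA 24) := by
  have hs := (dotB_pos 24).1
  have h2m : (2 : ℤ) • (cst 24 (1 / 4) + ev 0) ∈ latDp 24 := by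
    rw [smul_add]
    refine Submodule.add_mem _ ?_ (latD_le_latDp _ (two_mem_latD (ev_int 0)))
    convert half_mem_latDp 24 using 1
    funext i
    simp
    norm_num
  have htt : (cst 24 (1 / 4) - ev 0) - (cst 24 (1 / 4) + ev 0) ∈ latDp 24 := by
    have : (cst 24 (1 / 4) - ev 0) - (cst 24 (1 / 4) + ev 0) = -(ev 0 + ev 0) := by abel
    rw [this]
    exact Submodule.neg_mem _ (latD_le_latDp _ (ev_add_mem 0 0))
  have h2m' : (2 : ℤ) • (cst 24 (1 / 4) - ev 0) ∈ latDp 24 := by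
    have := Submodule.add_mem _ (Submodule.smul_mem _ 2 htt) h2m
    rwa [← smul_add, sub_add_cancel] at this
  have fZ : ∀ i j : Fin 24, IsZ (dotB 24 (ev i - ev j) (cst 24 (1 / 4) - ev 0)) := by
    intro i j
    rw [dot_quarter_sub]
    simp only [Pi.sub_apply, Finset.sum_sub_distrib, sum_ev, sub_self, zero_div, zero_sub]
    exact ((ev_int i 0).sub (ev_int j 0)).neg
  have fmem : ∀ i : Fin 24, cst 24 (1 / 4) - ev i ∈
      rootSublattice (dotB 24) (nb (dotB 24) (latDp 24) (cst 24 (1 / 4) - ev 0)) := by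
    intro i
    refine Submodule.subset_span ⟨?_, norm_f4 i⟩
    have := Submodule.add_mem _ (self_mem_nb (B := dotB 24) (E := latDp 24)
      (t := cst 24 (1 / 4) - ev 0)) (mem_nb_of (latD_le_latDp _ (ev_sub_mem 0 i)) (fZ 0 i))
    simpa using this
  refine exist_of (t' := cst 24 (1 / 4) - ev 0) (by simp) (dotB_pos 24) (latDp_uni (m := 6) rfl)
    (latDp_even (m := 3) rfl) (span_of_latD (latD_le_latDp 24)) h2m htt case4_odd
    ⟨1, by rw [norm_f4]; norm_num⟩ (iso_of_eq ?_)
    (iso_of_psi (C₂ := dotB 25) (dotB_pos 25) psi4 (fun x hx y hy => psi4_isom x y hx hy) ?_ ?_)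
  · exact root_eq (latD_le_latDp 24) (latD_gen 24 (by norm_num)) fun x hx h2 =>
      latDp_root (m := 3) rfl (by norm_num) hx h2.le
  · intro x hx
    have := latA_gen 24 (S := (rootSublattice (dotB 24) (nb (dotB 24) (latDp 24)
      (cst 24 (1 / 4) - ev 0))).comap (psi4.restrictScalars ℤ)) ?_ hx
    · exact this
    · intro i j _
      change psi4 (ev i - ev j) ∈ rootSublattice (dotB 24)
          (nb (dotB 24) (latDp 24) (cst 24 (1 / 4) - ev 0))
      have key : ∀ i : Fin 25, psi4 (ev i) ∈ rootSublattice (dotB 24)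
          (nb (dotB 24) (latDp 24) (cst 24 (1 / 4) - ev 0)) := by
        intro i
        refine Fin.lastCases ?_ (fun j => ?_) i
        · rw [psi4_last]
          exact Submodule.zero_mem _
        · rw [psi4_ev]
          exact fmem j
      rw [map_sub]
      exact Submodule.sub_mem _ (key i) (key j)
  · intro y hy hy2
    rcases nb_cases h2m' ⟨2, by rw [norm_f4]; norm_num⟩ hy with ⟨h1, h3⟩ | ⟨h1, h3⟩
    · have hyD := latDp_root (m := 3) rfl (by norm_num) h1 hy2.le
      rw [dot_quarter_sub] at h3
      have h0 := int_sum_zero hyD.1 hy2 (by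
        have := h3.add (hyD.1 0)
        simpa using this)
      refine ⟨Fin.snoc (α := fun _ => ℚ) (-y) 0, ⟨fun i => ?_, ?_⟩, ?_⟩
      · refine Fin.lastCases ?_ (fun j => ?_) i
        · rw [Fin.snoc_last]
          exact isZ_zero
        · rw [Fin.snoc_castSucc]
          exact IsZ.neg (hyD.1 j)
      · rw [Fin.sum_univ_castSucc]
        simp only [Fin.snoc_castSucc, Fin.snoc_last, Pi.neg_apply, Finset.sum_neg_distrib, h0]
        norm_num
      · funext i
        rw [psi4_snoc]
        simp only [Pi.neg_apply, Finset.sum_neg_distrib, h0]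
        ring
    · rcases (mem_latDp (m := 12) rfl).1 h1 with h | h
      · have hz : ∀ i, IsZ ((y - cst 24 (1 / 4)) i) := by
          intro i
          have := IsZ.sub (h.1 i) (ev_int 0 i)
          convert this using 1
          simp
          try ring
        have e : y = cst 24 (1 / 4) + (y - cst 24 (1 / 4)) := by abel
        rw [e] at hy2
        obtain ⟨x, hx, hxy⟩ := case4_hit hz hy2
        exact ⟨x, hx, by rw [hxy, ← e]⟩
      · have hz : ∀ i, IsZ ((-y - cst 24 (1 / 4)) i) := by
          intro i
          have := IsZ.sub (IsZ.sub (ev_int 0 i) (h.1 i)) (isZ_one)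
          convert this using 1
          simp
          ring
        have e : -y = cst 24 (1 / 4) + (-y - cst 24 (1 / 4)) := by abel
        have hy3 : dotB 24 (-y) (-y) = 2 := by simpa using hy2
        rw [e] at hy3
        obtain ⟨x, hx, hxy⟩ := case4_hit hz hy3
        exact ⟨-x, Submodule.neg_mem _ hx, by rw [map_neg, hxy, ← e, neg_neg]⟩

theorem case4_unique {B₁ B₂ : V →ₗ[ℚ] V →ₗ[ℚ] ℚ} [FiniteDimensional ℚ V] {N₁ N₂ : Submodule ℤ V}
    (h₁ : NeighborsRootPair B₁ N₁ (stdDot 24) (latD 24) (stdDot 25) (latA 24))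
    (h₂ : NeighborsRootPair B₂ N₂ (stdDot 24) (latD 24) (stdDot 25) (latA 24)) :
    LatticeIsometric (fun x y => B₁ x y) (fun x y => B₂ x y) N₁ N₂ :=
  unique_of_normal (C := dotB 24) (C₂ := dotB 25) (dotB_pos 24) (span_of_latD le_rfl) (by simp)
    (latDp 24) (cst 24 (1 / 4) + ev 0) case4_odd case4_normal h₁ h₂



theorem span_int {C : W →ₗ[ℚ] W →ₗ[ℚ] ℚ} {S : Set W} (h : ∀ x ∈ S, ∀ y ∈ S, IsZ (C x y)) :
    Submodule.span ℤ S ≤ dualLattice C (Submodule.span ℤ S) := by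
  intro x hx y hy
  change IsZ (C x y)
  induction hx using Submodule.span_induction with
  | zero => simpa using isZ_zero
  | add a b _ _ iha ihb =>
    rw [map_add, LinearMap.add_apply]
    exact iha.add ihb
  | smul c a _ iha =>
    rw [B_zsmul_left]
    exact (isZ_int c).mul iha
  | mem a ha =>
    induction hy using Submodule.span_induction with
    | zero => simpa using isZ_zero
    | add c d _ _ ihc ihd =>
      rw [map_add]
      exact ihc.add ihd
    | smul c d _ ihd =>
      rw [B_zsmul_right]
      exact (isZ_int c).mul ihd
    | mem b hb => exact h a ha b hb

theorem span_even {C : W →ₗ[ℚ] W →ₗ[ℚ] ℚ} (hs : ∀ x y, C x y = C y x) {S : Set W}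
    (h : ∀ x ∈ S, ∀ y ∈ S, IsZ (C x y)) (h2 : ∀ x ∈ S, ∃ k : ℤ, C x x = 2 * k) :
    IsEvenLat C (Submodule.span ℤ S) := by
  have hi := span_int h
  intro x hx
  induction hx using Submodule.span_induction with
  | zero => exact ⟨0, by simp⟩
  | add a b ha hb iha ihb =>
    obtain ⟨k, hk⟩ := iha
    obtain ⟨l, hl⟩ := ihb
    obtain ⟨m, hm⟩ := hi ha b hb
    refine ⟨k + l + m, ?_⟩
    simp only [map_add, LinearMap.add_apply]
    rw [hs b a, hk, hl, hm]
    push_cast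
    ring
  | smul c a _ iha =>
    obtain ⟨k, hk⟩ := iha
    refine ⟨c * c * k, ?_⟩
    rw [B_zsmul_left, B_zsmul_right, hk]
    push_cast
    ring
  | mem a ha => exact h2 a ha

theorem odd_mem {n : ℕ} {i : Fin n} {z : Fin n → ℚ} :
    z - ev i ∈ latD n ↔ (∀ i, IsZ (z i)) ∧ ∃ k : ℤ, ∑ i, z i = 2 * k + 1 := by
  constructor
  · rintro ⟨h1, k, hk⟩
    refine ⟨fun j => ?_, k, ?_⟩
    · have := IsZ.add (h1 j) (ev_int i j)
      simpa using this
    · simp only [Pi.sub_apply, Finset.sum_sub_distrib, sum_ev] at hk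
      linarith
  · rintro ⟨h1, k, hk⟩
    refine ⟨fun j => (h1 j).sub (ev_int i j), k, ?_⟩
    simp only [Pi.sub_apply, Finset.sum_sub_distrib, sum_ev, hk]
    ring

/-- The form on `ℚ¹² × ℚ¹²`. -/
noncomputable abbrev C3 : (Fin 12 → ℚ) × (Fin 12 → ℚ) →ₗ[ℚ] (Fin 12 → ℚ) × (Fin 12 → ℚ) →ₗ[ℚ] ℚ :=
  prodB (dotB 12) (dotB 12)

theorem C3_pos : IsPosDefSymm C3 := prodB_pos (dotB_pos 12) (dotB_pos 12)

/-- First glue vector. -/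
def h3 : (Fin 12 → ℚ) × (Fin 12 → ℚ) := (cst 12 (1 / 2), cst 12 (1 / 2))

/-- Second glue vector. -/
def g3 : (Fin 12 → ℚ) × (Fin 12 → ℚ) := (ev 0, cst 12 (1 / 2) + ev 0)

theorem C3_h3 (x : (Fin 12 → ℚ) × (Fin 12 → ℚ)) :
    C3 x h3 = (∑ i, x.1 i) / 2 + (∑ i, x.2 i) / 2 := by
  rw [prodB_apply, h3, dot_cst, dot_cst]
  ring

theorem C3_g3 (x : (Fin 12 → ℚ) × (Fin 12 → ℚ)) :
    C3 x g3 = x.1 0 + (∑ i, x.2 i) / 2 + x.2 0 := by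
  rw [prodB_apply, g3, map_add, dot_cst, dot_ev, dot_ev]
  ring

theorem sum_h1 : ∑ i, h3.1 i = 6 := by
  rw [h3, sum_cst]
  norm_num

theorem sum_h2 : ∑ i, h3.2 i = 6 := by
  rw [h3, sum_cst]
  norm_num

theorem sum_g2 : ∑ i, g3.2 i = 7 := by
  simp only [g3, Pi.add_apply, Finset.sum_add_distrib, sum_ev, sum_cst]
  norm_num

/-- The Niemeier lattice with root system `D₁₂²`. -/
def E3 : Submodule ℤ ((Fin 12 → ℚ) × (Fin 12 → ℚ)) :=
  Submodule.span ℤ (((latD 12).prod (latD 12) : Submodule ℤ _) ∪ {h3, g3})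

theorem M3_le : (latD 12).prod (latD 12) ≤ E3 := fun _ hx =>
  Submodule.subset_span (Or.inl hx)

theorem h3_mem : h3 ∈ E3 := Submodule.subset_span (Or.inr (Or.inl rfl))

theorem g3_mem : g3 ∈ E3 := Submodule.subset_span (Or.inr (Or.inr rfl))

theorem E3_gen_int : ∀ x ∈ ((((latD 12).prod (latD 12) : Submodule ℤ _) : Set _) ∪ {h3, g3}),
    ∀ y ∈ ((((latD 12).prod (latD 12) : Submodule ℤ _) : Set _) ∪ {h3, g3}), IsZ (C3 x y) := by
  have hs := C3_pos.1
  have hMM : ∀ x ∈ (latD 12).prod (latD 12), ∀ y ∈ (latD 12).prod (latD 12), IsZ (C3 x y) :=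
    fun x hx y hy => (dot_int hx.1.1 hy.1.1).add (dot_int hx.2.1 hy.2.1)
  have hMh : ∀ x ∈ (latD 12).prod (latD 12), IsZ (C3 x h3) := by
    rintro x ⟨⟨-, k, hk⟩, ⟨-, l, hl⟩⟩
    exact ⟨k + l, by rw [C3_h3]; rw [hk, hl]; push_cast; ring⟩
  have hMg : ∀ x ∈ (latD 12).prod (latD 12), IsZ (C3 x g3) := by
    rintro x ⟨⟨h1, -⟩, ⟨h2, l, hl⟩⟩
    rw [C3_g3]
    exact IsZ.add (IsZ.add (h1 0) ⟨l, by rw [hl]; ring⟩) (h2 0)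
  have hhh : IsZ (C3 h3 h3) := ⟨6, by rw [C3_h3, sum_h1, sum_h2]; norm_num⟩
  have hhg : IsZ (C3 h3 g3) := ⟨4, by rw [C3_g3, sum_h2, h3]; norm_num⟩
  have hgg : IsZ (C3 g3 g3) := ⟨6, by rw [C3_g3, sum_g2, g3]; norm_num⟩
  rintro x (hx | rfl | rfl) y (hy | rfl | rfl)
  · exact hMM x hx y hy
  · exact hMh x hx
  · exact hMg x hx
  · rw [hs]
    exact hMh y hy
  · exact hhh
  · exact hhg
  · rw [hs]
    exact hMg y hy
  · rw [hs]
    exact hhg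
  · exact hgg

theorem E3_even : IsEvenLat C3 E3 := by
  refine span_even C3_pos.1 E3_gen_int ?_
  rintro x (hx | rfl | rfl)
  · obtain ⟨k, hk⟩ := latD_even 12 _ hx.1
    obtain ⟨l, hl⟩ := latD_even 12 _ hx.2
    exact ⟨k + l, by rw [prodB_apply, hk, hl]; push_cast; ring⟩
  · exact ⟨3, by rw [C3_h3, sum_h1, sum_h2]; norm_num⟩
  · exact ⟨3, by rw [C3_g3, sum_g2, g3]; norm_num⟩

theorem C3_dual {L : Submodule ℤ ((Fin 12 → ℚ) × (Fin 12 → ℚ))}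
    (hL : (latD 12).prod (latD 12) ≤ L) {x : (Fin 12 → ℚ) × (Fin 12 → ℚ)}
    (hx : ∀ y ∈ L, IsZ (C3 x y)) :
    ((∀ i, IsZ (x.1 i)) ∨ (∀ i, ∃ m : ℤ, x.1 i = m + 1 / 2)) ∧
      ((∀ i, IsZ (x.2 i)) ∨ (∀ i, ∃ m : ℤ, x.2 i = m + 1 / 2)) := by
  constructor
  · refine dual_latD fun y hy => ?_
    have := hx (y, 0) (hL ⟨hy, Submodule.zero_mem _⟩)
    simpa [prodB_apply] using this
  · refine dual_latD fun y hy => ?_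
    have := hx (0, y) (hL ⟨Submodule.zero_mem _, hy⟩)
    simpa [prodB_apply] using this

theorem sub_half_int {n : ℕ} {x : Fin n → ℚ} (h : ∀ i, ∃ m : ℤ, x i = m + 1 / 2) (i : Fin n) :
    IsZ ((x - cst n (1 / 2)) i) := by
  obtain ⟨m, hm⟩ := h i
  exact ⟨m, by simp [hm]⟩

theorem E3_cases {x : (Fin 12 → ℚ) × (Fin 12 → ℚ)} (hx : ∀ y ∈ E3, IsZ (C3 x y)) :
    (x ∈ (latD 12).prod (latD 12)) ∨
    ((∀ i, ∃ m : ℤ, x.1 i = m + 1 / 2) ∧ (x - h3 ∈ (latD 12).prod (latD 12) ∨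
      x - h3 - g3 ∈ (latD 12).prod (latD 12))) ∨
    ((∀ i, ∃ m : ℤ, x.2 i = m + 1 / 2) ∧ x - g3 ∈ (latD 12).prod (latD 12)) := by
  obtain ⟨a, ha⟩ := hx _ h3_mem
  obtain ⟨b, hb⟩ := hx _ g3_mem
  rw [C3_h3] at ha
  rw [C3_g3] at hb
  obtain ⟨h1 | h1, h2 | h2⟩ := C3_dual M3_le hx
  · left
    obtain ⟨p, hp⟩ := h1 0
    obtain ⟨q, hq⟩ := h2 0
    have s2 : ∑ i, x.2 i = 2 * (b - p - q : ℤ) := by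
      rw [hp, hq] at hb
      push_cast
      linarith
    refine ⟨⟨h1, a - (b - p - q), ?_⟩, ⟨h2, _, s2⟩⟩
    rw [s2] at ha
    push_cast at ha ⊢
    linarith
  · right; right
    refine ⟨h2, ?_⟩
    obtain ⟨p, hp⟩ := h1 0
    obtain ⟨q, hq⟩ := h2 0
    rw [hp, hq] at hb
    have s2 : ∑ i, x.2 i = 2 * b - 2 * p - 2 * q - 1 := by linarith
    have s1 : ∑ i, x.1 i = 2 * (a - b + p + q : ℤ) + 1 := by
      rw [s2] at ha
      push_cast
      linarith
    constructor
    · exact odd_mem.2 ⟨h1, _, s1⟩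
    · have e : (x - g3).2 = (x.2 - cst 12 (1 / 2)) - ev 0 := by
        simp only [g3, Prod.snd_sub]
        abel
      rw [e]
      refine odd_mem.2 ⟨sub_half_int h2, b - p - q - 4, ?_⟩
      simp only [Pi.sub_apply, Finset.sum_sub_distrib, sum_cst, s2]
      push_cast
      ring
  · right; left
    refine ⟨h1, Or.inr ?_⟩
    obtain ⟨p, hp⟩ := h1 0
    obtain ⟨q, hq⟩ := h2 0
    rw [hp, hq] at hb
    have s2 : ∑ i, x.2 i = 2 * b - 2 * p - 2 * q - 1 := by linarith
    have s1 : ∑ i, x.1 i = 2 * (a - b + p + q : ℤ) + 1 := by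
      rw [s2] at ha
      push_cast
      linarith
    constructor
    · have e : (x - h3 - g3).1 = (x.1 - cst 12 (1 / 2)) - ev 0 := by
        simp only [g3, h3, Prod.fst_sub]
      rw [e]
      refine odd_mem.2 ⟨sub_half_int h1, a - b + p + q - 3, ?_⟩
      simp only [Pi.sub_apply, Finset.sum_sub_distrib, sum_cst, s1]
      push_cast
      ring
    · have e : (x - h3 - g3).2 = (x.2 - cst 12 1) - ev 0 := by
        funext i
        simp only [g3, h3, Prod.snd_sub, Pi.sub_apply, Pi.add_apply]
        ring
      rw [e]
      refine odd_mem.2 ⟨fun i => (h2 i).sub isZ_one, b - p - q - 7, ?_⟩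
      simp only [Pi.sub_apply, Finset.sum_sub_distrib, sum_cst, s2]
      push_cast
      ring
  · right; left
    refine ⟨h1, Or.inl ?_⟩
    obtain ⟨p, hp⟩ := h1 0
    obtain ⟨q, hq⟩ := h2 0
    rw [hp, hq] at hb
    have s2 : ∑ i, x.2 i = 2 * b - 2 * p - 2 * q - 2 := by linarith
    have s1 : ∑ i, x.1 i = 2 * (a - b + p + q + 1 : ℤ) := by
      rw [s2] at ha
      push_cast
      linarith
    refine ⟨⟨sub_half_int h1, a - b + p + q + 1 - 3, ?_⟩,
      ⟨sub_half_int h2, b - p - q - 1 - 3, ?_⟩⟩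
    · change ∑ i, (x.1 - cst 12 (1 / 2)) i = _
      simp only [Pi.sub_apply, Finset.sum_sub_distrib, sum_cst, s1]
      push_cast
      ring
    · change ∑ i, (x.2 - cst 12 (1 / 2)) i = _
      simp only [Pi.sub_apply, Finset.sum_sub_distrib, sum_cst, s2]
      push_cast
      ring

theorem E3_uni : IsUnimodular C3 E3 := by
  refine le_antisymm (span_int E3_gen_int) ?_
  intro x hx
  rcases E3_cases hx with h | ⟨-, h | h⟩ | ⟨-, h⟩
  · exact M3_le h
  · have := Submodule.add_mem _ (M3_le h) h3_mem
    simpa using this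
  · have := Submodule.add_mem _ (Submodule.add_mem _ (M3_le h) g3_mem) h3_mem
    simpa using this
  · have := Submodule.add_mem _ (M3_le h) g3_mem
    simpa using this

theorem dot_nonneg {n : ℕ} (x : Fin n → ℚ) : 0 ≤ dotB n x x := by
  rw [dotB_apply]
  exact Finset.sum_nonneg fun i _ => mul_self_nonneg _

theorem E3_root {x : (Fin 12 → ℚ) × (Fin 12 → ℚ)} (hx : x ∈ E3) (h2 : C3 x x = 2) :
    x ∈ (latD 12).prod (latD 12) := by
  rw [prodB_apply] at h2
  have n1 := dot_nonneg x.1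
  have n2 := dot_nonneg x.2
  rcases E3_cases (fun y hy => uni_int E3_uni hx hy) with h | ⟨h, -⟩ | ⟨h, -⟩
  · exact h
  · have := half_norm_ge h
    norm_num at this
    linarith
  · have := half_norm_ge h
    norm_num at this
    linarith

/-- The map to a sum of coordinates. -/
noncomputable def sumJ (m n : ℕ) : (Fin m → ℚ) × (Fin n → ℚ) →ₗ[ℚ] (Fin m ⊕ Fin n → ℚ) :=
  (LinearEquiv.sumArrowLequivProdArrow (Fin m) (Fin n) ℚ ℚ).symm.toLinearMap

theorem sumJ_inl {m n : ℕ} (x : (Fin m → ℚ) × (Fin n → ℚ)) (i : Fin m) :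
    sumJ m n x (Sum.inl i) = x.1 i := rfl

theorem sumJ_inr {m n : ℕ} (x : (Fin m → ℚ) × (Fin n → ℚ)) (i : Fin n) :
    sumJ m n x (Sum.inr i) = x.2 i := rfl

theorem sumJ_isom {m n : ℕ} (x y : (Fin m → ℚ) × (Fin n → ℚ)) :
    prodB (dotB m) (dotB n) x y = ∑ i, sumJ m n x i * sumJ m n y i := by
  rw [Fintype.sum_sum_type]
  simp only [sumJ_inl, sumJ_inr]
  rfl

/-- Block obstruction in case 3. -/
theorem case3_obs {E : Submodule ℤ ((Fin 12 → ℚ) × (Fin 12 → ℚ))}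
    {t : (Fin 12 → ℚ) × (Fin 12 → ℚ)}
    (h : Cfg C3 ((latD 12).prod (latD 12)) (prodB (dotB 13) (dotB 13))
      ((latA 12).prod (latA 12)) E t)
    (ι : (Fin 12 → ℚ) →ₗ[ℚ] (Fin 12 → ℚ) × (Fin 12 → ℚ))
    (hι : ∀ x y, C3 (ι x) (ι y) = dotB 12 x y) (hιM : ∀ x ∈ latD 12, ι x ∈ (latD 12).prod (latD 12))
    {u : Fin 12 → ℚ} (hu : ∀ x, C3 (ι x) t = dotB 12 x u) (hd : ∀ i, IsZ (2 * u i)) : False := by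
  obtain ⟨T, hT, hTp⟩ := exists_parity (t := u) (by norm_num) hd
  obtain ⟨p, hp1, hp2⟩ := h.obs (sumJ 13 13) sumJ_isom
  have hne : T.Nonempty := Finset.card_pos.1 (by omega)
  obtain ⟨k, hk⟩ := hne
  obtain ⟨-, i, hi, -⟩ := obsT (T := T) (by simpa using hT) p Finset.univ
    (fun x hx h2 h3 => by
      obtain ⟨y, hy, hxy⟩ := hp1 x hx h2 h3
      rw [hxy]
      refine ⟨?_, ?_⟩
      · rintro (i | i)
        · exact hy.1.1 i
        · exact hy.2.1 i
      · rw [Fintype.sum_sum_type]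
        simp only [sumJ_inl, sumJ_inr]
        rw [hy.1.2, hy.2.2, add_zero]) hp2 (fun k => ι (ev (k : Fin 12)))
    (fun k l => by
      rw [hι, norm_ev]
      exact if_congr Subtype.ext_iff.symm rfl rfl)
    (fun k l _ => by
      rw [← map_add, ← map_sub]
      exact ⟨h.le (hιM _ (ev_add_mem _ _)), h.le (hιM _ (ev_sub_mem _ _))⟩)
    (fun k l _ => by
      rw [← map_add, ← map_sub, hu, hu]
      rw [(dotB_pos 12).1, (dotB_pos 12).1 _ u, map_add, map_sub, dot_ev, dot_ev]
      exact hTp k k.2 l l.2) ⟨k, hk⟩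
  exact hi (Finset.mem_univ _)



theorem half_norm {n : ℕ} (z : Fin n → ℚ) :
    dotB n (cst n (1 / 2) + z) (cst n (1 / 2) + z) =
      n * (1 / 4) + (∑ i, z i) + ∑ i, z i * z i := by
  have : (n : ℚ) * (1 / 4) = ∑ i, cst n (1 / 4) i := (sum_cst _).symm
  rw [this, dotB_apply, ← Finset.sum_add_distrib, ← Finset.sum_add_distrib]
  refine Finset.sum_congr rfl fun i _ => ?_
  simp only [Pi.add_apply]
  ring

theorem mapL_trans (e f : W ≃ₗ[ℚ] W) (L : Submodule ℤ W) :
    mapL (e.trans f) L = mapL f (mapL e L) := by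
  ext x
  rw [mem_mapL, mem_mapL, mem_mapL]
  rfl

theorem prodCongr_isom {B : V →ₗ[ℚ] V →ₗ[ℚ] ℚ} {C : W →ₗ[ℚ] W →ₗ[ℚ] ℚ} {e : V ≃ₗ[ℚ] V}
    {f : W ≃ₗ[ℚ] W} (he : Isom B B e) (hf : Isom C C f) :
    Isom (prodB B C) (prodB B C) (e.prodCongr f) := by
  intro x y
  rw [prodB_apply, prodB_apply, ← he x.1 y.1, ← hf x.2 y.2]
  rfl

theorem case3_lemma {E : Submodule ℤ ((Fin 12 → ℚ) × (Fin 12 → ℚ))} {z1 z2 : Fin 12 → ℚ}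
    (h : Cfg C3 ((latD 12).prod (latD 12)) (prodB (dotB 13) (dotB 13))
      ((latA 12).prod (latA 12)) E (cst 12 (1 / 4) + z1, cst 12 (1 / 4) + z2))
    (hz1 : ∀ i, IsZ (z1 i)) (hz2 : ∀ i, IsZ (z2 i)) :
    E = E3 ∧ (((∃ k : ℤ, ∑ i, z1 i = 2 * k + 1) ∧ ∃ k : ℤ, ∑ i, z2 i = 2 * k) ∨
      ((∃ k : ℤ, ∑ i, z1 i = 2 * k) ∧ ∃ k : ℤ, ∑ i, z2 i = 2 * k + 1)) := by
  have half : h3 ∈ E := by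
    have hd : (((2 : ℤ) • z1, (2 : ℤ) • z2) : (Fin 12 → ℚ) × (Fin 12 → ℚ)) ∈ E :=
      h.le ⟨two_mem_latD hz1, two_mem_latD hz2⟩
    have h3' := Submodule.sub_mem _ h.two hd
    convert h3' using 1
    apply Prod.ext
    · funext i
      simp [h3]
      norm_num
    · funext i
      simp [h3]
      norm_num
  have hdual : ∀ x ∈ E, ((∀ i, IsZ (x.1 i)) ∨ (∀ i, ∃ m : ℤ, x.1 i = m + 1 / 2)) ∧
      ((∀ i, IsZ (x.2 i)) ∨ (∀ i, ∃ m : ℤ, x.2 i = m + 1 / 2)) :=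
    fun x hx => C3_dual h.le fun y hy => uni_int h.uni hx hy
  have hex : ∃ x ∈ E, (∀ i, IsZ (x.1 i)) ∧ ∀ i, ∃ m : ℤ, x.2 i = m + 1 / 2 := by
    by_contra hno
    have he : ((ev 0, ev 0) : (Fin 12 → ℚ) × (Fin 12 → ℚ)) ∈ E := by
      rw [h.uni]
      intro x hx
      change IsZ (C3 (ev 0, ev 0) x)
      rw [C3_pos.1, prodB_apply]
      simp only [dot_ev]
      obtain ⟨h1 | h1, h2 | h2⟩ := hdual x hx
      · exact (h1 0).add (h2 0)
      · exact absurd ⟨x, hx, h1, h2⟩ hno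
      · refine absurd ⟨x - h3, Submodule.sub_mem _ hx half, fun i => sub_half_int h1 i,
          fun i => ?_⟩ hno
        obtain ⟨m, hm⟩ := h2 i
        refine ⟨m - 1, ?_⟩
        change x.2 i - 1 / 2 = _
        rw [hm]
        push_cast
        ring
      · obtain ⟨m, hm⟩ := h1 0
        obtain ⟨l, hl⟩ := h2 0
        exact ⟨m + l + 1, by rw [hm, hl]; push_cast; ring⟩
    have hM := h.root _ he (by
      rw [prodB_apply, norm_ev]
      norm_num)
    obtain ⟨-, k, hk⟩ := hM.1
    simp only [sum_ev] at hk
    have : (1 : ℤ) = 2 * k := by exact_mod_cast hk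
    omega
  have hg : g3 ∈ E := by
    obtain ⟨x, hx, h1, h2⟩ := hex
    obtain ⟨a, ha⟩ := uni_int h.uni hx half
    obtain ⟨k, hk⟩ := h.even x hx
    have hy := sub_half_int h2
    obtain ⟨S, hS⟩ := IsZ.sum Finset.univ _ fun i _ => h1 i
    obtain ⟨R, hR⟩ := IsZ.sum Finset.univ _ fun i _ => hy i
    have e2 : x.2 = cst 12 (1 / 2) + (x.2 - cst 12 (1 / 2)) := by abel
    obtain ⟨w, hw⟩ := sq_sum h1
    obtain ⟨v, hv⟩ := sq_sum hy
    rw [prodB_apply, e2, half_norm, dotB_apply, hw, hv, hS, hR] at hk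
    rw [C3_h3, hS, e2] at ha
    rw [show ∑ i, (cst 12 (1 / 2) + (x.2 - cst 12 (1 / 2))) i =
      ∑ i, cst 12 (1 / 2) i + ∑ i, (x.2 - cst 12 (1 / 2)) i from Finset.sum_add_distrib,
      hR, sum_cst] at ha
    have hk' : S + 2 * w + 3 + 2 * R + 2 * v = 2 * k := by
      have : (S + 2 * w + 3 + 2 * R + 2 * v : ℚ) = 2 * k := by
        push_cast at hk
        linarith
      exact_mod_cast this
    have ha' : S + 6 + R = 2 * a := by
      have : (S + 6 + R : ℚ) = 2 * a := by
        push_cast at ha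
        linarith
      exact_mod_cast this
    have hxg : x - g3 ∈ (latD 12).prod (latD 12) := by
      constructor
      · refine odd_mem.2 ⟨h1, k - w - 2 - R - v, ?_⟩
        have : S = 2 * (k - w - 2 - R - v) + 1 := by omega
        rw [hS, this]
        push_cast
        ring
      · have e : (x - g3).2 = (x.2 - cst 12 (1 / 2)) - ev 0 := by
          simp only [g3, Prod.snd_sub]
          abel
        rw [e]
        refine odd_mem.2 ⟨hy, a - 3 - (k - w - 2 - R - v) - 1, ?_⟩
        have : R = 2 * (a - 3 - (k - w - 2 - R - v) - 1) + 1 := by omega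
        rw [hR]
        exact_mod_cast this
    have := Submodule.sub_mem _ hx (h.le hxg)
    simpa using this
  refine ⟨uni_eq_of_le h.uni E3_uni ?_, ?_⟩
  · refine Submodule.span_le.2 ?_
    rintro x (hx | rfl | rfl)
    · exact h.le hx
    · exact half
    · exact hg
  · obtain ⟨k, hk⟩ := h.odd
    rw [prodB_apply, quarter_norm, quarter_norm] at hk
    obtain ⟨w, hw⟩ := sq_sum hz1
    obtain ⟨v, hv⟩ := sq_sum hz2
    obtain ⟨S, hS⟩ := IsZ.sum Finset.univ z1 fun i _ => hz1 i
    obtain ⟨R, hR⟩ := IsZ.sum Finset.univ z2 fun i _ => hz2 i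
    rw [hw, hv, hS, hR] at hk
    rw [hS, hR]
    have hk' : 3 + 3 * S + 3 * R + 4 * w + 4 * v = 4 * k + 2 := by
      have : (3 + 3 * S + 3 * R + 4 * w + 4 * v : ℚ) = 4 * k + 2 := by
        push_cast at hk
        linarith
      exact_mod_cast this
    rcases Int.even_or_odd' S with ⟨a, ha | ha⟩ <;> rcases Int.even_or_odd' R with ⟨b, hb | hb⟩
    · omega
    · right
      exact ⟨⟨a, by exact_mod_cast ha⟩, b, by exact_mod_cast hb⟩
    · left
      exact ⟨⟨a, by exact_mod_cast ha⟩, b, by exact_mod_cast hb⟩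
    · omega

/-- The reference glue vector in case 3. -/
def t3 : (Fin 12 → ℚ) × (Fin 12 → ℚ) := (cst 12 (1 / 4) + ev 0, cst 12 (1 / 4))

theorem t3_odd : ∃ k : ℤ, C3 t3 t3 = 2 * k + 1 := by
  refine ⟨1, ?_⟩
  have := quarter_norm (n := 12) 0
  rw [add_zero] at this
  rw [prodB_apply, t3, quarter_norm, this]
  simp only [ev_sq, sum_ev]
  norm_num

theorem sub_t3 {z1 z2 : Fin 12 → ℚ} (hz1 : ∀ i, IsZ (z1 i)) (hz2 : ∀ i, IsZ (z2 i))
    (h1 : ∃ k : ℤ, ∑ i, z1 i = 2 * k + 1) (h2 : ∃ k : ℤ, ∑ i, z2 i = 2 * k) :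
    (cst 12 (1 / 4) + z1, cst 12 (1 / 4) + z2) - t3 ∈ E3 := by
  apply M3_le
  constructor
  · have e : ((cst 12 (1 / 4) + z1, cst 12 (1 / 4) + z2) - t3).1 = z1 - ev 0 := by
      simp [t3]
    rw [e]
    exact odd_mem.2 ⟨hz1, h1⟩
  · have e : ((cst 12 (1 / 4) + z1, cst 12 (1 / 4) + z2) - t3).2 = z2 := by
      simp [t3]
    rw [e]
    exact ⟨hz2, h2⟩

theorem case3_normal (E : Submodule ℤ ((Fin 12 → ℚ) × (Fin 12 → ℚ)))
    (t : (Fin 12 → ℚ) × (Fin 12 → ℚ))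
    (h : Cfg C3 ((latD 12).prod (latD 12)) (prodB (dotB 13) (dotB 13))
      ((latA 12).prod (latA 12)) E t) :
    ∃ e : ((Fin 12 → ℚ) × (Fin 12 → ℚ)) ≃ₗ[ℚ] ((Fin 12 → ℚ) × (Fin 12 → ℚ)), Isom C3 C3 e ∧
      mapL e E = E3 ∧ e t - t3 ∈ E3 := by
  obtain ⟨d1, d2⟩ := C3_dual h.le (x := (2 : ℤ) • t) fun y hy => uni_int h.uni h.two hy
  have q1 : ∀ i, ∃ m : ℤ, 2 * t.1 i = m + 1 / 2 := by
    rcases d1 with d | d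
    · exact (case3_obs h (LinearMap.inl ℚ _ _) (fun x y => by simp [prodB_apply])
        (fun x hx => ⟨hx, Submodule.zero_mem _⟩) (u := t.1) (fun x => by simp [prodB_apply])
        (fun i => by simpa using d i)).elim
    · intro i
      simpa using d i
  have q2 : ∀ i, ∃ m : ℤ, 2 * t.2 i = m + 1 / 2 := by
    rcases d2 with d | d
    · exact (case3_obs h (LinearMap.inr ℚ _ _) (fun x y => by simp [prodB_apply])
        (fun x hx => ⟨Submodule.zero_mem _, hx⟩) (u := t.2) (fun x => by simp [prodB_apply])
        (fun i => by simpa using d i)).elim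
    · intro i
      simpa using d i
  obtain ⟨s1, hs1, hst1⟩ := flip_quarter q1
  obtain ⟨s2, hs2, hst2⟩ := flip_quarter q2
  obtain ⟨z1, hz1, ht1⟩ := quarter_of (t := flip s1 hs1 t.1) hst1
  obtain ⟨z2, hz2, ht2⟩ := quarter_of (t := flip s2 hs2 t.2) hst2
  have he := prodCongr_isom (flip_isom s1 hs1) (flip_isom s2 hs2)
  have h' := h.map (e := (flip s1 hs1).prodCongr (flip s2 hs2)) he
    (fun x => and_congr (flip_mem_iff s1 hs1 x.1) (flip_mem_iff s2 hs2 x.2))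
  have het : (flip s1 hs1).prodCongr (flip s2 hs2) t =
      (cst 12 (1 / 4) + z1, cst 12 (1 / 4) + z2) := Prod.ext ht1 ht2
  rw [het] at h'
  obtain ⟨hE, ⟨hS, hR⟩ | ⟨hS, hR⟩⟩ := case3_lemma h' hz1 hz2
  · refine ⟨_, he, hE, ?_⟩
    rw [het]
    exact sub_t3 hz1 hz2 hS hR
  · have hsw : Isom C3 C3 (LinearEquiv.prodComm ℚ (Fin 12 → ℚ) (Fin 12 → ℚ)) := by
      intro x y
      rw [prodB_apply, prodB_apply]
      exact add_comm _ _
    have h'' := h'.map hsw (fun x => and_comm)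
    change Cfg _ _ _ _ _ (cst 12 (1 / 4) + z2, cst 12 (1 / 4) + z1) at h''
    obtain ⟨hE2, -⟩ := case3_lemma h'' hz2 hz1
    refine ⟨((flip s1 hs1).prodCongr (flip s2 hs2)).trans (LinearEquiv.prodComm ℚ _ _), ?_, ?_, ?_⟩
    · intro x y
      rw [LinearEquiv.trans_apply, LinearEquiv.trans_apply, hsw, he]
    · rw [mapL_trans]
      exact hE2
    · rw [LinearEquiv.trans_apply, het]
      exact sub_t3 hz2 hz1 hR hS

theorem case3_unique {B₁ B₂ : V →ₗ[ℚ] V →ₗ[ℚ] ℚ} [FiniteDimensional ℚ V] {N₁ N₂ : Submodule ℤ V}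
    (h₁ : NeighborsRootPair B₁ N₁ (prodForm (stdDot 12) (stdDot 12)) ((latD 12).prod (latD 12))
      (prodForm (stdDot 13) (stdDot 13)) ((latA 12).prod (latA 12)))
    (h₂ : NeighborsRootPair B₂ N₂ (prodForm (stdDot 12) (stdDot 12)) ((latD 12).prod (latD 12))
      (prodForm (stdDot 13) (stdDot 13)) ((latA 12).prod (latA 12))) :
    LatticeIsometric (fun x y => B₁ x y) (fun x y => B₂ x y) N₁ N₂ :=
  unique_of_normal (C := C3) (C₂ := prodB (dotB 13) (dotB 13)) C3_pos
    (span_prod (span_of_latD le_rfl) (span_of_latD le_rfl)) (by simp)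
    E3 t3 t3_odd case3_normal h₁ h₂



/-- Embedding of `A₁₂²`. -/
noncomputable def psi3 : (Fin 13 → ℚ) × (Fin 13 → ℚ) →ₗ[ℚ] (Fin 12 → ℚ) × (Fin 12 → ℚ) where
  toFun p := (fun i => (∑ j : Fin 12, p.1 j.castSucc) / 4 - (∑ j : Fin 12, p.2 j.castSucc) / 4
      - p.1 i.castSucc,
    fun i => (∑ j : Fin 12, p.1 j.castSucc) / 4 + (∑ j : Fin 12, p.2 j.castSucc) / 4
      - p.2 i.castSucc)
  map_add' x y := by
    apply Prod.ext <;> funext i <;>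
    simp only [Prod.fst_add, Prod.snd_add, Pi.add_apply, Finset.sum_add_distrib] <;>
    ring
  map_smul' c x := by
    apply Prod.ext <;> funext i <;>
    simp only [Prod.smul_fst, Prod.smul_snd, Pi.smul_apply, smul_eq_mul, ← Finset.mul_sum,
      RingHom.id_apply] <;>
    ring

theorem psi3_fst (p : (Fin 13 → ℚ) × (Fin 13 → ℚ)) (i : Fin 12) :
    (psi3 p).1 i = (∑ j : Fin 12, p.1 j.castSucc) / 4 - (∑ j : Fin 12, p.2 j.castSucc) / 4
      - p.1 i.castSucc := rfl

theorem psi3_snd (p : (Fin 13 → ℚ) × (Fin 13 → ℚ)) (i : Fin 12) :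
    (psi3 p).2 i = (∑ j : Fin 12, p.1 j.castSucc) / 4 + (∑ j : Fin 12, p.2 j.castSucc) / 4
      - p.2 i.castSucc := rfl

theorem ev_last_castSucc {n : ℕ} (j : Fin n) :
    (ev (Fin.last n) : Fin (n + 1) → ℚ) j.castSucc = 0 :=
  Pi.single_eq_of_ne (Fin.castSucc_lt_last j).ne _

theorem psi3_ev1 (i : Fin 12) :
    psi3 (ev i.castSucc, 0) = (cst 12 (1 / 4) - ev i, cst 12 (1 / 4)) := by
  apply Prod.ext
  · funext k
    rw [psi3_fst]
    simp [Pi.single_apply]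
  · funext k
    rw [psi3_snd]
    simp [Pi.single_apply]

theorem psi3_ev2 (i : Fin 12) :
    psi3 (0, ev i.castSucc) = (cst 12 (-(1 / 4)), cst 12 (1 / 4) - ev i) := by
  apply Prod.ext
  · funext k
    rw [psi3_fst]
    simp [Pi.single_apply]
  · funext k
    rw [psi3_snd]
    simp [Pi.single_apply]

theorem psi3_last1 : psi3 (ev (Fin.last 12), 0) = 0 := by
  apply Prod.ext
  · funext k
    rw [psi3_fst]
    simp only [ev_last_castSucc]
    simp
  · funext k
    rw [psi3_snd]
    simp only [ev_last_castSucc]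
    simp

theorem psi3_last2 : psi3 (0, ev (Fin.last 12)) = 0 := by
  apply Prod.ext
  · funext k
    rw [psi3_fst]
    simp only [ev_last_castSucc]
    simp
  · funext k
    rw [psi3_snd]
    simp only [ev_last_castSucc]
    simp

theorem sum_mul_shift (x y : Fin 12 → ℚ) (a b : ℚ) : ∑ i, (a - x i) * (b - y i) =
    12 * (a * b) - a * ∑ i, y i - (∑ i, x i) * b + ∑ i, x i * y i := by
  have e1 : ∀ i : Fin 12, (a - x i) * (b - y i) = a * b - a * y i - x i * b + x i * y i :=
    fun i => by ring
  simp only [e1, Finset.sum_add_distrib, Finset.sum_sub_distrib, ← Finset.mul_sum,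
    ← Finset.sum_mul]
  simp
  ring

theorem psi3_isom (p q : (Fin 13 → ℚ) × (Fin 13 → ℚ)) (hp : p ∈ (latA 12).prod (latA 12))
    (hq : q ∈ (latA 12).prod (latA 12)) :
    C3 (psi3 p) (psi3 q) = prodB (dotB 13) (dotB 13) p q := by
  have hp1 := hp.1.2
  have hp2 := hp.2.2
  have hq1 := hq.1.2
  have hq2 := hq.2.2
  rw [Fin.sum_univ_castSucc (n := 12)] at hp1 hp2 hq1 hq2
  rw [prodB_apply, prodB_apply, dotB_apply, dotB_apply, dotB_apply, dotB_apply,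
    Fin.sum_univ_castSucc (n := 12), Fin.sum_univ_castSucc (n := 12)]
  simp only [psi3_fst, psi3_snd]
  rw [sum_mul_shift (fun i => p.1 i.castSucc) (fun i => q.1 i.castSucc),
    sum_mul_shift (fun i => p.2 i.castSucc) (fun i => q.2 i.castSucc)]
  rw [eq_neg_of_add_eq_zero_right hp1, eq_neg_of_add_eq_zero_right hp2,
    eq_neg_of_add_eq_zero_right hq1, eq_neg_of_add_eq_zero_right hq2]
  ring

theorem snoc_latA {n : ℕ} {u : Fin n → ℚ} (hu : ∀ i, IsZ (u i)) :
    (Fin.snoc (α := fun _ => ℚ) u (-∑ i, u i) : Fin (n + 1) → ℚ) ∈ latA n := by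
  refine ⟨fun i => ?_, ?_⟩
  · refine Fin.lastCases ?_ (fun j => ?_) i
    · rw [Fin.snoc_last]
      exact (IsZ.sum Finset.univ u fun i _ => hu i).neg
    · rw [Fin.snoc_castSucc]
      exact hu j
  · rw [Fin.sum_univ_castSucc]
    simp only [Fin.snoc_castSucc, Fin.snoc_last]
    ring

theorem psi3_hit {u v : Fin 12 → ℚ} (hu : ∀ i, IsZ (u i)) (hv : ∀ i, IsZ (v i))
    {y : (Fin 12 → ℚ) × (Fin 12 → ℚ)}
    (h1 : ∀ i, y.1 i = (∑ j, u j) / 4 - (∑ j, v j) / 4 - u i)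
    (h2 : ∀ i, y.2 i = (∑ j, u j) / 4 + (∑ j, v j) / 4 - v i) :
    ∃ p ∈ (latA 12).prod (latA 12), psi3 p = y := by
  refine ⟨(Fin.snoc (α := fun _ => ℚ) u (-∑ i, u i), Fin.snoc (α := fun _ => ℚ) v (-∑ i, v i)),
    ⟨snoc_latA hu, snoc_latA hv⟩, ?_⟩
  apply Prod.ext
  · funext i
    rw [psi3_fst, h1]
    simp only [Fin.snoc_castSucc]
  · funext i
    rw [psi3_snd, h2]
    simp only [Fin.snoc_castSucc]

theorem case3_arith {z1 z2 : Fin 12 → ℚ} (hz1 : ∀ i, IsZ (z1 i)) (hz2 : ∀ i, IsZ (z2 i))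
    (h : dotB 12 (cst 12 (1 / 4) + z1) (cst 12 (1 / 4) + z1) +
      dotB 12 (cst 12 (1 / 4) + z2) (cst 12 (1 / 4) + z2) = 2)
    (h2 : ∃ k : ℤ, ∑ i, z2 i = 2 * k) : ∑ i, z1 i = -1 ∧ ∑ i, z2 i = 0 := by
  rw [quarter_norm, quarter_norm] at h
  obtain ⟨a, b⟩ := abs_sum_le hz1
  obtain ⟨c, d⟩ := abs_sum_le hz2
  obtain ⟨S, hS⟩ := IsZ.sum Finset.univ z1 fun i _ => hz1 i
  obtain ⟨Q, hQ⟩ := IsZ.sum Finset.univ (fun i => z1 i * z1 i) fun i _ => (hz1 i).mul (hz1 i)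
  obtain ⟨R, hR⟩ := IsZ.sum Finset.univ (fun i => z2 i * z2 i) fun i _ => (hz2 i).mul (hz2 i)
  obtain ⟨k, hk⟩ := h2
  rw [hS, hQ, hk, hR] at h
  rw [hS, hQ] at a b
  rw [hk, hR] at c d
  have a' : S ≤ Q := by exact_mod_cast a
  have b' : -S ≤ Q := by exact_mod_cast b
  have c' : 2 * k ≤ R := by exact_mod_cast c
  have d' : -(2 * k) ≤ R := by exact_mod_cast d
  have e' : 3 + S + 2 * k + 2 * Q + 2 * R = 4 := by
    have : (3 + S + 2 * k + 2 * Q + 2 * R : ℚ) = 4 := by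
      push_cast at h
      linarith
    exact_mod_cast this
  have hk0 : k = 0 := by omega
  have hS1 : S = -1 := by omega
  rw [hS, hk, hk0, hS1]
  norm_num

theorem dot_neg_neg {n : ℕ} (x : Fin n → ℚ) : dotB n (-x) (-x) = dotB n x x := by
  simp

theorem case3_hitf {y : (Fin 12 → ℚ) × (Fin 12 → ℚ)} (h1 : ∀ i, IsZ (y.1 i - 1 / 4))
    (h2 : ∀ i, IsZ (y.2 i - 1 / 4)) (hs : ∃ k : ℤ, ∑ i, y.2 i = 3 + 2 * k) (hn : C3 y y = 2) :
    ∃ p ∈ (latA 12).prod (latA 12), psi3 p = y := by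
  have e1 : y.1 = cst 12 (1 / 4) + fun i => y.1 i - 1 / 4 := by
    funext i
    simp
  have e2 : y.2 = cst 12 (1 / 4) + fun i => y.2 i - 1 / 4 := by
    funext i
    simp
  rw [prodB_apply, e1, e2] at hn
  obtain ⟨k, hk⟩ := hs
  obtain ⟨s1, s2⟩ := case3_arith h1 h2 hn ⟨k, by
    rw [Finset.sum_sub_distrib, hk]
    simp
    norm_num⟩
  refine psi3_hit (u := fun i => -(y.1 i - 1 / 4)) (v := fun i => -(y.2 i - 1 / 4))
    (fun i => (h1 i).neg) (fun i => (h2 i).neg) (fun i => ?_) (fun i => ?_)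
  · rw [Finset.sum_neg_distrib, Finset.sum_neg_distrib, s1, s2]
    ring
  · rw [Finset.sum_neg_distrib, Finset.sum_neg_distrib, s1, s2]
    ring

theorem case3_hitg {y : (Fin 12 → ℚ) × (Fin 12 → ℚ)} (h1 : ∀ i, IsZ (y.1 i + 1 / 4))
    (h2 : ∀ i, IsZ (y.2 i - 1 / 4)) (hs : ∃ k : ℤ, ∑ i, y.1 i = -3 + 2 * k) (hn : C3 y y = 2) :
    ∃ p ∈ (latA 12).prod (latA 12), psi3 p = y := by
  have e1 : -y.1 = cst 12 (1 / 4) + fun i => -(y.1 i + 1 / 4) := by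
    funext i
    simp
  have e2 : y.2 = cst 12 (1 / 4) + fun i => y.2 i - 1 / 4 := by
    funext i
    simp
  rw [prodB_apply, ← dot_neg_neg y.1, e1, e2, add_comm] at hn
  obtain ⟨k, hk⟩ := hs
  obtain ⟨s2, s1⟩ := case3_arith h2 (fun i => (h1 i).neg) hn ⟨-k, by
    rw [Finset.sum_neg_distrib, Finset.sum_add_distrib, hk]
    simp
    norm_num⟩
  refine psi3_hit (u := fun i => -(y.1 i + 1 / 4)) (v := fun i => -(y.2 i - 1 / 4))
    (fun i => (h1 i).neg) (fun i => (h2 i).neg) (fun i => ?_) (fun i => ?_)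
  · rw [s1, Finset.sum_neg_distrib, s2]
    ring
  · rw [s1, Finset.sum_neg_distrib, s2]
    ring



/-- The even glue vector in case 3. -/
def t3' : (Fin 12 → ℚ) × (Fin 12 → ℚ) := (cst 12 (1 / 4) - ev 0, cst 12 (1 / 4))

theorem C3_t3 (x : (Fin 12 → ℚ) × (Fin 12 → ℚ)) :
    C3 x t3' = (∑ i, x.1 i) / 4 - x.1 0 + (∑ i, x.2 i) / 4 := by
  rw [prodB_apply, t3', dot_quarter_sub, dot_cst]
  ring

theorem t3'_norm : C3 t3' t3' = 2 := by
  rw [C3_t3]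
  simp only [t3', Pi.sub_apply, Finset.sum_sub_distrib, sum_ev, sum_cst]
  simp
  norm_num

theorem norm_f3 (i : Fin 12) : C3 (cst 12 (1 / 4) - ev i, cst 12 (1 / 4))
    (cst 12 (1 / 4) - ev i, cst 12 (1 / 4)) = 2 := by
  rw [prodB_apply, dot_quarter_sub, dot_cst]
  simp only [Pi.sub_apply, Finset.sum_sub_distrib, sum_ev, sum_cst]
  simp
  norm_num

theorem norm_g3 (i : Fin 12) : C3 (cst 12 (-(1 / 4)), cst 12 (1 / 4) - ev i)
    (cst 12 (-(1 / 4)), cst 12 (1 / 4) - ev i) = 2 := by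
  rw [prodB_apply, dot_quarter_sub, dot_cst]
  simp only [Pi.sub_apply, Finset.sum_sub_distrib, sum_ev, sum_cst]
  simp
  norm_num

theorem case3_two : (2 : ℤ) • t3 ∈ E3 := by
  have e : (2 : ℤ) • t3 = h3 + ((2 : ℤ) • ev 0, 0) := by
    apply Prod.ext
    · funext i
      simp [t3, h3]
      norm_num
    · funext i
      simp [t3, h3]
      norm_num
  rw [e]
  exact Submodule.add_mem _ h3_mem (M3_le ⟨two_mem_latD (ev_int 0), Submodule.zero_mem _⟩)

theorem case3_sub : t3' - t3 ∈ E3 := by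
  refine M3_le ⟨?_, ?_⟩
  · have e : (t3' - t3).1 = -(ev 0 + ev 0) := by
      simp only [t3, t3', Prod.fst_sub]
      abel
    rw [e]
    exact Submodule.neg_mem _ (ev_add_mem 0 0)
  · have e : (t3' - t3).2 = 0 := by simp [t3, t3']
    rw [e]
    exact Submodule.zero_mem _

theorem case3_two' : (2 : ℤ) • t3' ∈ E3 := by
  have := Submodule.add_mem _ (Submodule.smul_mem _ 2 case3_sub) case3_two
  rwa [← smul_add, sub_add_cancel] at this

theorem case3_hit {y : (Fin 12 → ℚ) × (Fin 12 → ℚ)} (hy : y ∈ nb C3 E3 t3') (hn : C3 y y = 2) :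
    ∃ p ∈ (latA 12).prod (latA 12), psi3 p = y := by
  have hneg : C3 (-y) (-y) = 2 := by simpa using hn
  rcases nb_cases case3_two' ⟨2, by rw [t3'_norm]; norm_num⟩ hy with ⟨h1, h3'⟩ | ⟨h1, h3'⟩
  · have hM := E3_root h1 hn
    rw [C3_t3] at h3'
    obtain ⟨⟨i1, k, hk⟩, ⟨i2, l, hl⟩⟩ := hM
    obtain ⟨a, b⟩ := abs_sum_le i1
    obtain ⟨c, d⟩ := abs_sum_le i2
    obtain ⟨m, hm⟩ := h3'.add (i1 0)
    obtain ⟨Q, hQ⟩ := IsZ.sum Finset.univ (fun i => y.1 i * y.1 i) fun i _ =>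
      IsZ.mul (i1 i) (i1 i)
    obtain ⟨R, hR⟩ := IsZ.sum Finset.univ (fun i => y.2 i * y.2 i) fun i _ =>
      IsZ.mul (i2 i) (i2 i)
    rw [prodB_apply, dotB_apply, dotB_apply, hQ, hR] at hn
    rw [hk, hQ] at a b
    rw [hl, hR] at c d
    rw [hk, hl] at hm
    have a' : 2 * k ≤ Q := by exact_mod_cast a
    have b' : -(2 * k) ≤ Q := by exact_mod_cast b
    have c' : 2 * l ≤ R := by exact_mod_cast c
    have d' : -(2 * l) ≤ R := by exact_mod_cast d
    have e' : Q + R = 2 := by exact_mod_cast hn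
    have f' : k + l = 2 * m := by
      have : (k + l : ℚ) = 2 * m := by linarith
      exact_mod_cast this
    have hk0 : k = 0 := by omega
    have hl0 : l = 0 := by omega
    have s1 : ∑ i, y.1 i = 0 := by rw [hk, hk0]; simp
    have s2 : ∑ i, y.2 i = 0 := by rw [hl, hl0]; simp
    refine psi3_hit (u := fun i => -y.1 i) (v := fun i => -y.2 i)
      (fun i => IsZ.neg (i1 i)) (fun i => IsZ.neg (i2 i)) (fun i => ?_) (fun i => ?_)
    · rw [Finset.sum_neg_distrib, Finset.sum_neg_distrib, s1, s2]
      ring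
    · rw [Finset.sum_neg_distrib, Finset.sum_neg_distrib, s1, s2]
      ring
  · rcases E3_cases (fun y hy => uni_int E3_uni h1 hy) with h | ⟨-, h | h⟩ | ⟨-, h⟩
    · obtain ⟨⟨i1, k, hk⟩, ⟨i2, l, hl⟩⟩ := h
      simp only [Prod.fst_sub, Prod.snd_sub, t3', Pi.sub_apply, Finset.sum_sub_distrib,
        sum_ev, sum_cst] at hk hl
      refine case3_hitf (fun i => ?_) (fun i => ?_) ⟨l, by push_cast at hl; linarith⟩ hn
      · have := IsZ.sub (i1 i) (ev_int 0 i)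
        convert this using 1
        simp only [Prod.fst_sub, t3', Pi.sub_apply]
        ring
      · exact i2 i
    · obtain ⟨⟨i1, k, hk⟩, ⟨i2, l, hl⟩⟩ := h
      simp only [Prod.fst_sub, Prod.snd_sub, t3', h3, Pi.sub_apply, Finset.sum_sub_distrib,
        sum_ev, sum_cst] at hk hl
      suffices key : ∃ p ∈ (latA 12).prod (latA 12), psi3 p = -y by
        obtain ⟨p, hp, hpy⟩ := key
        exact ⟨-p, Submodule.neg_mem _ hp, by rw [map_neg, hpy, neg_neg]⟩
      refine case3_hitf (y := -y) (fun i => ?_) (fun i => ?_) ⟨-l - 6, ?_⟩ hneg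
      · have := IsZ.sub (IsZ.sub (ev_int 0 i) (i1 i)) isZ_one
        convert this using 1
        simp only [Prod.fst_sub, Prod.fst_neg, t3', h3, Pi.sub_apply, Pi.neg_apply]
        ring
      · have := IsZ.sub (IsZ.neg (i2 i)) isZ_one
        convert this using 1
        simp only [Prod.snd_sub, Prod.snd_neg, t3', h3, Pi.sub_apply, Pi.neg_apply]
        ring
      · simp only [Prod.snd_neg, Pi.neg_apply, Finset.sum_neg_distrib]
        push_cast at hl ⊢
        linarith
    · obtain ⟨⟨i1, k, hk⟩, ⟨i2, l, hl⟩⟩ := h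
      simp only [Prod.fst_sub, Prod.snd_sub, t3', h3, g3, Pi.sub_apply, Pi.add_apply,
        Finset.sum_sub_distrib, Finset.sum_add_distrib, sum_ev, sum_cst] at hk hl
      refine case3_hitg (fun i => ?_) (fun i => ?_) ⟨k + 6, ?_⟩ hn
      · have := IsZ.add (i1 i) isZ_one
        convert this using 1
        simp only [Prod.fst_sub, t3', h3, g3, Pi.sub_apply]
        ring
      · have := IsZ.add (IsZ.add (i2 i) isZ_one) (ev_int 0 i)
        convert this using 1
        simp only [Prod.snd_sub, t3', h3, g3, Pi.sub_apply, Pi.add_apply]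
        ring
      · push_cast at hk ⊢
        linarith
    · obtain ⟨⟨i1, k, hk⟩, ⟨i2, l, hl⟩⟩ := h
      simp only [Prod.fst_sub, Prod.snd_sub, t3', g3, Pi.sub_apply, Pi.add_apply,
        Finset.sum_sub_distrib, Finset.sum_add_distrib, sum_ev, sum_cst] at hk hl
      suffices key : ∃ p ∈ (latA 12).prod (latA 12), psi3 p = -y by
        obtain ⟨p, hp, hpy⟩ := key
        exact ⟨-p, Submodule.neg_mem _ hp, by rw [map_neg, hpy, neg_neg]⟩
      refine case3_hitg (y := -y) (fun i => ?_) (fun i => ?_) ⟨-k, ?_⟩ hneg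
      · have := IsZ.neg (i1 i)
        convert this using 1
        simp only [Prod.fst_sub, Prod.fst_neg, t3', g3, Pi.sub_apply, Pi.neg_apply]
        ring
      · have := IsZ.sub (IsZ.sub (IsZ.neg (i2 i)) isZ_one) (ev_int 0 i)
        convert this using 1
        simp only [Prod.snd_sub, Prod.snd_neg, t3', g3, Pi.sub_apply, Pi.add_apply, Pi.neg_apply]
        ring
      · simp only [Prod.fst_neg, Pi.neg_apply, Finset.sum_neg_distrib]
        push_cast at hk ⊢
        linarith

theorem case3_f (i : Fin 12) : (cst 12 (1 / 4) - ev i, cst 12 (1 / 4)) ∈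
    rootSublattice C3 (nb C3 E3 t3') := by
  refine Submodule.subset_span ⟨?_, norm_f3 i⟩
  have hw : ((ev 0 - ev i, 0) : (Fin 12 → ℚ) × (Fin 12 → ℚ)) ∈ nb C3 E3 t3' := by
    refine mem_nb_of (M3_le ⟨ev_sub_mem 0 i, Submodule.zero_mem _⟩) ?_
    rw [C3_t3]
    simp only [Pi.sub_apply, Finset.sum_sub_distrib, sum_ev, Pi.zero_apply, Finset.sum_const_zero]
    have := ((ev_int 0 (0 : Fin 12)).sub (ev_int i 0)).neg
    convert this using 1
    ring
  have := Submodule.add_mem _ (self_mem_nb (B := C3) (E := E3) (t := t3')) hw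
  convert this using 1
  simp [t3']

theorem case3_g (j : Fin 12) : (cst 12 (-(1 / 4)), cst 12 (1 / 4) - ev j) ∈
    rootSublattice C3 (nb C3 E3 t3') := by
  refine Submodule.subset_span ⟨?_, norm_g3 j⟩
  have hw : ((cst 12 (-(1 / 2)) + ev 0, -ev j) : (Fin 12 → ℚ) × (Fin 12 → ℚ)) ∈ nb C3 E3 t3' := by
    refine mem_nb_of ?_ ⟨-2, ?_⟩
    · have e : ((cst 12 (-(1 / 2)) + ev 0, -ev j) : (Fin 12 → ℚ) × (Fin 12 → ℚ)) =
          g3 - h3 - (0, ev 0 + ev j) := by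
        apply Prod.ext
        · funext i
          simp [g3, h3]
          ring
        · funext i
          simp [g3, h3]
      rw [e]
      exact Submodule.sub_mem _ (Submodule.sub_mem _ g3_mem h3_mem)
        (M3_le ⟨Submodule.zero_mem _, ev_add_mem _ _⟩)
    · rw [C3_t3]
      simp only [Pi.add_apply, Pi.neg_apply, Finset.sum_add_distrib, Finset.sum_neg_distrib,
        sum_ev, sum_cst]
      simp
      norm_num
  have := Submodule.add_mem _ (self_mem_nb (B := C3) (E := E3) (t := t3')) hw
  convert this using 1
  apply Prod.ext
  · funext i
    simp [t3']
    ring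
  · funext i
    simp [t3']
    ring

theorem case3_exist : NeighborsRootPair C3 (nb C3 E3 t3)
    (prodForm (stdDot 12) (stdDot 12)) ((latD 12).prod (latD 12))
    (prodForm (stdDot 13) (stdDot 13)) ((latA 12).prod (latA 12)) := by
  refine exist_of (t' := t3') (by simp) C3_pos E3_uni E3_even
    (span_mono_top M3_le (span_prod (span_of_latD le_rfl) (span_of_latD le_rfl)))
    case3_two case3_sub t3_odd
    ⟨1, by rw [t3'_norm]; norm_num⟩ (iso_of_eq ?_)
    (iso_of_psi (C₂ := prodB (dotB 13) (dotB 13)) (prodB_pos (dotB_pos 13) (dotB_pos 13)) psi3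
      (fun x hx y hy => psi3_isom x y hx hy) ?_ (fun y hy hn => case3_hit hy hn))
  · exact root_eq M3_le (gen_prod (latD_gen 12 (by norm_num)) (latD_gen 12 (by norm_num)))
      fun x hx h2 => E3_root hx h2
  · intro p hp
    have a1 := latA_gen 12 (S := (rootSublattice C3 (nb C3 E3 t3')).comap
      ((psi3.comp (LinearMap.inl ℚ _ _)).restrictScalars ℤ)) ?_ hp.1
    · have a2 := latA_gen 12 (S := (rootSublattice C3 (nb C3 E3 t3')).comap
        ((psi3.comp (LinearMap.inr ℚ _ _)).restrictScalars ℤ)) ?_ hp.2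
      · have := Submodule.add_mem (rootSublattice C3 (nb C3 E3 t3')) a1 a2
        change psi3 (p.1, 0) + psi3 (0, p.2) ∈ _ at this
        rwa [← map_add, Prod.mk_add_mk, add_zero, zero_add] at this
      · intro i j _
        have key : ∀ i : Fin 13, psi3 (0, ev i) ∈ rootSublattice C3 (nb C3 E3 t3') := by
          intro i
          refine Fin.lastCases ?_ (fun j => ?_) i
          · rw [psi3_last2]
            exact Submodule.zero_mem _
          · rw [psi3_ev2]
            exact case3_g j
        have := Submodule.sub_mem _ (key i) (key j)
        rw [← map_sub, Prod.mk_sub_mk, sub_zero] at this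
        exact this
    · intro i j _
      have key : ∀ i : Fin 13, psi3 (ev i, 0) ∈ rootSublattice C3 (nb C3 E3 t3') := by
        intro i
        refine Fin.lastCases ?_ (fun j => ?_) i
        · rw [psi3_last1]
          exact Submodule.zero_mem _
        · rw [psi3_ev1]
          exact case3_f j
      have := Submodule.sub_mem _ (key i) (key j)
      rw [← map_sub, Prod.mk_sub_mk, sub_zero] at this
      exact this



theorem E8_half_norm : dotB 8 (cst 8 (1 / 2)) (cst 8 (1 / 2)) = 2 := by
  rw [dot_cst, sum_cst]
  norm_num

theorem E8_gen : latE8 ≤ Submodule.span ℤ {x | x ∈ latE8 ∧ dotB 8 x x = 2} := by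
  refine sup_le ((latD_gen 8 (by norm_num)).trans (Submodule.span_mono ?_)) ?_
  · rintro x ⟨hx, h2⟩
    exact ⟨latD_le_latDp 8 hx, h2⟩
  · rw [Submodule.span_singleton_le_iff_mem]
    exact Submodule.subset_span ⟨half_mem_latDp 8, E8_half_norm⟩

theorem E8_uni : IsUnimodular (dotB 8) latE8 := latDp_uni (m := 2) rfl

theorem E8_even : IsEvenLat (dotB 8) latE8 := latDp_even (m := 1) rfl

theorem mem_E8 {x : Fin 8 → ℚ} : x ∈ latE8 ↔ x ∈ latD 8 ∨ x - cst 8 (1 / 2) ∈ latD 8 :=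
  mem_latDp (m := 4) rfl

/-- Reflection in a vector of norm 2. -/
noncomputable def rfl2 {n : ℕ} (r : Fin n → ℚ) (hr : dotB n r r = 2) :
    (Fin n → ℚ) ≃ₗ[ℚ] (Fin n → ℚ) :=
  LinearEquiv.ofInvolutive
    { toFun := fun x => x - dotB n x r • r
      map_add' := fun x y => by
        rw [map_add, LinearMap.add_apply, add_smul]
        abel
      map_smul' := fun c x => by
        simp only [map_smul, LinearMap.smul_apply, RingHom.id_apply, smul_sub, smul_smul,
          smul_eq_mul] }
    (fun x => by
      change (x - dotB n x r • r) - dotB n (x - dotB n x r • r) r • r = x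
      rw [map_sub, LinearMap.sub_apply, map_smul, LinearMap.smul_apply, hr, smul_eq_mul]
      module)

theorem rfl2_apply {n : ℕ} (r : Fin n → ℚ) (hr : dotB n r r = 2) (x : Fin n → ℚ) :
    rfl2 r hr x = x - dotB n x r • r := rfl

theorem rfl2_invol {n : ℕ} (r : Fin n → ℚ) (hr : dotB n r r = 2) (x : Fin n → ℚ) :
    rfl2 r hr (rfl2 r hr x) = x := (rfl2 r hr).symm_apply_apply x

theorem rfl2_isom {n : ℕ} (r : Fin n → ℚ) (hr : dotB n r r = 2) :
    Isom (dotB n) (dotB n) (rfl2 r hr) := by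
  intro x y
  rw [rfl2_apply, rfl2_apply]
  simp only [map_sub, LinearMap.sub_apply, map_smul, LinearMap.smul_apply, smul_eq_mul, hr]
  rw [(dotB_pos n).1 r y]
  ring

theorem rfl2_mem {r : Fin 8 → ℚ} (hr : dotB 8 r r = 2) (hE : r ∈ latE8) {x : Fin 8 → ℚ}
    (hx : x ∈ latE8) : rfl2 r hr x ∈ latE8 := by
  obtain ⟨k, hk⟩ := uni_int E8_uni hx hE
  rw [rfl2_apply, hk]
  refine Submodule.sub_mem _ hx ?_
  have := Submodule.smul_mem latE8 k hE
  rwa [← Int.cast_smul_eq_zsmul ℚ] at this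

theorem rfl2_mem_iff {r : Fin 8 → ℚ} (hr : dotB 8 r r = 2) (hE : r ∈ latE8) (x : Fin 8 → ℚ) :
    x ∈ latE8 ↔ rfl2 r hr x ∈ latE8 := by
  refine ⟨rfl2_mem hr hE, fun h => ?_⟩
  have := rfl2_mem hr hE h
  rwa [rfl2_invol] at this

/-- `t` can be moved by an automorphism of `E₈` to one of the three standard classes. -/
def Red (t : Fin 8 → ℚ) : Prop :=
  ∃ σ : (Fin 8 → ℚ) ≃ₗ[ℚ] (Fin 8 → ℚ), Isom (dotB 8) (dotB 8) σ ∧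
    (∀ x, x ∈ latE8 ↔ σ x ∈ latE8) ∧
    (σ t ∈ latE8 ∨ σ t - cst 8 (1 / 4) ∈ latE8 ∨ σ t - ev 0 ∈ latE8)

theorem Red.base {t : Fin 8 → ℚ}
    (h : t ∈ latE8 ∨ t - cst 8 (1 / 4) ∈ latE8 ∨ t - ev 0 ∈ latE8) : Red t :=
  ⟨LinearEquiv.refl ℚ _, fun _ _ => rfl, fun _ => Iff.rfl, h⟩

theorem Red.of {t : Fin 8 → ℚ} {τ : (Fin 8 → ℚ) ≃ₗ[ℚ] (Fin 8 → ℚ)}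
    (hi : Isom (dotB 8) (dotB 8) τ) (hm : ∀ x, x ∈ latE8 ↔ τ x ∈ latE8) (h : Red (τ t)) :
    Red t := by
  obtain ⟨σ, h1, h2, h3⟩ := h
  refine ⟨τ.trans σ, fun x y => ?_, fun x => ?_, h3⟩
  · rw [LinearEquiv.trans_apply, LinearEquiv.trans_apply, h1, hi]
  · rw [hm, h2, LinearEquiv.trans_apply]

theorem flip_E8 {s : Fin 8 → ℚ} (hs : ∀ i, s i = 1 ∨ s i = -1)
    (h : flip s hs (cst 8 (1 / 2)) ∈ latE8) (x : Fin 8 → ℚ) :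
    x ∈ latE8 ↔ flip s hs x ∈ latE8 := by
  have key : ∀ x ∈ latE8, flip s hs x ∈ latE8 := by
    intro x hx
    rcases mem_E8.1 hx with h1 | h1
    · exact latD_le_latDp 8 (flip_mem s hs h1)
    · have := Submodule.add_mem _ (latD_le_latDp 8 (flip_mem s hs h1)) h
      rwa [← map_add, sub_add_cancel] at this
  refine ⟨key x, fun hx => ?_⟩
  have := key _ hx
  rwa [show flip s hs (flip s hs x) = x from (flip s hs).symm_apply_apply x] at this

theorem E8red_half {t : Fin 8 → ℚ} (h2 : (2 : ℤ) • t ∈ latE8)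
    (hh : ∀ i, ∃ m : ℤ, 2 * t i = m + 1 / 2) : Red t := by
  obtain ⟨s, hs, hst⟩ := flip_quarter hh
  obtain ⟨z, hz, htz⟩ := quarter_of (t := flip s hs t) hst
  have hinv : ∀ x, flip s hs (flip s hs x) = x := fun x => (flip s hs).symm_apply_apply x
  have hf : flip s hs (cst 8 (1 / 2)) ∈ latE8 := by
    have h3 := Submodule.sub_mem _ h2 (latD_le_latDp 8 (flip_mem s hs (two_mem_latD hz)))
    convert h3 using 1
    have : (2 : ℤ) • t = flip s hs ((2 : ℤ) • (cst 8 (1 / 4) + z)) := by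
      rw [← htz, map_zsmul, hinv]
    rw [this, ← map_sub]
    congr 1
    funext i
    simp
    norm_num
  refine Red.of (flip_isom s hs) (flip_E8 hs hf) ?_
  rw [htz]
  obtain ⟨S, hS⟩ := IsZ.sum Finset.univ z fun i _ => hz i
  rcases Int.even_or_odd' S with ⟨k, rfl | rfl⟩
  · refine Red.base (Or.inr (Or.inl ?_))
    rw [add_sub_cancel_left]
    exact latD_le_latDp 8 ⟨hz, k, by rw [hS]; push_cast; ring⟩
  · refine Red.of (rfl2_isom (cst 8 (1 / 2)) E8_half_norm)
      (rfl2_mem_iff E8_half_norm (half_mem_latDp 8)) (Red.base (Or.inr (Or.inr ?_)))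
    have hzo : z + ev 0 ∈ latE8 := by
      apply latD_le_latDp 8
      have := odd_mem (i := 0).2 ⟨hz, k, by rw [hS]; push_cast; ring⟩
      have h3 := Submodule.add_mem _ this (ev_add_mem 0 0)
      convert h3 using 1
      abel
    have h4 := rfl2_mem E8_half_norm (half_mem_latDp 8) hzo
    have e : cst 8 (1 / 4) + z = (cst 8 (1 / 4) - ev 0) + (z + ev 0) := by abel
    have e2 : rfl2 (cst 8 (1 / 2)) E8_half_norm (cst 8 (1 / 4) - ev 0) = -ev 0 := by
      rw [rfl2_apply, dot_cst]
      funext i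
      simp only [Pi.sub_apply, Finset.sum_sub_distrib, sum_ev, sum_cst, Pi.smul_apply,
        Pi.neg_apply, smul_eq_mul]
      push_cast
      ring
    rw [e, map_add, e2]
    have h5 := Submodule.sub_mem _ h4 (latD_le_latDp 8 (ev_add_mem (0 : Fin 8) 0))
    convert h5 using 1
    abel

theorem E8red_int {t : Fin 8 → ℚ} (hi : ∀ i, IsZ (2 * t i))
    (h1 : IsZ (dotB 8 t (cst 8 (1 / 2)))) (h2 : ∀ i j, i ≠ j → IsZ (t i + t j)) :
    t ∈ latE8 := by
  have h3 : ∀ i j, IsZ (t i + t j) := by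
    intro i j
    by_cases h : i = j
    · subst h
      have := hi i
      rwa [two_mul] at this
    · exact h2 i j h
  obtain ⟨k, hk⟩ := h1
  rw [dot_cst] at hk
  by_cases h : IsZ (t 0)
  · refine mem_E8.2 (Or.inl ⟨fun i => ?_, k, by linarith⟩)
    have := (h3 i 0).sub h
    rwa [add_sub_cancel_right] at this
  · obtain ⟨m, hm⟩ := IsZ.half (hi 0) h
    refine mem_E8.2 (Or.inr ⟨fun i => ?_, k - 2, ?_⟩)
    · obtain ⟨l, hl⟩ := h3 i 0
      refine ⟨l - m - 1, ?_⟩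
      simp only [Pi.sub_apply]
      push_cast
      linarith
    · simp only [Pi.sub_apply, Finset.sum_sub_distrib, sum_cst]
      push_cast
      linarith

theorem half_root {i j : Fin 8} (h : i ≠ j) :
    dotB 8 (cst 8 (1 / 2) - (ev i + ev j)) (cst 8 (1 / 2) - (ev i + ev j)) = 2 := by
  rw [map_sub, dot_cst, map_add, dot_ev, dot_ev]
  simp only [Pi.sub_apply, Pi.add_apply, Finset.sum_sub_distrib, Finset.sum_add_distrib, sum_ev,
    sum_cst]
  simp [h, h.symm]
  norm_num

theorem E8red {t : Fin 8 → ℚ} (h2 : (2 : ℤ) • t ∈ latE8) : Red t := by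
  rcases mem_E8.1 h2 with h | h
  · have hi : ∀ i, IsZ (2 * t i) := fun i => by
      have h0 : IsZ (((2 : ℤ) • t) i) := h.1 i
      simpa using h0
    by_cases hE : t ∈ latE8
    · exact Red.base (Or.inl hE)
    have hr : ∃ r ∈ latE8, dotB 8 r r = 2 ∧ (∀ i, ∃ m : ℤ, r i = m + 1 / 2) ∧
        ¬ IsZ (dotB 8 t r) := by
      by_contra hno
      push Not at hno
      apply hE
      have a1 := hno _ (half_mem_latDp 8) E8_half_norm (fun i => ⟨0, by simp⟩)
      refine E8red_int hi a1 fun i j hij => ?_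
      have a2 := hno _ (Submodule.sub_mem _ (half_mem_latDp 8)
        (latD_le_latDp 8 (ev_add_mem i j))) (half_root hij) (fun k => by
          obtain ⟨a, ha⟩ := ev_int i k
          obtain ⟨b, hb⟩ := ev_int j k
          refine ⟨-a - b, ?_⟩
          simp only [Pi.sub_apply, Pi.add_apply, ha, hb]
          push_cast
          ring)
      have := a1.sub a2
      rwa [map_sub, sub_sub_cancel, map_add, dot_ev, dot_ev] at this
    obtain ⟨r, hrE, hr2, hrh, hrt⟩ := hr
    refine Red.of (rfl2_isom r hr2) (rfl2_mem_iff hr2 hrE) (E8red_half ?_ ?_)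
    · have := rfl2_mem hr2 hrE h2
      rwa [map_zsmul] at this
    · obtain ⟨m, hm⟩ := IsZ.half (by
        have := uni_int E8_uni h2 hrE
        rwa [B_two] at this) hrt
      intro i
      obtain ⟨a, ha⟩ := hi i
      obtain ⟨b, hb⟩ := hrh i
      refine ⟨a - m - 2 * m * b - b - 1, ?_⟩
      rw [rfl2_apply, hm]
      simp only [Pi.sub_apply, Pi.smul_apply, smul_eq_mul]
      rw [hb, mul_sub, ha]
      push_cast
      ring
  · refine E8red_half h2 fun i => ?_
    simpa using half_of_sub h.1 i



/-- Half of an integral vector. -/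
def hv (a : Fin 8 → ℤ) : Fin 8 → ℚ := fun i => (a i : ℚ) / 2

theorem hv_mem {a : Fin 8 → ℤ} (h : (∀ i, a i % 2 = 0) ∨ (∀ i, a i % 2 = 1))
    (hs : (∑ i, a i) % 4 = 0) : hv a ∈ latE8 := by
  have hs' : ∑ i, a i = 4 * ((∑ i, a i) / 4) := by omega
  have hs2 : ∑ i, (a i : ℚ) = 4 * (((∑ i, a i) / 4 : ℤ) : ℚ) := by exact_mod_cast hs'
  rcases h with h | h
  · refine mem_E8.2 (Or.inl ⟨fun i => ⟨a i / 2, ?_⟩, (∑ i, a i) / 4, ?_⟩)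
    · have : a i = 2 * (a i / 2) := by have := h i; omega
      have h2 : (a i : ℚ) = 2 * ((a i / 2 : ℤ) : ℚ) := by exact_mod_cast this
      simp only [hv]
      linarith
    · simp only [hv]
      rw [← Finset.sum_div, hs2]
      ring
  · refine mem_E8.2 (Or.inr ⟨fun i => ⟨a i / 2, ?_⟩, (∑ i, a i) / 4 - 2, ?_⟩)
    · have : a i = 2 * (a i / 2) + 1 := by have := h i; omega
      have h2 : (a i : ℚ) = 2 * ((a i / 2 : ℤ) : ℚ) + 1 := by exact_mod_cast this
      simp only [hv, Pi.sub_apply]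
      linarith
    · simp only [hv, Pi.sub_apply, Finset.sum_sub_distrib, sum_cst]
      rw [← Finset.sum_div, hs2]
      push_cast
      ring

theorem hv_dot (a b : Fin 8 → ℤ) : dotB 8 (hv a) (hv b) = ((∑ i, a i * b i : ℤ) : ℚ) / 4 := by
  rw [dotB_apply]
  push_cast
  rw [Finset.sum_div]
  refine Finset.sum_congr rfl fun i _ => ?_
  simp only [hv]
  ring

/-- Seven mutually orthogonal roots of `E₇ ⊂ E₈` (doubled), and three half sums. -/
def R8 : Fin 10 → Fin 8 → ℤ :=
  ![![2, -2, 0, 0, 0, 0, 0, 0],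
    ![0, 0, 2, -2, 0, 0, 0, 0],
    ![0, 0, 0, 0, 2, -2, 0, 0],
    ![0, 0, 0, 0, 0, 0, 2, -2],
    ![1, 1, 1, 1, -1, -1, -1, -1],
    ![1, 1, -1, -1, 1, 1, -1, -1],
    ![1, 1, -1, -1, -1, -1, 1, 1],
    ![1, -1, 1, -1, 1, -1, 1, -1],
    ![2, 0, 0, 0, 0, 0, 0, -2],
    ![2, 0, 0, 0, 0, -2, 0, 0]]

theorem R8_sum (k : Fin 10) : ∑ i, R8 k i = 0 := by
  revert k
  decide

theorem R8_mem (k : Fin 10) : hv (R8 k) ∈ latE8 := by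
  refine hv_mem ?_ (by rw [R8_sum]; rfl)
  revert k
  decide

theorem R8_norm (k : Fin 10) : dotB 8 (hv (R8 k)) (hv (R8 k)) = 2 := by
  have : ∑ i, R8 k i * R8 k i = 8 := by
    revert k
    decide
  rw [hv_dot, this]
  norm_num

theorem R8_gram (k l : Fin 7) :
    dotB 8 (hv (R8 (Fin.castLE (by norm_num) k))) (hv (R8 (Fin.castLE (by norm_num) l))) =
      if k = l then 2 else 0 := by
  have : ∑ i, R8 (Fin.castLE (by norm_num) k) i * R8 (Fin.castLE (by norm_num) l) i =
      if k = l then 8 else 0 := by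
    revert k l
    decide
  rw [hv_dot, this]
  split_ifs <;> norm_num

theorem R8_half {a b c d e : Fin 10} (h : ∀ i, R8 a i + R8 b i + R8 c i + R8 d i = 2 * R8 e i) :
    (1 / 2 : ℚ) • (hv (R8 a) + hv (R8 b) + hv (R8 c) + hv (R8 d)) = hv (R8 e) := by
  funext i
  have h2 : (R8 a i : ℚ) + R8 b i + R8 c i + R8 d i = 2 * R8 e i := by exact_mod_cast h i
  simp only [Pi.smul_apply, Pi.add_apply, hv, smul_eq_mul]
  linarith

theorem E8_obs {κ : Type*} [Fintype κ] {C : W →ₗ[ℚ] W →ₗ[ℚ] ℚ} {E : Submodule ℤ W} {t : W}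
    (p : W →ₗ[ℚ] (κ → ℚ)) (hp1 : ∀ x ∈ E, C x x = 2 → IsZ (C x t) → ∀ i, IsZ (p x i))
    (hp2 : ∀ x ∈ Submodule.span ℚ {x | x ∈ E ∧ C x x = 2 ∧ IsZ (C x t)},
      ∀ y ∈ Submodule.span ℚ {x | x ∈ E ∧ C x x = 2 ∧ IsZ (C x t)},
        ∑ i, p x i * p y i = C x y)
    (ι : (Fin 8 → ℚ) →ₗ[ℚ] W) (hι : ∀ x y, C (ι x) (ι y) = dotB 8 x y)
    (hιE : ∀ x ∈ latE8, ι x ∈ E) {u : Fin 8 → ℚ} (hu : ∀ x, C (ι x) t = dotB 8 x u)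
    (h : u ∈ latE8 ∨ u - cst 8 (1 / 4) ∈ latE8) : False := by
  have hZ : ∀ k, IsZ (C (ι (hv (R8 k))) t) := by
    intro k
    rw [hu]
    rcases h with h | h
    · exact uni_int E8_uni (R8_mem k) h
    · have := uni_int E8_uni (R8_mem k) h
      rw [map_sub, dot_cst] at this
      have e : ∑ i, hv (R8 k) i = 0 := by
        have := R8_sum k
        have h2 : ∑ i, (R8 k i : ℚ) = 0 := by exact_mod_cast this
        simp only [hv]
        rw [← Finset.sum_div, h2]
        simp
      rwa [e, zero_mul, sub_zero] at this
  have hE : ∀ k, ι (hv (R8 k)) ∈ E := fun k => hιE _ (R8_mem k)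
  have hn : ∀ k, C (ι (hv (R8 k))) (ι (hv (R8 k))) = 2 := fun k => by rw [hι, R8_norm]
  have hInteg : ∀ k i, IsZ (p (ι (hv (R8 k))) i) := fun k => hp1 _ (hE k) (hn k) (hZ k)
  have hhalf : ∀ {a b c d e : Fin 10}, (∀ i, R8 a i + R8 b i + R8 c i + R8 d i = 2 * R8 e i) →
      ∀ i, IsZ ((1 / 2) * (p (ι (hv (R8 a))) i + p (ι (hv (R8 b))) i + p (ι (hv (R8 c))) i +
        p (ι (hv (R8 d))) i)) := by
    intro a b c d e h i
    have := hInteg e i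
    rw [← R8_half h] at this
    simp only [map_smul, map_add, Pi.smul_apply, Pi.add_apply, smul_eq_mul] at this
    exact this
  refine obsH (fun k : Fin 7 => p (ι (hv (R8 (Fin.castLE (by norm_num) k)))))
    (fun k i => hInteg _ i) (fun k l => ?_) ?_ ?_ ?_
  · rw [hp2 _ (Submodule.subset_span ⟨hE _, hn _, hZ _⟩) _
      (Submodule.subset_span ⟨hE _, hn _, hZ _⟩), hι, R8_gram]
  · exact hhalf (a := 0) (b := 1) (c := 2) (d := 3) (e := 7) (by decide)
  · exact hhalf (a := 4) (b := 5) (c := 0) (d := 3) (e := 8) (by decide)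
  · exact hhalf (a := 4) (b := 6) (c := 0) (d := 2) (e := 9) (by decide)



theorem prod_uni {B : V →ₗ[ℚ] V →ₗ[ℚ] ℚ} {C : W →ₗ[ℚ] W →ₗ[ℚ] ℚ} {L : Submodule ℤ V}
    {M : Submodule ℤ W} (hL : IsUnimodular B L) (hM : IsUnimodular C M) :
    IsUnimodular (prodB B C) (L.prod M) := by
  refine le_antisymm ?_ ?_
  · intro x hx y hy
    rw [prodB_apply]
    exact IsZ.add (uni_int hL hx.1 hy.1) (uni_int hM hx.2 hy.2)
  · intro x hx
    constructor
    · rw [hL]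
      intro y hy
      have := hx (y, 0) ⟨hy, M.zero_mem⟩
      simpa [prodB_apply] using this
    · rw [hM]
      intro y hy
      have := hx (0, y) ⟨L.zero_mem, hy⟩
      simpa [prodB_apply] using this

theorem prod_even {B : V →ₗ[ℚ] V →ₗ[ℚ] ℚ} {C : W →ₗ[ℚ] W →ₗ[ℚ] ℚ} {L : Submodule ℤ V}
    {M : Submodule ℤ W} (hL : IsEvenLat B L) (hM : IsEvenLat C M) :
    IsEvenLat (prodB B C) (L.prod M) := by
  intro x hx
  obtain ⟨a, ha⟩ := hL _ hx.1
  obtain ⟨b, hb⟩ := hM _ hx.2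
  refine ⟨a + b, ?_⟩
  rw [prodB_apply, ha, hb]
  push_cast
  ring

theorem D8_le : latD 8 ≤ latE8 := fun _ hx => mem_E8.2 (Or.inl hx)

theorem half_E8 : cst 8 (1 / 2) ∈ latE8 := mem_E8.2 (Or.inr (by rw [sub_self]; exact Submodule.zero_mem _))

theorem E8_span : Submodule.span ℚ (latE8 : Set (Fin 8 → ℚ)) = ⊤ := span_of_latD D8_le

theorem two_ev_E8 : (2 : ℤ) • ev (0 : Fin 8) ∈ latE8 := D8_le (two_mem_latD (ev_int 0))

theorem E8_int_or {x : Fin 8 → ℚ} (h : x ∈ latE8) :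
    x ∈ latD 8 ∨ (2 ≤ dotB 8 x x ∧ ∀ w, w - ev 0 ∈ latE8 → ¬ IsZ (dotB 8 x w)) := by
  rcases mem_E8.1 h with h1 | h1
  · exact Or.inl h1
  · right
    have hh := half_of_sub h1.1
    refine ⟨?_, fun w hw hZ => ?_⟩
    · have := half_norm_ge hh
      norm_num at this
      exact this
    · have := hZ.sub (uni_int E8_uni h hw)
      rw [← map_sub, sub_sub_cancel, dot_ev] at this
      obtain ⟨m, hm⟩ := hh 0
      obtain ⟨k, hk⟩ := this
      rw [hm] at hk
      have : 2 * m + 1 = 2 * k := by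
        have : (2 * m + 1 : ℚ) = 2 * k := by linarith
        exact_mod_cast this
      omega

theorem D8_ev {x w : Fin 8 → ℚ} (h : x ∈ latD 8) (hw : w - ev 0 ∈ latE8) : IsZ (dotB 8 x w) := by
  have := (uni_int E8_uni (D8_le h) hw).add (h.1 0)
  rwa [← dot_ev x 0, ← map_add, sub_add_cancel] at this

theorem E8_odd_norm {x : Fin 8 → ℚ} (h : x - ev 0 ∈ latE8) : 1 ≤ dotB 8 x x := by
  rcases mem_E8.1 h with h1 | h1
  · obtain ⟨hi, k, hk⟩ := odd_mem.1 h1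
    obtain ⟨a, b⟩ := abs_sum_le hi
    obtain ⟨Q, hQ⟩ := IsZ.sum Finset.univ (fun i => x i * x i) fun i _ => (hi i).mul (hi i)
    rw [dotB_apply, hQ]
    rw [hk, hQ] at a b
    have a' : 2 * k + 1 ≤ Q := by exact_mod_cast a
    have b' : -(2 * k + 1) ≤ Q := by exact_mod_cast b
    have : 1 ≤ Q := by omega
    exact_mod_cast this
  · have hh : ∀ i, ∃ m : ℤ, x i = m + 1 / 2 := by
      apply half_of_sub
      intro i
      have := IsZ.add (h1.1 i) (ev_int 0 i)
      convert this using 1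
      simp only [Pi.sub_apply]
      ring
    have := half_norm_ge hh
    norm_num at this
    linarith

abbrev V8 := Fin 8 → ℚ

/-- The form on `ℚ⁸ ⊕ ℚ⁸ ⊕ ℚ⁸`. -/
noncomputable abbrev C1 : (V8 × V8 × V8) →ₗ[ℚ] (V8 × V8 × V8) →ₗ[ℚ] ℚ :=
  prodB (dotB 8) (prodB (dotB 8) (dotB 8))

abbrev E1 : Submodule ℤ (V8 × V8 × V8) := latE8.prod (latE8.prod latE8)

abbrev D1 : Submodule ℤ (V8 × V8 × V8) := (latD 8).prod ((latD 8).prod (latD 8))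

def t1 : V8 × V8 × V8 := (ev 0, ev 0, ev 0)

def t1' : V8 × V8 × V8 := (cst 8 (1 / 2) + ev 0, ev 0, ev 0)

theorem C1_pos : IsPosDefSymm C1 := prodB_pos (dotB_pos 8) (prodB_pos (dotB_pos 8) (dotB_pos 8))

theorem E1_uni : IsUnimodular C1 E1 := prod_uni E8_uni (prod_uni E8_uni E8_uni)

theorem E1_even : IsEvenLat C1 E1 := prod_even E8_even (prod_even E8_even E8_even)

theorem C1_apply (x y : V8 × V8 × V8) :
    C1 x y = dotB 8 x.1 y.1 + (dotB 8 x.2.1 y.2.1 + dotB 8 x.2.2 y.2.2) := rfl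

theorem t1_odd : ∃ k : ℤ, C1 t1 t1 = 2 * k + 1 := by
  refine ⟨1, ?_⟩
  rw [C1_apply, t1, norm_ev]
  norm_num

theorem E1_span : Submodule.span ℚ (E1 : Set (V8 × V8 × V8)) = ⊤ :=
  span_prod E8_span (span_prod E8_span E8_span)

theorem dot_zero_of {x : V8} (h : dotB 8 x x ≤ 0) : x = 0 := by
  by_contra hx
  have := (dotB_pos 8).2 x hx
  linarith

theorem case1_root {w y : V8 × V8 × V8} (hw : w - t1 ∈ E1) (hy : y ∈ E1) (hZ : IsZ (C1 y w))
    (hn : C1 y y = 2) : y ∈ D1 := by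
  obtain ⟨w1, w2, w3⟩ := hw
  obtain ⟨y1, y2, y3⟩ := hy
  rw [C1_apply] at hZ hn
  have n1 := dot_nonneg y.1
  have n2 := dot_nonneg y.2.1
  have n3 := dot_nonneg y.2.2
  refine ⟨?_, ?_, ?_⟩
  · rcases E8_int_or y1 with h | ⟨h2, h⟩
    · exact h
    · exfalso
      have e2 := dot_zero_of (x := y.2.1) (by linarith)
      have e3 := dot_zero_of (x := y.2.2) (by linarith)
      rw [e2, e3] at hZ
      exact h w.1 w1 (by simpa using hZ)
  · rcases E8_int_or y2 with h | ⟨h2, h⟩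
    · exact h
    · exfalso
      have e2 := dot_zero_of (x := y.1) (by linarith)
      have e3 := dot_zero_of (x := y.2.2) (by linarith)
      rw [e2, e3] at hZ
      exact h w.2.1 w2 (by simpa using hZ)
  · rcases E8_int_or y3 with h | ⟨h2, h⟩
    · exact h
    · exfalso
      have e2 := dot_zero_of (x := y.1) (by linarith)
      have e3 := dot_zero_of (x := y.2.1) (by linarith)
      rw [e2, e3] at hZ
      exact h w.2.2 w3 (by simpa using hZ)

theorem case1_two : (2 : ℤ) • t1 ∈ E1 := ⟨two_ev_E8, two_ev_E8, two_ev_E8⟩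

theorem case1_sub : t1' - t1 ∈ E1 := by
  have e : t1' - t1 = (cst 8 (1 / 2), 0, 0) := by
    simp [t1, t1']
    rfl
  rw [e]
  exact ⟨half_E8, Submodule.zero_mem _, Submodule.zero_mem _⟩

theorem t1'_norm : C1 t1' t1' = 6 := by
  rw [C1_apply, t1', norm_ev, map_add, dot_ev, dot_cst]
  simp only [Pi.add_apply, Finset.sum_add_distrib, sum_ev, sum_cst]
  simp
  norm_num

theorem case1_exist : NeighborsRootPair C1 (nb C1 E1 t1)
    (prodForm (stdDot 8) (prodForm (stdDot 8) (stdDot 8))) (latE8.prod (latE8.prod latE8))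
    (prodForm (stdDot 8) (prodForm (stdDot 8) (stdDot 8)))
    ((latD 8).prod ((latD 8).prod (latD 8))) := by
  have two' : (2 : ℤ) • t1' ∈ E1 := by
    have := Submodule.add_mem _ (Submodule.smul_mem _ 2 case1_sub) case1_two
    rwa [← smul_add, sub_add_cancel] at this
  have g8 := latD_gen 8 (by norm_num)
  refine exist_of (t' := t1') (by simp) C1_pos E1_uni E1_even E1_span case1_two case1_sub t1_odd
    ⟨3, by rw [t1'_norm]; norm_num⟩ (iso_of_eq ?_) (iso_of_eq ?_)
  · exact root_eq le_rfl (gen_prod E8_gen (gen_prod E8_gen E8_gen)) fun x hx _ => hx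
  · refine root_eq (fun x hx => ?_) (gen_prod g8 (gen_prod g8 g8)) fun x hx hn => ?_
    · refine mem_nb_of ⟨D8_le hx.1, D8_le hx.2.1, D8_le hx.2.2⟩ ?_
      rw [C1_apply]
      exact (D8_ev hx.1 case1_sub.1).add
        ((D8_ev hx.2.1 case1_sub.2.1).add (D8_ev hx.2.2 case1_sub.2.2))
    · rcases nb_cases two' ⟨6, by rw [t1'_norm]; norm_num⟩ hx with ⟨h1, h2⟩ | ⟨h1, -⟩
      · exact case1_root case1_sub h1 h2 hn
      · exfalso
        have h2 := Submodule.add_mem _ h1 case1_sub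
        rw [sub_add_sub_cancel] at h2
        have a := E8_odd_norm h2.1
        have b := E8_odd_norm h2.2.1
        have c := E8_odd_norm h2.2.2
        rw [C1_apply] at hn
        linarith

/-- Coordinates on `ℚ⁸ ⊕ ℚ⁸ ⊕ ℚ⁸`. -/
noncomputable def J1 : (V8 × V8 × V8) →ₗ[ℚ] (Fin 8 ⊕ (Fin 8 ⊕ Fin 8) → ℚ) :=
  LinearMap.pi (Sum.elim (fun i => (LinearMap.proj i).comp (LinearMap.fst ℚ _ _))
    (fun i => (LinearMap.proj i).comp ((sumJ 8 8).comp (LinearMap.snd ℚ _ _))))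

theorem J1_inl (x : V8 × V8 × V8) (i) : J1 x (Sum.inl i) = x.1 i := rfl

theorem J1_inr (x : V8 × V8 × V8) (i) : J1 x (Sum.inr i) = sumJ 8 8 x.2 i := rfl

theorem J1_isom (x y : V8 × V8 × V8) : C1 x y = ∑ i, J1 x i * J1 y i := by
  rw [Fintype.sum_sum_type, prodB_apply, sumJ_isom, dotB_apply]
  rfl

theorem case1_normal (E : Submodule ℤ (V8 × V8 × V8)) (t : V8 × V8 × V8)
    (h : Cfg C1 E1 C1 D1 E t) :
    ∃ e : (V8 × V8 × V8) ≃ₗ[ℚ] (V8 × V8 × V8), Isom C1 C1 e ∧ mapL e E = E1 ∧ e t - t1 ∈ E1 := by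
  have hE := uni_eq_of_le h.uni E1_uni h.le
  have h2 := h.two
  rw [hE] at h2
  obtain ⟨σ1, i1, m1, r1⟩ := E8red h2.1
  obtain ⟨σ2, i2, m2, r2⟩ := E8red h2.2.1
  obtain ⟨σ3, i3, m3, r3⟩ := E8red h2.2.2
  have he := prodCongr_isom i1 (prodCongr_isom i2 i3)
  have h' := h.map (e := σ1.prodCongr (σ2.prodCongr σ3)) he
    (fun x => and_congr (m1 x.1) (and_congr (m2 x.2.1) (m3 x.2.2)))
  have hE' := uni_eq_of_le h'.uni E1_uni h'.le
  refine ⟨_, he, hE', ?_⟩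
  obtain ⟨p, hp1, hp2⟩ := h'.obs J1 J1_isom
  have hp3 : ∀ x ∈ mapL (σ1.prodCongr (σ2.prodCongr σ3)) E, C1 x x = 2 →
      IsZ (C1 x (σ1.prodCongr (σ2.prodCongr σ3) t)) → ∀ i, IsZ (p x i) := by
    intro x hx hn hZ i
    obtain ⟨y, hy, hxy⟩ := hp1 x hx hn hZ
    rw [hxy]
    rcases i with i | i | i
    · exact hy.1.1 i
    · exact hy.2.1.1 i
    · exact hy.2.2.1 i
  refine ⟨?_, ?_, ?_⟩
  · rw [← or_assoc] at r1
    refine r1.resolve_left fun hr => ?_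
    refine E8_obs p hp3 hp2 (LinearMap.inl ℚ _ _) (fun x y => by simp [prodB_apply])
      (fun x hx => h'.le ⟨hx, Submodule.zero_mem _, Submodule.zero_mem _⟩) (fun x => ?_) hr
    simp [prodB_apply]
  · rw [← or_assoc] at r2
    refine r2.resolve_left fun hr => ?_
    refine E8_obs p hp3 hp2 ((LinearMap.inr ℚ _ _).comp (LinearMap.inl ℚ _ _))
      (fun x y => by simp [prodB_apply])
      (fun x hx => h'.le ⟨Submodule.zero_mem _, hx, Submodule.zero_mem _⟩) (fun x => ?_) hr
    simp [prodB_apply]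
  · rw [← or_assoc] at r3
    refine r3.resolve_left fun hr => ?_
    refine E8_obs p hp3 hp2 ((LinearMap.inr ℚ _ _).comp (LinearMap.inr ℚ _ _))
      (fun x y => by simp [prodB_apply])
      (fun x hx => h'.le ⟨Submodule.zero_mem _, Submodule.zero_mem _, hx⟩) (fun x => ?_) hr
    simp [prodB_apply]

theorem case1_unique {B₁ B₂ : V →ₗ[ℚ] V →ₗ[ℚ] ℚ} [FiniteDimensional ℚ V] {N₁ N₂ : Submodule ℤ V}
    (h₁ : NeighborsRootPair B₁ N₁ (prodForm (stdDot 8) (prodForm (stdDot 8) (stdDot 8)))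
      (latE8.prod (latE8.prod latE8)) (prodForm (stdDot 8) (prodForm (stdDot 8) (stdDot 8)))
      ((latD 8).prod ((latD 8).prod (latD 8))))
    (h₂ : NeighborsRootPair B₂ N₂ (prodForm (stdDot 8) (prodForm (stdDot 8) (stdDot 8)))
      (latE8.prod (latE8.prod latE8)) (prodForm (stdDot 8) (prodForm (stdDot 8) (stdDot 8)))
      ((latD 8).prod ((latD 8).prod (latD 8)))) :
    LatticeIsometric (fun x y => B₁ x y) (fun x y => B₂ x y) N₁ N₂ :=
  unique_of_normal (C := C1) (C₂ := C1) C1_pos E1_span (by simp) E1 t1 t1_odd case1_normal h₁ h₂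



abbrev V16 := Fin 16 → ℚ

/-- The form on `ℚ¹⁶ ⊕ ℚ⁸`. -/
noncomputable abbrev C2 : (V16 × V8) →ₗ[ℚ] (V16 × V8) →ₗ[ℚ] ℚ := prodB (dotB 16) (dotB 8)

abbrev E2 : Submodule ℤ (V16 × V8) := (latDp 16).prod latE8

abbrev M2 : Submodule ℤ (V16 × V8) := (latD 16).prod latE8

theorem M2_le : M2 ≤ E2 := fun _ hx => ⟨latD_le_latDp 16 hx.1, hx.2⟩

def t2 : V16 × V8 := (cst 16 (1 / 4) + (ev 0 + ev 1), ev 0)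

def t2' : V16 × V8 := (cst 16 (1 / 4), ev 0)

theorem C2_pos : IsPosDefSymm C2 := prodB_pos (dotB_pos 16) (dotB_pos 8)

theorem E2_uni : IsUnimodular C2 E2 := prod_uni (latDp_uni (m := 4) rfl) E8_uni

theorem E2_even : IsEvenLat C2 E2 := prod_even (latDp_even (m := 2) rfl) E8_even

theorem M2_span : Submodule.span ℚ (M2 : Set (V16 × V8)) = ⊤ :=
  span_prod (span_of_latD le_rfl) E8_span

theorem C2_t2 (x : V16 × V8) : C2 x t2' = (∑ i, x.1 i) / 4 + x.2 0 := by
  rw [prodB_apply, t2', dot_cst, dot_ev]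
  ring

theorem t2'_norm : C2 t2' t2' = 2 := by
  rw [C2_t2]
  simp only [t2', sum_cst]
  simp
  norm_num

theorem case2_sub : t2' - t2 ∈ E2 := by
  have e : t2' - t2 = (-(ev 0 + ev 1), 0) := by
    simp [t2, t2']
  rw [e]
  exact M2_le ⟨Submodule.neg_mem _ (ev_add_mem 0 1), Submodule.zero_mem _⟩

theorem case2_two' : (2 : ℤ) • t2' ∈ E2 := by
  refine ⟨?_, two_ev_E8⟩
  have e : ((2 : ℤ) • t2').1 = cst 16 (1 / 2) := by
    funext i
    simp [t2']
    norm_num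
  rw [e]
  exact half_mem_latDp 16

theorem case2_two : (2 : ℤ) • t2 ∈ E2 := by
  have := Submodule.sub_mem _ case2_two' (Submodule.smul_mem _ 2 case2_sub)
  rwa [← smul_sub, sub_sub_cancel] at this

theorem t2_odd : ∃ k : ℤ, C2 t2 t2 = 2 * k + 1 := by
  refine ⟨2, ?_⟩
  have h := norm_ev_add (n := 16) (i := 0) (j := 1) (by decide)
  rw [dotB_apply] at h
  rw [prodB_apply, t2, quarter_norm, h, norm_ev]
  simp only [Pi.add_apply, Finset.sum_add_distrib, sum_ev]
  norm_num

theorem E8_dot_int {w : V8} (hw : w - ev 0 ∈ latE8) : IsZ (dotB 8 w w) := by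
  obtain ⟨a, ha⟩ := uni_int E8_uni hw hw
  obtain ⟨b, hb⟩ := uni_int E8_uni hw two_ev_E8
  refine ⟨a + b + 1, ?_⟩
  have e : w = (w - ev 0) + ev 0 := by abel
  have hb' : 2 * dotB 8 (w - ev 0) (ev 0) = b := by
    rw [B_zsmul_right] at hb
    push_cast at hb
    exact hb
  have c : dotB 8 (ev 0) (w - ev 0) = dotB 8 (w - ev 0) (ev 0) := (dotB_pos 8).1 _ _
  have n : dotB 8 (ev 0) (ev 0) = 1 := by rw [norm_ev]; simp
  rw [e, map_add, map_add, LinearMap.add_apply, LinearMap.add_apply, ha, n, c]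
  push_cast
  linarith

theorem case2_obs {E : Submodule ℤ (V16 × V8)} {t : V16 × V8}
    (h : Cfg C2 M2 (prodB (dotB 16) (dotB 9)) ((latA 15).prod (latD 9)) E t)
    (hw : t.2 - ev 0 ∈ latE8) (hd : ∀ i, IsZ (2 * t.1 i)) : False := by
  classical
  obtain ⟨T, hT, hTp⟩ := exists_parity (t := t.1) (by norm_num) hd
  obtain ⟨p, hp1, hp2⟩ := h.obs (sumJ 16 9) sumJ_isom
  let A : Finset (Fin 16 ⊕ Fin 9) := Finset.univ.map Function.Embedding.inl
  have hp3 : ∀ x ∈ E, C2 x x = 2 → IsZ (C2 x t) →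
      (∀ i, IsZ (p x i)) ∧ ∑ i ∈ A, p x i = 0 := by
    intro x hx h2 h3
    obtain ⟨y, hy, hxy⟩ := hp1 x hx h2 h3
    rw [hxy]
    refine ⟨?_, ?_⟩
    · rintro (i | i)
      · exact hy.1.1 i
      · exact hy.2.1 i
    · rw [Finset.sum_map]
      exact hy.1.2
  have o1 := obsT (T := T) (by simpa using hT) p A hp3 hp2
    (fun k => ((ev (k : Fin 16), 0) : V16 × V8))
    (fun k l => by
      rw [prodB_apply]
      simp only [map_zero, add_zero]
      rw [norm_ev]
      exact if_congr Subtype.ext_iff.symm rfl rfl)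
    (fun k l _ => by
      rw [Prod.mk_add_mk, Prod.mk_sub_mk, add_zero, sub_zero]
      exact ⟨h.le ⟨ev_add_mem _ _, Submodule.zero_mem _⟩,
        h.le ⟨ev_sub_mem _ _, Submodule.zero_mem _⟩⟩)
    (fun k l _ => by
      rw [Prod.mk_add_mk, Prod.mk_sub_mk, add_zero, sub_zero, prodB_apply, prodB_apply]
      simp only [map_zero, LinearMap.zero_apply, add_zero]
      rw [(dotB_pos 16).1, (dotB_pos 16).1 _ t.1, map_add, map_sub, dot_ev, dot_ev]
      exact hTp k k.2 l l.2)
  have o2 := obsT (T := Fin 8) (by simp) p A hp3 hp2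
    (fun k => ((0, ev k) : V16 × V8))
    (fun k l => by
      rw [prodB_apply]
      simp only [map_zero, zero_add]
      rw [norm_ev])
    (fun k l _ => by
      rw [Prod.mk_add_mk, Prod.mk_sub_mk, add_zero, sub_zero]
      exact ⟨h.le ⟨Submodule.zero_mem _, D8_le (ev_add_mem _ _)⟩,
        h.le ⟨Submodule.zero_mem _, D8_le (ev_sub_mem _ _)⟩⟩)
    (fun k l _ => by
      rw [Prod.mk_add_mk, Prod.mk_sub_mk, add_zero, sub_zero, prodB_apply, prodB_apply]
      simp only [map_zero, LinearMap.zero_apply, zero_add]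
      exact ⟨D8_ev (ev_add_mem _ _) hw, D8_ev (ev_sub_mem _ _) hw⟩)
  let u : T ⊕ Fin 8 → V16 × V8 := Sum.elim (fun k => (ev (k : Fin 16), 0)) (fun k => (0, ev k))
  have o : ∀ k, u k ∈ Submodule.span ℚ {x | x ∈ E ∧ C2 x x = 2 ∧ IsZ (C2 x t)} ∧
      ∃ i, i ∉ A ∧ p (u k) i ≠ 0 ∧ ∀ j, j ≠ i → p (u k) j = 0 := by
    rintro (k | k)
    · exact o1 k
    · exact o2 k
  have orth : ∀ k l, k ≠ l → C2 (u k) (u l) = 0 := by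
    rintro (k | k) (l | l) hkl
    · have hne : (k : Fin 16) ≠ l := fun h => hkl (by rw [Subtype.ext h])
      simp [u, prodB_apply, norm_ev, hne]
    · simp [u, prodB_apply]
    · simp [u, prodB_apply]
    · have hne : k ≠ l := fun h => hkl (by rw [h])
      simp [u, prodB_apply, norm_ev, hne]
  choose f hf using fun k => (o k).2
  have hinj : Function.Injective f := by
    intro k l hkl
    by_contra hne
    have := hp2 _ (o k).1 _ (o l).1
    rw [orth k l hne, Finset.sum_eq_single (f k)] at this
    · rcases mul_eq_zero.1 this with h0 | h0
      · exact (hf k).2.1 h0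
      · rw [hkl] at h0
        exact (hf l).2.1 h0
    · intro j _ hj
      rw [(hf k).2.2 j hj, zero_mul]
    · intro h
      exact absurd (Finset.mem_univ _) h
  have hr : ∀ k, ∃ j : Fin 9, f k = Sum.inr j := by
    intro k
    rcases hfk : f k with i | j
    · exact absurd (Finset.mem_map.2 ⟨i, Finset.mem_univ _, hfk.symm⟩) (hf k).1
    · exact ⟨j, rfl⟩
  choose g hg using hr
  have hginj : Function.Injective g := by
    intro k l hkl
    apply hinj
    rw [hg, hg, hkl]
  have := Fintype.card_le_of_injective g hginj
  simp only [Fintype.card_sum, Fintype.card_coe, Fintype.card_fin] at this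
  omega

theorem case2_lemma {E : Submodule ℤ (V16 × V8)} {z : V16} {w : V8}
    (h : Cfg C2 M2 (prodB (dotB 16) (dotB 9)) ((latA 15).prod (latD 9)) E
      (cst 16 (1 / 4) + z, w))
    (hz : ∀ i, IsZ (z i)) (hw : w - ev 0 ∈ latE8) :
    E = E2 ∧ (cst 16 (1 / 4) + z, w) - t2 ∈ E2 := by
  have half : ((cst 16 (1 / 2), 0) : V16 × V8) ∈ E := by
    have h2w : (2 : ℤ) • w ∈ latE8 := by
      have := Submodule.add_mem _ (Submodule.smul_mem _ 2 hw) two_ev_E8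
      rwa [← smul_add, sub_add_cancel] at this
    have := Submodule.sub_mem _ h.two (h.le (x := ((2 : ℤ) • z, (2 : ℤ) • w)) ⟨two_mem_latD hz, h2w⟩)
    convert this using 1
    apply Prod.ext
    · funext i
      simp
      ring
    · simp
  refine ⟨uni_eq_of_le h.uni E2_uni ?_, ?_, ?_⟩
  · rintro ⟨x, y⟩ ⟨hx, hy⟩
    rcases (mem_latDp (m := 8) rfl).1 hx with hx | hx
    · exact h.le ⟨hx, hy⟩
    · have := Submodule.add_mem _ half (h.le (x := (x - cst 16 (1 / 2), y)) ⟨hx, hy⟩)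
      convert this using 1
      simp
  · obtain ⟨k, hk⟩ := h.odd
    rw [prodB_apply, quarter_norm] at hk
    obtain ⟨a, ha⟩ := E8_dot_int hw
    obtain ⟨b, hb⟩ := IsZ.sum Finset.univ (fun i => z i * z i) fun i _ => (hz i).mul (hz i)
    have e : ((cst 16 (1 / 4) + z, w) - t2).1 = z - (ev 0 + ev 1) := by
      simp [t2]
    rw [e]
    refine latD_le_latDp 16 (Submodule.sub_mem _ ⟨hz, 2 * k - a - b, ?_⟩ (ev_add_mem 0 1))
    change _ + dotB 8 w w = _ at hk
    rw [ha, hb] at hk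
    push_cast at hk ⊢
    linarith
  · exact hw

theorem case2_normal (E : Submodule ℤ (V16 × V8)) (t : V16 × V8)
    (h : Cfg C2 M2 (prodB (dotB 16) (dotB 9)) ((latA 15).prod (latD 9)) E t) :
    ∃ e : (V16 × V8) ≃ₗ[ℚ] (V16 × V8), Isom C2 C2 e ∧ mapL e E = E2 ∧ e t - t2 ∈ E2 := by
  have d2 : (2 : ℤ) • t.2 ∈ latE8 := by
    rw [E8_uni]
    intro y hy
    have := uni_int h.uni h.two (h.le (x := (0, y)) ⟨Submodule.zero_mem _, hy⟩)
    change IsZ _; simpa [prodB_apply] using this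
  have d1 := dual_latD (x := (2 : ℤ) • t.1) (fun y hy => by
    have := uni_int h.uni h.two (h.le (x := (y, 0)) ⟨hy, Submodule.zero_mem _⟩)
    simpa [prodB_apply] using this)
  obtain ⟨σ, hi, hm, hr⟩ := E8red d2
  have he0 := prodCongr_isom (e := LinearEquiv.refl ℚ V16) (B := dotB 16)
    (fun x y => rfl) hi
  have h0 := h.map he0 (fun x => and_congr Iff.rfl (hm x.2))
  have hw : σ t.2 - ev 0 ∈ latE8 := by
    rw [← or_assoc] at hr
    refine hr.resolve_left fun hr => ?_
    obtain ⟨p, hp1, hp2⟩ := h0.obs (sumJ 16 9) sumJ_isom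
    refine E8_obs p (fun x hx h2 h3 i => ?_) hp2 (LinearMap.inr ℚ _ _)
      (fun x y => by simp [prodB_apply])
      (fun x hx => h0.le ⟨Submodule.zero_mem _, hx⟩) (fun x => ?_) hr
    · obtain ⟨y, hy, hxy⟩ := hp1 x hx h2 h3
      rw [hxy]
      rcases i with i | i
      · exact hy.1.1 i
      · exact hy.2.1 i
    · simp [prodB_apply]
  have q1 : ∀ i, ∃ m : ℤ, 2 * t.1 i = m + 1 / 2 := by
    rcases d1 with d | d
    · exact (case2_obs h0 hw (fun i => by simpa using d i)).elim
    · intro i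
      simpa using d i
  obtain ⟨s, hs, hst⟩ := flip_quarter q1
  obtain ⟨z, hz, ht⟩ := quarter_of (t := flip s hs t.1) hst
  have he := prodCongr_isom (flip_isom s hs) hi
  have h' := h.map (e := (flip s hs).prodCongr σ) he
    (fun x => and_congr (flip_mem_iff s hs x.1) (hm x.2))
  have het : (flip s hs).prodCongr σ t = (cst 16 (1 / 4) + z, σ t.2) := Prod.ext ht rfl
  rw [het] at h'
  obtain ⟨a, b⟩ := case2_lemma h' hz hw
  refine ⟨_, he, a, ?_⟩
  rw [het]
  exact b

theorem case2_unique {B₁ B₂ : V →ₗ[ℚ] V →ₗ[ℚ] ℚ} [FiniteDimensional ℚ V] {N₁ N₂ : Submodule ℤ V}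
    (h₁ : NeighborsRootPair B₁ N₁ (prodForm (stdDot 16) (stdDot 8)) ((latD 16).prod latE8)
      (prodForm (stdDot 16) (stdDot 9)) ((latA 15).prod (latD 9)))
    (h₂ : NeighborsRootPair B₂ N₂ (prodForm (stdDot 16) (stdDot 8)) ((latD 16).prod latE8)
      (prodForm (stdDot 16) (stdDot 9)) ((latA 15).prod (latD 9))) :
    LatticeIsometric (fun x y => B₁ x y) (fun x y => B₂ x y) N₁ N₂ :=
  unique_of_normal (C := C2) (C₂ := prodB (dotB 16) (dotB 9)) C2_pos M2_span (by simp)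
    E2 t2 t2_odd case2_normal h₁ h₂



/-- Embedding of `A₁₅ ⊕ D₉`. -/
noncomputable def psi2 : (Fin 16 → ℚ) × (Fin 9 → ℚ) →ₗ[ℚ] V16 × V8 where
  toFun p := (fun i => p.1 i + p.2 (Fin.last 8) / 4, fun j => p.2 j.castSucc)
  map_add' x y := by
    apply Prod.ext <;> funext i <;>
    simp only [Prod.fst_add, Prod.snd_add, Pi.add_apply]
    ring
  map_smul' c x := by
    apply Prod.ext <;> funext i <;>
    simp only [Prod.smul_fst, Prod.smul_snd, Pi.smul_apply, smul_eq_mul, RingHom.id_apply]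
    ring

theorem psi2_fst (p : (Fin 16 → ℚ) × (Fin 9 → ℚ)) (i : Fin 16) :
    (psi2 p).1 i = p.1 i + p.2 (Fin.last 8) / 4 := rfl

theorem psi2_snd (p : (Fin 16 → ℚ) × (Fin 9 → ℚ)) (j : Fin 8) :
    (psi2 p).2 j = p.2 j.castSucc := rfl

theorem psi2_isom (p q : (Fin 16 → ℚ) × (Fin 9 → ℚ)) (hp : p ∈ (latA 15).prod (latD 9))
    (hq : q ∈ (latA 15).prod (latD 9)) :
    C2 (psi2 p) (psi2 q) = prodB (dotB 16) (dotB 9) p q := by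
  have hp1 : ∑ i, p.1 i = 0 := hp.1.2
  have hq1 : ∑ i, q.1 i = 0 := hq.1.2
  rw [prodB_apply, prodB_apply, dotB_apply, dotB_apply, dotB_apply, dotB_apply,
    Fin.sum_univ_castSucc (n := 8)]
  simp only [psi2_fst, psi2_snd]
  have e1 : ∀ i : Fin 16, (p.1 i + p.2 (Fin.last 8) / 4) * (q.1 i + q.2 (Fin.last 8) / 4) =
      p.1 i * q.1 i + p.1 i * (q.2 (Fin.last 8) / 4) + p.2 (Fin.last 8) / 4 * q.1 i +
        p.2 (Fin.last 8) * q.2 (Fin.last 8) / 16 := fun i => by ring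
  simp only [e1, Finset.sum_add_distrib, ← Finset.mul_sum, ← Finset.sum_mul, hp1, hq1]
  simp only [Finset.sum_const, Finset.card_univ, Fintype.card_fin]
  ring

theorem psi2_hit {y : V16 × V8} {x : V16} {a : ℤ} (hx : x ∈ latA 15)
    (h2 : ∀ i, IsZ (y.2 i)) (hs : ∃ k : ℤ, ∑ i, y.2 i + a = 2 * k)
    (h1 : ∀ i, y.1 i = x i + a / 4) : ∃ p ∈ (latA 15).prod (latD 9), psi2 p = y := by
  refine ⟨(x, Fin.snoc (α := fun _ => ℚ) y.2 (a : ℚ)), ⟨hx, fun i => ?_, ?_⟩, ?_⟩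
  · refine Fin.lastCases ?_ (fun j => ?_) i
    · simp only [Fin.snoc_last]
      exact isZ_int a
    · simp only [Fin.snoc_castSucc]
      exact h2 j
  · rw [Fin.sum_univ_castSucc]
    simp only [Fin.snoc_castSucc, Fin.snoc_last]
    exact hs
  · apply Prod.ext
    · funext i
      rw [psi2_fst, h1]
      simp only [Fin.snoc_last]
    · funext i
      rw [psi2_snd]
      simp only [Fin.snoc_castSucc]

theorem E8_odd_int {x : V8} (h : x - ev 0 ∈ latE8) (hn : dotB 8 x x < 2) :
    (∀ i, IsZ (x i)) ∧ ∃ k : ℤ, ∑ i, x i = 2 * k + 1 := by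
  rcases mem_E8.1 h with h1 | h1
  · exact odd_mem.1 h1
  · have hh : ∀ i, ∃ m : ℤ, x i = m + 1 / 2 := by
      apply half_of_sub
      intro i
      have := IsZ.add (h1.1 i) (ev_int 0 i)
      convert this using 1
      simp only [Pi.sub_apply]
      ring
    have := half_norm_ge hh
    norm_num at this
    linarith

theorem case2_hitb {y : V16 × V8} (h1 : y.1 - cst 16 (1 / 4) ∈ latD 16)
    (h2 : y.2 - ev 0 ∈ latE8) (hn : C2 y y = 2) :
    ∃ p ∈ (latA 15).prod (latD 9), psi2 p = y := by
  have n2 := E8_odd_norm h2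
  set z := y.1 - cst 16 (1 / 4) with hzdef
  have hy1 : y.1 = cst 16 (1 / 4) + z := by rw [hzdef]; abel
  rw [prodB_apply, hy1, quarter_norm] at hn
  obtain ⟨a, b⟩ := abs_sum_le h1.1
  have hz0 : ∑ i, z i * z i = 0 := by
    have := dot_nonneg z
    rw [dotB_apply] at this
    push_cast at hn
    linarith
  rw [hz0] at a b hn
  have hs0 : ∑ i, z i = 0 := by linarith
  rw [hs0] at hn
  have hz : z = 0 := by
    by_contra hne
    have := (dotB_pos 16).2 z hne
    rw [dotB_apply, hz0] at this
    exact lt_irrefl _ this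
  obtain ⟨i2, k, hk⟩ := E8_odd_int h2 (by push_cast at hn; linarith)
  refine psi2_hit (x := 0) (a := 1) (Submodule.zero_mem _) i2 ⟨k + 1, ?_⟩ (fun i => ?_)
  · rw [hk]
    push_cast
    ring
  · rw [hy1, hz]
    simp

theorem case2_hit {y : V16 × V8} (hy : y ∈ nb C2 E2 t2') (hn : C2 y y = 2) :
    ∃ p ∈ (latA 15).prod (latD 9), psi2 p = y := by
  have n1 := dot_nonneg y.1
  have n2 := dot_nonneg y.2
  have hn' := hn
  rw [prodB_apply] at hn'
  rcases nb_cases case2_two' ⟨2, by rw [t2'_norm]; norm_num⟩ hy with ⟨h1, h3⟩ | ⟨h1, -⟩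
  · have hD := latDp_root (m := 2) rfl le_rfl h1.1 (by linarith)
    rcases E8_int_or h1.2 with h | ⟨h2, h⟩
    · rw [C2_t2] at h3
      have h4 := h3.sub (h.1 0)
      rw [add_sub_cancel_right] at h4
      obtain ⟨a, b⟩ := abs_sum_le hD.1
      rw [← dotB_apply] at a b
      obtain ⟨k, hk⟩ := h4
      have hk' : ∑ i, y.1 i = 4 * k := by linarith
      rw [hk'] at a b
      have a' : (4 * k : ℚ) ≤ 2 := by linarith
      have b' : (-(4 * k) : ℚ) ≤ 2 := by linarith
      have a'' : 4 * k ≤ 2 := by exact_mod_cast a'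
      have b'' : -(4 * k) ≤ 2 := by exact_mod_cast b'
      have hk0 : k = 0 := by omega
      obtain ⟨i2, l, hl⟩ := h
      refine psi2_hit (x := y.1) (a := 0) ⟨hD.1, ?_⟩ i2 ⟨l, ?_⟩ (fun i => ?_)
      · exact hk'.trans (by rw [hk0]; simp)
      · rw [hl]
        simp
      · simp
    · exfalso
      have e : y.1 = 0 := by
        by_contra hne
        have := (dotB_pos 16).2 y.1 hne
        linarith
      refine h (ev 0) (by rw [sub_self]; exact Submodule.zero_mem _) ?_
      rw [C2_t2, e] at h3
      rw [dot_ev]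
      simpa using h3
  · rcases (mem_latDp (m := 8) rfl).1 h1.1 with h | h
    · exact case2_hitb h h1.2 hn
    · suffices key : ∃ p ∈ (latA 15).prod (latD 9), psi2 p = -y by
        obtain ⟨p, hp, hpy⟩ := key
        exact ⟨-p, Submodule.neg_mem _ hp, by rw [map_neg, hpy, neg_neg]⟩
      refine case2_hitb (y := -y) ?_ ?_ (by simpa using hn)
      · have h5 : cst 16 1 ∈ latD 16 := by
          refine ⟨fun i => isZ_one, 8, ?_⟩
          rw [sum_cst]
          norm_num
        have := Submodule.neg_mem _ (Submodule.add_mem _ h h5)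
        convert this using 1
        funext i
        simp [t2']
        ring
      · have := Submodule.neg_mem _ (Submodule.add_mem _ h1.2 two_ev_E8)
        convert this using 1
        funext i
        simp [t2']
        ring

theorem latD_gen2 {n : ℕ} {S : Submodule ℤ (Fin n → ℚ)}
    (hS : ∀ i j, i ≠ j → ev i - ev j ∈ S) {i j : Fin n} (hij : i ≠ j) (h : ev i + ev j ∈ S) :
    latD n ≤ S := by
  intro x hx
  rw [mem_latD] at hx
  obtain ⟨h1, k, hk⟩ := hx
  choose z hz using h1
  have h2 := sub_ev_span i hS hz
  have h3 := Submodule.add_mem _ h2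
    (Submodule.smul_mem _ k (Submodule.add_mem _ h (hS i j hij)))
  convert h3 using 1
  funext l
  rw [hk]
  simp only [Pi.add_apply, Pi.sub_apply, Pi.smul_apply, smul_eq_mul]
  simp only [zsmul_eq_mul]
  ring

theorem case2_f (j : Fin 8) : (cst 16 (1 / 4), -ev j) ∈ rootSublattice C2 (nb C2 E2 t2') := by
  refine Submodule.subset_span ⟨?_, ?_⟩
  · have hw : ((0, ev 0 + ev j) : V16 × V8) ∈ nb C2 E2 t2' := by
      refine mem_nb_of (M2_le ⟨Submodule.zero_mem _, D8_le (ev_add_mem 0 j)⟩) ?_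
      rw [C2_t2]
      have := (ev_int 0 (0 : Fin 8)).add (ev_int j 0)
      simpa only [Pi.zero_apply, Finset.sum_const_zero, zero_div, zero_add, Pi.add_apply] using this
    have := Submodule.sub_mem _ (self_mem_nb (B := C2) (E := E2) (t := t2')) hw
    convert this using 1
    simp [t2']
  · rw [prodB_apply, dot_neg_neg, norm_ev, dot_cst, sum_cst]
    norm_num

theorem case2_t : t2' ∈ rootSublattice C2 (nb C2 E2 t2') :=
  Submodule.subset_span ⟨self_mem_nb, t2'_norm⟩

theorem psi2_ev (j : Fin 8) : psi2 (0, ev j.castSucc) = (0, ev j) := by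
  apply Prod.ext
  · funext k
    rw [psi2_fst]
    have : (ev j.castSucc : Fin 9 → ℚ) (Fin.last 8) = 0 :=
      Pi.single_eq_of_ne (Fin.castSucc_lt_last j).ne' _
    dsimp only
    rw [this]
    simp
  · funext k
    rw [psi2_snd]
    simp [Pi.single_apply]

theorem psi2_last : psi2 (0, ev (Fin.last 8)) = (cst 16 (1 / 4), 0) := by
  apply Prod.ext
  · funext k
    rw [psi2_fst]
    simp
  · funext k
    rw [psi2_snd]
    exact ev_last_castSucc k

theorem case2_exist : NeighborsRootPair C2 (nb C2 E2 t2)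
    (prodForm (stdDot 16) (stdDot 8)) ((latD 16).prod latE8)
    (prodForm (stdDot 16) (stdDot 9)) ((latA 15).prod (latD 9)) := by
  refine exist_of (t' := t2') (by simp) C2_pos E2_uni E2_even (span_mono_top M2_le M2_span)
    case2_two case2_sub t2_odd ⟨1, by rw [t2'_norm]; norm_num⟩ (iso_of_eq ?_)
    (iso_of_psi (C₂ := prodB (dotB 16) (dotB 9)) (prodB_pos (dotB_pos 16) (dotB_pos 9)) psi2
      (fun x hx y hy => psi2_isom x y hx hy) ?_ (fun y hy hn => case2_hit hy hn))
  · refine root_eq M2_le (gen_prod (latD_gen 16 (by norm_num)) E8_gen) fun x hx h2 => ?_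
    rw [prodB_apply] at h2
    have := dot_nonneg x.2
    exact ⟨latDp_root (m := 2) rfl le_rfl hx.1 (by linarith), hx.2⟩
  · intro p hp
    have a1 := latA_gen 15 (S := (rootSublattice C2 (nb C2 E2 t2')).comap
      ((psi2.comp (LinearMap.inl ℚ _ _)).restrictScalars ℤ)) ?_ hp.1
    · have a2 := latD_gen2 (S := (rootSublattice C2 (nb C2 E2 t2')).comap
        ((psi2.comp (LinearMap.inr ℚ _ _)).restrictScalars ℤ)) ?_
        (Fin.castSucc_lt_last (0 : Fin 8)).ne' ?_ hp.2
      · have := Submodule.add_mem (rootSublattice C2 (nb C2 E2 t2')) a1 a2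
        change psi2 (p.1, 0) + psi2 (0, p.2) ∈ rootSublattice C2 (nb C2 E2 t2') at this
        rwa [← map_add, Prod.mk_add_mk, add_zero, zero_add] at this
      · have key : ∀ j : Fin 8,
            psi2 (0, ev (Fin.last 8) - ev j.castSucc) ∈ rootSublattice C2 (nb C2 E2 t2') := by
          intro j
          have e : psi2 (0, ev (Fin.last 8) - ev j.castSucc) = (cst 16 (1 / 4), -ev j) := by
            have : ((0, ev (Fin.last 8) - ev j.castSucc) : (Fin 16 → ℚ) × (Fin 9 → ℚ)) =
                (0, ev (Fin.last 8)) - (0, ev j.castSucc) := by simp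
            rw [this, map_sub, psi2_last, psi2_ev]
            simp
          rw [e]
          exact case2_f j
        have key' : ∀ j : Fin 9,
            psi2 (0, ev (Fin.last 8) - ev j) ∈ rootSublattice C2 (nb C2 E2 t2') := by
          intro j
          refine Fin.lastCases ?_ key j
          rw [sub_self, Prod.mk_zero_zero, map_zero]
          exact Submodule.zero_mem _
        intro i j _
        have := Submodule.sub_mem _ (key' j) (key' i)
        rw [← map_sub, Prod.mk_sub_mk, sub_zero, sub_sub_sub_cancel_left] at this
        exact this
      · change psi2 (0, ev (Fin.last 8) + ev (Fin.castSucc 0)) ∈ rootSublattice C2 (nb C2 E2 t2')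
        have : ((0, ev (Fin.last 8) + ev (Fin.castSucc 0)) : (Fin 16 → ℚ) × (Fin 9 → ℚ)) =
            (0, ev (Fin.last 8)) + (0, ev (Fin.castSucc 0)) := by simp
        rw [this, map_add, psi2_last, psi2_ev]
        have e : ((cst 16 (1 / 4), 0) : V16 × V8) + (0, ev 0) = t2' := by simp [t2']
        rw [e]
        exact case2_t
    · intro i j hij
      change psi2 (ev i - ev j, 0) ∈ rootSublattice C2 (nb C2 E2 t2')
      have e : psi2 (ev i - ev j, 0) = (ev i - ev j, 0) := by
        apply Prod.ext
        · funext k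
          rw [psi2_fst]
          simp
        · funext k
          rw [psi2_snd]
          simp
      rw [e]
      refine Submodule.subset_span ⟨mem_nb_of (M2_le ⟨ev_sub_mem i j, Submodule.zero_mem _⟩) ?_, ?_⟩
      · rw [C2_t2]
        simp only [Pi.sub_apply, Finset.sum_sub_distrib, sum_ev, Pi.zero_apply, sub_self, zero_div,
          add_zero]
        exact isZ_zero
      · rw [prodB_apply, norm_ev_sub hij]
        simp


/-- For each of the four unordered pairs of root systems `{E₈³, D₈³}`,
`{D₁₆⊕E₈, A₁₅⊕D₉}`, `{D₁₂², A₁₂²}`, `{D₂₄, A₂₄}` there is exactly one isometry class of odd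
Niemeier lattice whose two even neighbors have root sublattices isometric to the members of
that pair. Odd Niemeier lattices are realized inside the ambient space `ℚ²⁴` with an arbitrary
positive-definite symmetric bilinear form. -/
theorem stmt17 :
    ((∃ (B : (Fin 24 → ℚ) →ₗ[ℚ] (Fin 24 → ℚ) →ₗ[ℚ] ℚ) (N : Submodule ℤ (Fin 24 → ℚ)),
        NeighborsRootPair B N
          (prodForm (stdDot 8) (prodForm (stdDot 8) (stdDot 8))) (latE8.prod (latE8.prod latE8))
          (prodForm (stdDot 8) (prodForm (stdDot 8) (stdDot 8)))
          ((latD 8).prod ((latD 8).prod (latD 8)))) ∧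
      ∀ (B₁ : (Fin 24 → ℚ) →ₗ[ℚ] (Fin 24 → ℚ) →ₗ[ℚ] ℚ) (N₁ : Submodule ℤ (Fin 24 → ℚ))
        (B₂ : (Fin 24 → ℚ) →ₗ[ℚ] (Fin 24 → ℚ) →ₗ[ℚ] ℚ) (N₂ : Submodule ℤ (Fin 24 → ℚ)),
        NeighborsRootPair B₁ N₁
          (prodForm (stdDot 8) (prodForm (stdDot 8) (stdDot 8))) (latE8.prod (latE8.prod latE8))
          (prodForm (stdDot 8) (prodForm (stdDot 8) (stdDot 8)))
          ((latD 8).prod ((latD 8).prod (latD 8))) →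
        NeighborsRootPair B₂ N₂
          (prodForm (stdDot 8) (prodForm (stdDot 8) (stdDot 8))) (latE8.prod (latE8.prod latE8))
          (prodForm (stdDot 8) (prodForm (stdDot 8) (stdDot 8)))
          ((latD 8).prod ((latD 8).prod (latD 8))) →
        LatticeIsometric (fun x y => B₁ x y) (fun x y => B₂ x y) N₁ N₂) ∧
    ((∃ (B : (Fin 24 → ℚ) →ₗ[ℚ] (Fin 24 → ℚ) →ₗ[ℚ] ℚ) (N : Submodule ℤ (Fin 24 → ℚ)),
        NeighborsRootPair B N
          (prodForm (stdDot 16) (stdDot 8)) ((latD 16).prod latE8)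
          (prodForm (stdDot 16) (stdDot 9)) ((latA 15).prod (latD 9))) ∧
      ∀ (B₁ : (Fin 24 → ℚ) →ₗ[ℚ] (Fin 24 → ℚ) →ₗ[ℚ] ℚ) (N₁ : Submodule ℤ (Fin 24 → ℚ))
        (B₂ : (Fin 24 → ℚ) →ₗ[ℚ] (Fin 24 → ℚ) →ₗ[ℚ] ℚ) (N₂ : Submodule ℤ (Fin 24 → ℚ)),
        NeighborsRootPair B₁ N₁
          (prodForm (stdDot 16) (stdDot 8)) ((latD 16).prod latE8)
          (prodForm (stdDot 16) (stdDot 9)) ((latA 15).prod (latD 9)) →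
        NeighborsRootPair B₂ N₂
          (prodForm (stdDot 16) (stdDot 8)) ((latD 16).prod latE8)
          (prodForm (stdDot 16) (stdDot 9)) ((latA 15).prod (latD 9)) →
        LatticeIsometric (fun x y => B₁ x y) (fun x y => B₂ x y) N₁ N₂) ∧
    ((∃ (B : (Fin 24 → ℚ) →ₗ[ℚ] (Fin 24 → ℚ) →ₗ[ℚ] ℚ) (N : Submodule ℤ (Fin 24 → ℚ)),
        NeighborsRootPair B N
          (prodForm (stdDot 12) (stdDot 12)) ((latD 12).prod (latD 12))
          (prodForm (stdDot 13) (stdDot 13)) ((latA 12).prod (latA 12))) ∧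
      ∀ (B₁ : (Fin 24 → ℚ) →ₗ[ℚ] (Fin 24 → ℚ) →ₗ[ℚ] ℚ) (N₁ : Submodule ℤ (Fin 24 → ℚ))
        (B₂ : (Fin 24 → ℚ) →ₗ[ℚ] (Fin 24 → ℚ) →ₗ[ℚ] ℚ) (N₂ : Submodule ℤ (Fin 24 → ℚ)),
        NeighborsRootPair B₁ N₁
          (prodForm (stdDot 12) (stdDot 12)) ((latD 12).prod (latD 12))
          (prodForm (stdDot 13) (stdDot 13)) ((latA 12).prod (latA 12)) →
        NeighborsRootPair B₂ N₂
          (prodForm (stdDot 12) (stdDot 12)) ((latD 12).prod (latD 12))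
          (prodForm (stdDot 13) (stdDot 13)) ((latA 12).prod (latA 12)) →
        LatticeIsometric (fun x y => B₁ x y) (fun x y => B₂ x y) N₁ N₂) ∧
    ((∃ (B : (Fin 24 → ℚ) →ₗ[ℚ] (Fin 24 → ℚ) →ₗ[ℚ] ℚ) (N : Submodule ℤ (Fin 24 → ℚ)),
        NeighborsRootPair B N (stdDot 24) (latD 24) (stdDot 25) (latA 24)) ∧
      ∀ (B₁ : (Fin 24 → ℚ) →ₗ[ℚ] (Fin 24 → ℚ) →ₗ[ℚ] ℚ) (N₁ : Submodule ℤ (Fin 24 → ℚ))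
        (B₂ : (Fin 24 → ℚ) →ₗ[ℚ] (Fin 24 → ℚ) →ₗ[ℚ] ℚ) (N₂ : Submodule ℤ (Fin 24 → ℚ)),
        NeighborsRootPair B₁ N₁ (stdDot 24) (latD 24) (stdDot 25) (latA 24) →
        NeighborsRootPair B₂ N₂ (stdDot 24) (latD 24) (stdDot 25) (latA 24) →
        LatticeIsometric (fun x y => B₁ x y) (fun x y => B₂ x y) N₁ N₂) := by
  exact ⟨⟨exist_fin case1_exist, fun _ _ _ _ h₁ h₂ => case1_unique h₁ h₂⟩,
    ⟨exist_fin case2_exist, fun _ _ _ _ h₁ h₂ => case2_unique h₁ h₂⟩,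
    ⟨exist_fin case3_exist, fun _ _ _ _ h₁ h₂ => case3_unique h₁ h₂⟩,
    ⟨exist_fin case4_exist, fun _ _ _ _ h₁ h₂ => case4_unique h₁ h₂⟩⟩

end Niemeier
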